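/- For a ∈ (0,a*) let u_a be a minimizer of e(a), ε_a = (∫_{ℝ²}|∇|u_a||² dx)^{−1/2}, x_a a global maximum point of |u_a|, and w_a(x) = ε_a u_a(ε_a x + x_a) e^{−i((ε_a Ω/2) x·x_a^⊥ − θ_a)}. Then there exist R > 0 and a constant C > 0, both independent of a, such that |w_a(x)| ≤ C e^{−|x|/(3√a*)} for all |x| ≥ R, uniformly for a sufficiently close to a*. -/

import Mathlib

open MeasureTheory Filter Topology Set Metric

noncomputable section

/-- The plane `ℝ²` with the Euclidean norm. -/
abbrev Plane : Type := EuclideanSpace ℝ (Fin 2)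

def e0 : Plane := EuclideanSpace.single (0 : Fin 2) (1 : ℝ)
def e1 : Plane := EuclideanSpace.single (1 : Fin 2) (1 : ℝ)

/-- Partial derivatives of a complex-valued function. -/
def d0 (u : Plane → ℂ) (x : Plane) : ℂ := fderiv ℝ u x e0
def d1 (u : Plane → ℂ) (x : Plane) : ℂ := fderiv ℝ u x e1

/-- `|∇u|²` for complex-valued `u`. -/
def gradSq (u : Plane → ℂ) (x : Plane) : ℝ := ‖d0 u x‖ ^ 2 + ‖d1 u x‖ ^ 2

/-- `|∇|u||²`. -/
def gradAbsSq (u : Plane → ℂ) (x : Plane) : ℝ := ‖fderiv ℝ (fun y => ‖u y‖) x‖ ^ 2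

/-- Membership in `H¹(ℝ², ℂ)` (smooth-representative formulation). -/
def InH1 (u : Plane → ℂ) : Prop :=
  Differentiable ℝ u ∧ Integrable (fun x => ‖u x‖ ^ 2) ∧ Integrable (gradSq u)

/-- Membership in the space `𝓗 = {u ∈ H¹ : ∫ V |u|² < ∞}`. -/
def InH (V : Plane → ℝ) (u : Plane → ℂ) : Prop :=
  InH1 u ∧ Integrable (fun x => V x * ‖u x‖ ^ 2)

/-- The constraint set `S_a`. -/
def Sset (V : Plane → ℝ) (a : ℝ) : Set (Plane → ℂ) :=
  {u | InH V u ∧ (∫ x : Plane, ‖u x‖ ^ 2) = a}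

/-- The momentum density `x^⊥ · (iu, ∇u)`, with `x^⊥ = (-x₂, x₁)` and
`(iu,∇u)_j = Im(ū ∂_j u)`. -/
def momentum (u : Plane → ℂ) (x : Plane) : ℝ :=
  (-(x 1)) * ((starRingEnd ℂ) (u x) * d0 u x).im + (x 0) * ((starRingEnd ℂ) (u x) * d1 u x).im

/-- The logarithmic convolution term `∫∫ ln|x-y| |u(x)|²|u(y)|²`. -/
def logConv (u : Plane → ℂ) : ℝ :=
  ∫ x : Plane, ∫ y : Plane, Real.log ‖x - y‖ * ‖u x‖ ^ 2 * ‖u y‖ ^ 2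

/-- The energy functional `E_a`. -/
def Ea (V : Plane → ℝ) (Ω : ℝ) (u : Plane → ℂ) : ℝ :=
  (∫ x : Plane, (gradSq u x + V x * ‖u x‖ ^ 2)) + (1 / 2) * logConv u
    - (1 / 2) * (∫ x : Plane, ‖u x‖ ^ 4) - Ω * (∫ x : Plane, momentum u x)

/-- `u` is a minimizer of `e(a) = inf_{S_a} E_a`. -/
def IsMinimizer (V : Plane → ℝ) (Ω a : ℝ) (u : Plane → ℂ) : Prop :=
  u ∈ Sset V a ∧ ∀ v ∈ Sset V a, Ea V Ω u ≤ Ea V Ω v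

/-- `e(a) = inf_{u ∈ S_a} E_a(u)`. -/
def eInf (V : Plane → ℝ) (Ω a : ℝ) : ℝ := sInf (Ea V Ω '' Sset V a)

/-- `f(x) → ∞` as `|x| → ∞`. -/
def TendsInfty (f : Plane → ℝ) : Prop := ∀ M : ℝ, ∃ R : ℝ, ∀ x : Plane, R ≤ ‖x‖ → M ≤ f x

/-- Hypotheses (1.10): `0 ≤ V ∈ L^∞_loc` and `liminf_{|x|→∞} V(x)/|x|² > 0`. -/
def V110 (V : Plane → ℝ) : Prop :=
  Measurable V ∧ (∀ x, 0 ≤ V x) ∧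
  (∀ R : ℝ, ∃ C : ℝ, ∀ x : Plane, ‖x‖ ≤ R → V x ≤ C) ∧
  (∃ c : ℝ, 0 < c ∧ ∃ R : ℝ, ∀ x : Plane, R ≤ ‖x‖ → c * ‖x‖ ^ 2 ≤ V x)

/-- The set of rotational velocities `W > 0` with `V(x) - (W²/4)|x|² → ∞`;
`Ω* = sup RotSet V`. -/
def RotSet (V : Plane → ℝ) : Set ℝ :=
  {W : ℝ | 0 < W ∧ TendsInfty (fun x => V x - W ^ 2 / 4 * ‖x‖ ^ 2)}

/-- `Ω < Ω*` where `Ω* = sup RotSet V` (possibly `+∞`). -/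
def SubCritical (V : Plane → ℝ) (Ω : ℝ) : Prop := ∃ W ∈ RotSet V, Ω < W

def d0R (q : Plane → ℝ) (x : Plane) : ℝ := fderiv ℝ q x e0
def d1R (q : Plane → ℝ) (x : Plane) : ℝ := fderiv ℝ q x e1

/-- `|∇q|²` for real-valued `q`. -/
def gradSqR (q : Plane → ℝ) (x : Plane) : ℝ := (d0R q x) ^ 2 + (d1R q x) ^ 2

/-- The Laplacian of a real-valued function. -/
def lapR (q : Plane → ℝ) (x : Plane) : ℝ := fderiv ℝ (d0R q) x e0 + fderiv ℝ (d1R q) x e1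

/-- `Q` is the positive radially symmetric `H¹` solution of `-ΔQ + Q - Q³ = 0` on `ℝ²`. -/
def IsGroundState (Q : Plane → ℝ) : Prop :=
  ContDiff ℝ 2 Q ∧ (∀ x, 0 < Q x) ∧ (∀ x y : Plane, ‖x‖ = ‖y‖ → Q x = Q y) ∧
  Integrable (fun x => (Q x) ^ 2) ∧ Integrable (fun x => ‖fderiv ℝ Q x‖ ^ 2) ∧
  (∀ x, - lapR Q x + Q x - (Q x) ^ 3 = 0)

/-- The Laplacian of a complex-valued function. -/
def lapC (u : Plane → ℂ) (x : Plane) : ℂ := fderiv ℝ (d0 u) x e0 + fderiv ℝ (d1 u) x e1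

/-- The Euler–Lagrange equation (1.18):
`-Δu + V u + (∫ ln|x-y||u(y)|² dy) u + iΩ (x^⊥·∇u) = μ u + |u|² u`. -/
def EulerLagrange (V : Plane → ℝ) (Ω : ℝ) (u : Plane → ℂ) (μ : ℝ) : Prop :=
  ∀ x : Plane,
    - lapC u x + (V x : ℂ) * u x
      + (((∫ y : Plane, Real.log ‖x - y‖ * ‖u y‖ ^ 2) : ℝ) : ℂ) * u x
      + Complex.I * (Ω : ℂ) * (((-(x 1) : ℝ) : ℂ) * d0 u x + ((x 0 : ℝ) : ℂ) * d1 u x)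
    = (μ : ℂ) * u x + ((‖u x‖ ^ 2 : ℝ) : ℂ) * u x

/-- Condition (V): `0 ≤ V_Ω ∈ C^α_loc`, `V_Ω` vanishes only at the origin, and `V` has at
most exponential growth. Here `V_Ω(x) = V(x) - (Ω²/4)|x|²`. -/
def CondV (V : Plane → ℝ) (Ω α : ℝ) : Prop :=
  α ∈ Ioo (0 : ℝ) 1 ∧
  (∀ x : Plane, 0 ≤ V x - Ω ^ 2 / 4 * ‖x‖ ^ 2) ∧
  (∀ x : Plane, V x - Ω ^ 2 / 4 * ‖x‖ ^ 2 = 0 ↔ x = 0) ∧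
  (∀ R : ℝ, 0 < R → ∃ C : ℝ, ∀ x ∈ closedBall (0 : Plane) R, ∀ y ∈ closedBall (0 : Plane) R,
    |(V x - Ω ^ 2 / 4 * ‖x‖ ^ 2) - (V y - Ω ^ 2 / 4 * ‖y‖ ^ 2)| ≤ C * ‖x - y‖ ^ α) ∧
  (∃ C γ : ℝ, 0 < γ ∧ ∀ x : Plane, V x ≤ C * Real.exp (γ * ‖x‖))

/-- `ε_a = (∫ |∇|u_a||²)^{-1/2}` for a family of minimizers. -/
def epsOf (u : ℝ → Plane → ℂ) (a : ℝ) : ℝ :=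
  (∫ x : Plane, gradAbsSq (u a) x) ^ (-(1 : ℝ) / 2)

/-- The rescaled family
`w_a(y) = ε_a u_a(ε_a y + x_a) e^{-i((ε_a Ω/2) y·x_a^⊥ - θ)}`. -/
def wfam (Ω : ℝ) (u : ℝ → Plane → ℂ) (xa : ℝ → Plane) (a θv : ℝ) (y : Plane) : ℂ :=
  ((epsOf u a : ℝ) : ℂ) * u a ((epsOf u a) • y + xa a) *
    Complex.exp (-Complex.I *
      ((((epsOf u a * Ω / 2) * (-(y 0) * (xa a 1) + (y 1) * (xa a 0)) - θv) : ℝ) : ℂ))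

/-- The limit profile `(1/√a*) Q(x/√a*)` where `a* = ‖Q‖₂²`. -/
def Qstar (Q : Plane → ℝ) (x : Plane) : ℝ :=
  (Real.sqrt (∫ y : Plane, (Q y) ^ 2))⁻¹ * Q ((Real.sqrt (∫ y : Plane, (Q y) ^ 2))⁻¹ • x)

lemma inner_e0 (x : Plane) : inner ℝ x e0 = x 0 := by
  simp [e0, EuclideanSpace.inner_single_right]

lemma inner_e1 (x : Plane) : inner ℝ x e1 = x 1 := by
  simp [e1, EuclideanSpace.inner_single_right]

lemma norm_sq_plane (x : Plane) : ‖x‖ ^ 2 = x 0 ^ 2 + x 1 ^ 2 := by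
  rw [EuclideanSpace.real_norm_sq_eq]; simp [Fin.sum_univ_two]

lemma opNorm_sq_eq (L : Plane →L[ℝ] ℝ) : ‖L‖ ^ 2 = (L e0) ^ 2 + (L e1) ^ 2 := by
  obtain ⟨v, rfl⟩ := (InnerProductSpace.toDual ℝ Plane).surjective L
  rw [LinearIsometryEquiv.norm_map, norm_sq_plane, InnerProductSpace.toDual_apply_apply,
    InnerProductSpace.toDual_apply_apply, inner_e0, inner_e1]

/-- The pointwise product `∇f · ∇h`. -/
def gradDot (f h : Plane → ℝ) (x : Plane) : ℝ := d0R f x * d0R h x + d1R f x * d1R h x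

lemma abs_gradDot_le (f h : Plane → ℝ) (x : Plane) :
    |gradDot f h x| ≤ ‖fderiv ℝ f x‖ * ‖fderiv ℝ h x‖ := by
  apply abs_le_of_sq_le_sq _ (by positivity)
  rw [mul_pow, opNorm_sq_eq, opNorm_sq_eq, gradDot]
  simp only [d0R, d1R]
  nlinarith [sq_nonneg ((fderiv ℝ f x) e0 * (fderiv ℝ h x) e1
    - (fderiv ℝ f x) e1 * (fderiv ℝ h x) e0)]

/-- Compactly supported `C²` test functions. -/
def IsTest (φ : Plane → ℝ) : Prop := ContDiff ℝ 2 φ ∧ HasCompactSupport φ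

lemma contDiff_d0R {φ : Plane → ℝ} (h : ContDiff ℝ 2 φ) : ContDiff ℝ 1 (d0R φ) :=
  (h.fderiv_right (m := 1) (by norm_num)).clm_apply contDiff_const

lemma contDiff_d1R {φ : Plane → ℝ} (h : ContDiff ℝ 2 φ) : ContDiff ℝ 1 (d1R φ) :=
  (h.fderiv_right (m := 1) (by norm_num)).clm_apply contDiff_const

lemma continuous_lapR {φ : Plane → ℝ} (h : ContDiff ℝ 2 φ) : Continuous (lapR φ) :=
  (((contDiff_d0R h).continuous_fderiv (by norm_num)).clm_apply continuous_const).add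
    (((contDiff_d1R h).continuous_fderiv (by norm_num)).clm_apply continuous_const)

lemma hasCompactSupport_d0R {φ : Plane → ℝ} (h : HasCompactSupport φ) :
    HasCompactSupport (d0R φ) := h.fderiv_apply (𝕜 := ℝ) e0

lemma hasCompactSupport_d1R {φ : Plane → ℝ} (h : HasCompactSupport φ) :
    HasCompactSupport (d1R φ) := h.fderiv_apply (𝕜 := ℝ) e1

lemma differentiable_of_contDiff_two {φ : Plane → ℝ} (h : ContDiff ℝ 2 φ) :
    Differentiable ℝ φ := h.differentiable (by norm_num)

/-- Integration by parts against a test function. -/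
lemma integral_mul_lapR {h φ : Plane → ℝ} (hh : Differentiable ℝ h) (hφ : IsTest φ)
    (h0 : Integrable (fun x => d0R h x * d0R φ x))
    (h1 : Integrable (fun x => d1R h x * d1R φ x)) :
    ∫ x, h x * lapR φ x = - ∫ x, gradDot h φ x := by
  have c0 := contDiff_d0R hφ.1
  have c1 := contDiff_d1R hφ.1
  have s0 := hasCompactSupport_d0R hφ.2
  have s1 := hasCompactSupport_d1R hφ.2
  have i0 : Integrable (fun x => h x * fderiv ℝ (d0R φ) x e0) :=
    (hh.continuous.mul ((c0.continuous_fderiv (by norm_num)).clm_apply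
      continuous_const)).integrable_of_hasCompactSupport
        ((s0.fderiv_apply (𝕜 := ℝ) e0).mul_left)
  have i1 : Integrable (fun x => h x * fderiv ℝ (d1R φ) x e1) :=
    (hh.continuous.mul ((c1.continuous_fderiv (by norm_num)).clm_apply
      continuous_const)).integrable_of_hasCompactSupport
        ((s1.fderiv_apply (𝕜 := ℝ) e1).mul_left)
  have p0 := integral_mul_fderiv_eq_neg_fderiv_mul_of_integrable (μ := volume)
    (f := h) (g := d0R φ) (v := e0) h0 i0
    ((hh.continuous.mul c0.continuous).integrable_of_hasCompactSupport s0.mul_left)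
    (fun x _ => hh x) (fun x _ => c0.differentiable (by norm_num) x)
  have p1 := integral_mul_fderiv_eq_neg_fderiv_mul_of_integrable (μ := volume)
    (f := h) (g := d1R φ) (v := e1) h1 i1
    ((hh.continuous.mul c1.continuous).integrable_of_hasCompactSupport s1.mul_left)
    (fun x _ => hh x) (fun x _ => c1.differentiable (by norm_num) x)
  have e : ∀ x, h x * lapR φ x
      = h x * fderiv ℝ (d0R φ) x e0 + h x * fderiv ℝ (d1R φ) x e1 := fun x => by
    rw [lapR]; ring
  simp only [e, gradDot]
  rw [integral_add i0 i1, p0, p1, integral_add h0 h1]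
  simp only [d0R, d1R]
  ring

lemma d0R_mul {f h : Plane → ℝ} (hf : Differentiable ℝ f) (hh : Differentiable ℝ h) (x : Plane) :
    d0R (fun y => f y * h y) x = f x * d0R h x + h x * d0R f x := by
  simp only [d0R]; rw [fderiv_fun_mul (hf x) (hh x)]; simp

lemma d1R_mul {f h : Plane → ℝ} (hf : Differentiable ℝ f) (hh : Differentiable ℝ h) (x : Plane) :
    d1R (fun y => f y * h y) x = f x * d1R h x + h x * d1R f x := by
  simp only [d1R]; rw [fderiv_fun_mul (hf x) (hh x)]; simp

lemma lapR_mul {f h : Plane → ℝ} (hf : ContDiff ℝ 2 f) (hh : ContDiff ℝ 2 h) (x : Plane) :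
    lapR (fun y => f y * h y) x = f x * lapR h x + 2 * gradDot f h x + h x * lapR f x := by
  have df := differentiable_of_contDiff_two hf
  have dh := differentiable_of_contDiff_two hh
  have f0 := (contDiff_d0R hf).differentiable (by norm_num)
  have f1 := (contDiff_d1R hf).differentiable (by norm_num)
  have h0 := (contDiff_d0R hh).differentiable (by norm_num)
  have h1 := (contDiff_d1R hh).differentiable (by norm_num)
  have e0' : d0R (fun y => f y * h y) = fun y => f y * d0R h y + h y * d0R f y :=
    funext (d0R_mul df dh)
  have e1' : d1R (fun y => f y * h y) = fun y => f y * d1R h y + h y * d1R f y :=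
    funext (d1R_mul df dh)
  simp only [lapR, gradDot]
  rw [e0', e1', fderiv_fun_add ((df x).fun_mul (h0 x)) ((dh x).fun_mul (f0 x)),
    fderiv_fun_add ((df x).fun_mul (h1 x)) ((dh x).fun_mul (f1 x)),
    fderiv_fun_mul (df x) (h0 x), fderiv_fun_mul (dh x) (f0 x),
    fderiv_fun_mul (df x) (h1 x), fderiv_fun_mul (dh x) (f1 x)]
  simp only [_root_.add_apply, _root_.smul_apply, smul_eq_mul]
  simp only [d0R, d1R]
  ring

lemma hasFDerivAt_normSq (c x : Plane) :
    HasFDerivAt (fun y : Plane => ‖y - c‖ ^ 2) ((2 : ℝ) • innerSL ℝ (x - c)) x := by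
  have := ((hasFDerivAt_id x).sub_const c).norm_sq
  refine this.congr_fderiv ?_
  ext v; simp [two_smul]

lemma hasFDerivAt_radial {F : ℝ → ℝ} {c x : Plane} {F1 : ℝ}
    (hF : HasDerivAt F F1 (‖x - c‖ ^ 2)) :
    HasFDerivAt (fun y : Plane => F (‖y - c‖ ^ 2)) (F1 • ((2 : ℝ) • innerSL ℝ (x - c))) x :=
  hF.comp_hasFDerivAt x (hasFDerivAt_normSq c x)

lemma contDiff_radial {F : ℝ → ℝ} {n : WithTop ℕ∞} (hF : ContDiff ℝ n F) (c : Plane) :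
    ContDiff ℝ n (fun y : Plane => F (‖y - c‖ ^ 2)) :=
  hF.comp ((contDiff_id.sub contDiff_const).norm_sq ℝ)

lemma norm_fderiv_radial {F : ℝ → ℝ} {c x : Plane} {F1 : ℝ}
    (hF : HasDerivAt F F1 (‖x - c‖ ^ 2)) :
    ‖fderiv ℝ (fun y : Plane => F (‖y - c‖ ^ 2)) x‖ = 2 * |F1| * ‖x - c‖ := by
  rw [(hasFDerivAt_radial hF).fderiv, norm_smul, norm_smul, innerSL_apply_norm]
  simp; ring

lemma d0R_radial {F : ℝ → ℝ} {c x : Plane} {F1 : ℝ}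
    (hF : HasDerivAt F F1 (‖x - c‖ ^ 2)) :
    d0R (fun y : Plane => F (‖y - c‖ ^ 2)) x = F1 * (2 * (x 0 - c 0)) := by
  rw [d0R, (hasFDerivAt_radial hF).fderiv]
  simp [innerSL_apply_apply, inner_e0]

lemma d1R_radial {F : ℝ → ℝ} {c x : Plane} {F1 : ℝ}
    (hF : HasDerivAt F F1 (‖x - c‖ ^ 2)) :
    d1R (fun y : Plane => F (‖y - c‖ ^ 2)) x = F1 * (2 * (x 1 - c 1)) := by
  rw [d1R, (hasFDerivAt_radial hF).fderiv]
  simp [innerSL_apply_apply, inner_e1]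

lemma hasFDerivAt_coord (i : Fin 2) (x : Plane) :
    HasFDerivAt (fun y : Plane => y i) (EuclideanSpace.proj i : Plane →L[ℝ] ℝ) x :=
  (EuclideanSpace.proj i : Plane →L[ℝ] ℝ).hasFDerivAt

lemma lapR_radial {F F1 F2 : ℝ → ℝ} (c : Plane) (hF : ∀ t, HasDerivAt F (F1 t) t)
    (hF1 : ∀ t, HasDerivAt F1 (F2 t) t) (x : Plane) :
    lapR (fun y : Plane => F (‖y - c‖ ^ 2)) x
      = 4 * F1 (‖x - c‖ ^ 2) + 4 * ‖x - c‖ ^ 2 * F2 (‖x - c‖ ^ 2) := by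
  have e0' : d0R (fun y : Plane => F (‖y - c‖ ^ 2))
      = fun y => F1 (‖y - c‖ ^ 2) * (2 * (y 0 - c 0)) := funext fun y => d0R_radial (hF _)
  have e1' : d1R (fun y : Plane => F (‖y - c‖ ^ 2))
      = fun y => F1 (‖y - c‖ ^ 2) * (2 * (y 1 - c 1)) := funext fun y => d1R_radial (hF _)
  rw [lapR, e0', e1']
  have k0 : HasFDerivAt (fun y : Plane => 2 * (y 0 - c 0))
      ((2 : ℝ) • (EuclideanSpace.proj 0 : Plane →L[ℝ] ℝ)) x :=
    ((hasFDerivAt_coord 0 x).sub_const _).const_mul 2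
  have k1 : HasFDerivAt (fun y : Plane => 2 * (y 1 - c 1))
      ((2 : ℝ) • (EuclideanSpace.proj 1 : Plane →L[ℝ] ℝ)) x :=
    ((hasFDerivAt_coord 1 x).sub_const _).const_mul 2
  rw [((hasFDerivAt_radial (hF1 _)).fun_mul k0).fderiv,
    ((hasFDerivAt_radial (hF1 _)).fun_mul k1).fderiv,
    norm_sq_plane]
  simp [innerSL_apply_apply, inner_e0, inner_e1]
  simp [e0, e1]
  ring

lemma contDiff_planeWave {h : ℝ → ℝ} {n : WithTop ℕ∞} (hh : ContDiff ℝ n h) (e c : Plane) :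
    ContDiff ℝ n (fun y : Plane => h (inner ℝ e (y - c))) :=
  hh.comp (contDiff_const.inner ℝ (contDiff_id.sub contDiff_const))

lemma hasFDerivAt_planeWave {h : ℝ → ℝ} {e c x : Plane} {h1 : ℝ}
    (hh : HasDerivAt h h1 (inner ℝ e (x - c))) :
    HasFDerivAt (fun y : Plane => h (inner ℝ e (y - c))) (h1 • innerSL ℝ e) x := by
  have : HasFDerivAt (fun y : Plane => inner ℝ e (y - c)) (innerSL ℝ e) x := by
    have := (innerSL ℝ e).hasFDerivAt.comp x ((hasFDerivAt_id x).sub_const c)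
    exact this
  exact hh.comp_hasFDerivAt x this

lemma lapR_planeWave {h h1 h2 : ℝ → ℝ} (e c : Plane) (he : ‖e‖ = 1)
    (hh : ∀ t, HasDerivAt h (h1 t) t)
    (hh1 : ∀ t, HasDerivAt h1 (h2 t) t) (x : Plane) :
    lapR (fun y : Plane => h (inner ℝ e (y - c))) x = h2 (inner ℝ e (x - c)) := by
  have e0' : d0R (fun y : Plane => h (inner ℝ e (y - c)))
      = fun y => h1 (inner ℝ e (y - c)) * e 0 := funext fun y => by
    rw [d0R, (hasFDerivAt_planeWave (hh _)).fderiv]; simp [innerSL_apply_apply, inner_e0]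
  have e1' : d1R (fun y : Plane => h (inner ℝ e (y - c)))
      = fun y => h1 (inner ℝ e (y - c)) * e 1 := funext fun y => by
    rw [d1R, (hasFDerivAt_planeWave (hh _)).fderiv]; simp [innerSL_apply_apply, inner_e1]
  have hn : e 0 ^ 2 + e 1 ^ 2 = 1 := by rw [← norm_sq_plane, he]; norm_num
  rw [lapR, e0', e1', ((hasFDerivAt_planeWave (hh1 _)).mul_const _).fderiv,
    ((hasFDerivAt_planeWave (hh1 _)).mul_const _).fderiv]
  simp [innerSL_apply_apply, inner_e0, inner_e1]
  linear_combination (h2 (inner ℝ e (x - c))) * hn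

/-- `g` is a distributional solution of `Δg ≥ 2 (l - g) g`. -/
def SubSol (g : Plane → ℝ) (l : ℝ) : Prop :=
  ∀ φ : Plane → ℝ, IsTest φ → (∀ x, 0 ≤ φ x) →
    2 * ∫ x, (l - g x) * g x * φ x ≤ ∫ x, g x * lapR φ x

lemma hasDerivAt_max_pow (n : ℕ) (t : ℝ) :
    HasDerivAt (fun s : ℝ => (max s 0) ^ (n + 2)) ((n + 2) * (max t 0) ^ (n + 1)) t := by
  rcases lt_trichotomy t 0 with h | h | h
  · have : (fun s : ℝ => (max s 0) ^ (n + 2)) =ᶠ[𝓝 t] fun _ => 0 := by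
      filter_upwards [gt_mem_nhds h] with s hs
      simp [max_eq_right hs.le]
    simpa [max_eq_right h.le] using (hasDerivAt_const t (0 : ℝ)).congr_of_eventuallyEq this
  · subst h
    simp only [max_self, ne_eq, Nat.add_eq_zero_iff, one_ne_zero, and_false, not_false_eq_true,
      zero_pow, mul_zero]
    rw [hasDerivAt_iff_isLittleO_nhds_zero]
    simp only [zero_add, max_self, smul_zero, sub_zero, ne_eq, Nat.add_eq_zero_iff,
      OfNat.ofNat_ne_zero, and_false, not_false_eq_true, zero_pow]
    have h1 : (fun h : ℝ => (max h 0) ^ (n + 2)) =O[𝓝 0] fun h : ℝ => h ^ (n + 2) := by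
      apply Asymptotics.IsBigO.of_bound 1
      filter_upwards with h
      rw [one_mul, norm_pow, norm_pow]
      gcongr
      rw [Real.norm_eq_abs, Real.norm_eq_abs, abs_of_nonneg (le_max_right _ _)]
      exact max_le (le_abs_self h) (abs_nonneg h)
    refine h1.trans_isLittleO ?_
    have := Asymptotics.isLittleO_pow_pow (𝕜 := ℝ) (show 1 < n + 2 by omega)
    simpa using this
  · have : (fun s : ℝ => (max s 0) ^ (n + 2)) =ᶠ[𝓝 t] fun s => s ^ (n + 2) := by
      filter_upwards [lt_mem_nhds h] with s hs
      simp [max_eq_left hs.le]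
    have h2 := (hasDerivAt_pow (n + 2) t).congr_of_eventuallyEq this
    have h3 : ((n : ℝ) + 2) * t ^ (n + 1) = ((n + 2 : ℕ) : ℝ) * t ^ (n + 2 - 1) := by
      push_cast; rfl
    rw [max_eq_left h.le, h3]
    exact h2

lemma contDiff_max_cube : ContDiff ℝ 2 (fun s : ℝ => (max s 0) ^ 3) := by
  have e1 : deriv (fun s : ℝ => (max s 0) ^ 3) = fun s => 3 * (max s 0) ^ 2 := by
    ext s; rw [(hasDerivAt_max_pow 1 s).deriv]; norm_num
  have e2 : deriv (fun s : ℝ => 3 * (max s 0) ^ 2) = fun s => 6 * max s 0 := by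
    ext s; rw [((hasDerivAt_max_pow 0 s).const_mul 3).deriv]; norm_num; ring
  rw [show (2 : WithTop ℕ∞) = 1 + 1 by norm_num, contDiff_succ_iff_deriv]
  refine ⟨fun s => (hasDerivAt_max_pow 1 s).differentiableAt, by simp, ?_⟩
  rw [e1, contDiff_one_iff_deriv]
  refine ⟨fun s => ((hasDerivAt_max_pow 0 s).const_mul 3).differentiableAt, ?_⟩
  rw [e2]; fun_prop

/-- The bump `(1 - |y - c|² / s²)₊³`. -/
def cubeBump (c : Plane) (s : ℝ) (y : Plane) : ℝ := (max (1 - ‖y - c‖ ^ 2 / s ^ 2) 0) ^ 3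

/-- The rescaled kernel `s⁻² · 3 (1 - |y - c|² / s²)₊²`. -/
def sqKernel (c : Plane) (s : ℝ) (y : Plane) : ℝ :=
  3 * (max (1 - ‖y - c‖ ^ 2 / s ^ 2) 0) ^ 2 / s ^ 2

lemma max_bump_eq_zero {c y : Plane} {s : ℝ} (hs : 0 < s) (h : s ≤ ‖y - c‖) :
    max (1 - ‖y - c‖ ^ 2 / s ^ 2) 0 = 0 := by
  apply max_eq_right
  have : 1 ≤ ‖y - c‖ ^ 2 / s ^ 2 := by
    rw [le_div_iff₀ (by positivity)]; nlinarith
  linarith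

lemma max_bump_le_one (c y : Plane) (s : ℝ) : max (1 - ‖y - c‖ ^ 2 / s ^ 2) 0 ≤ 1 := by
  apply max_le _ zero_le_one
  have : 0 ≤ ‖y - c‖ ^ 2 / s ^ 2 := by positivity
  linarith

lemma hasCompactSupport_of_ball {f : Plane → ℝ} {c : Plane} {s : ℝ}
    (h : ∀ y, s ≤ ‖y - c‖ → f y = 0) : HasCompactSupport f := by
  apply HasCompactSupport.intro (isCompact_closedBall c s)
  intro y hy
  apply h
  rw [mem_closedBall, dist_eq_norm, not_le] at hy
  exact hy.le

lemma isTest_cubeBump (c : Plane) {s : ℝ} (hs : 0 < s) : IsTest (cubeBump c s) := by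
  constructor
  · have : ContDiff ℝ 2 (fun t : ℝ => (max (1 - t / s ^ 2) 0) ^ 3) :=
      contDiff_max_cube.comp (contDiff_const.sub (contDiff_id.div_const _))
    exact contDiff_radial this c
  · apply hasCompactSupport_of_ball (c := c) (s := s)
    intro y hy
    rw [cubeBump, max_bump_eq_zero hs hy]; norm_num

lemma lapR_cubeBump (c : Plane) {s : ℝ} (y : Plane) :
    lapR (cubeBump c s) y = - 12 * (max (1 - ‖y - c‖ ^ 2 / s ^ 2) 0) ^ 2 / s ^ 2
      + 24 * ‖y - c‖ ^ 2 * max (1 - ‖y - c‖ ^ 2 / s ^ 2) 0 / s ^ 4 := by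
  have hl : ∀ t : ℝ, HasDerivAt (fun t : ℝ => 1 - t / s ^ 2) (-(1 / s ^ 2)) t := fun t =>
    ((hasDerivAt_id t).div_const (s ^ 2)).const_sub 1
  have h1 : ∀ t : ℝ, HasDerivAt (fun t : ℝ => (max (1 - t / s ^ 2) 0) ^ 3)
      (3 * (max (1 - t / s ^ 2) 0) ^ 2 * (-(1 / s ^ 2))) t := fun t => by
    have := (hasDerivAt_max_pow 1 (1 - t / s ^ 2)).comp t (hl t)
    norm_num at this ⊢
    exact this
  have h2 : ∀ t : ℝ, HasDerivAt (fun t : ℝ => 3 * (max (1 - t / s ^ 2) 0) ^ 2 * (-(1 / s ^ 2)))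
      (3 * (2 * (max (1 - t / s ^ 2) 0) * (-(1 / s ^ 2))) * (-(1 / s ^ 2))) t := fun t => by
    have := (((hasDerivAt_max_pow 0 (1 - t / s ^ 2)).comp t (hl t)).const_mul 3).mul_const
      (-(1 / s ^ 2))
    norm_num at this ⊢
    exact this
  have := lapR_radial c h1 h2 y
  rw [show cubeBump c s = fun y => (max (1 - ‖y - c‖ ^ 2 / s ^ 2) 0) ^ 3 from rfl, this]
  rcases eq_or_ne s 0 with rfl | hs
  · norm_num
  · field_simp
    ring

lemma hasDerivAt_sqKernel (c y : Plane) {s : ℝ} (hs : 0 < s) :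
    HasDerivAt (fun s => sqKernel c s y) (lapR (cubeBump c s) y / (2 * s)) s := by
  have hl : HasDerivAt (fun s : ℝ => 1 - ‖y - c‖ ^ 2 / s ^ 2) (2 * ‖y - c‖ ^ 2 / s ^ 3) s := by
    have := (((hasDerivAt_pow 2 s).inv (by positivity)).const_mul (‖y - c‖ ^ 2)).const_sub 1
    simp only [Pi.inv_apply, ← div_eq_mul_inv] at this
    convert! this using 1
    push_cast
    field_simp
  have h := (((hasDerivAt_max_pow 0 (1 - ‖y - c‖ ^ 2 / s ^ 2)).comp s hl).const_mul 3).div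
    (hasDerivAt_pow 2 s) (by positivity)
  rw [lapR_cubeBump]
  convert! h using 1
  push_cast
  simp only [Function.comp]
  field_simp
  norm_num
  ring

lemma sqKernel_eq_zero {c y : Plane} {s : ℝ} (hs : 0 < s) (h : s ≤ ‖y - c‖) :
    sqKernel c s y = 0 := by
  rw [sqKernel, max_bump_eq_zero hs h]; norm_num

lemma continuous_sqKernel (c : Plane) (s : ℝ) : Continuous (sqKernel c s) := by
  unfold sqKernel; fun_prop

lemma abs_lapR_cubeBump_le (c y : Plane) {s : ℝ} (hs : 0 < s) :
    |lapR (cubeBump c s) y| ≤ 36 / s ^ 2 := by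
  rw [lapR_cubeBump]
  have h0 : 0 ≤ max (1 - ‖y - c‖ ^ 2 / s ^ 2) 0 := le_max_right _ _
  have h1 := max_bump_le_one c y s
  by_cases h : s ≤ ‖y - c‖
  · rw [max_bump_eq_zero hs h]; norm_num; positivity
  set p := max (1 - ‖y - c‖ ^ 2 / s ^ 2) 0
  have ht : ‖y - c‖ ^ 2 ≤ s ^ 2 := by
    push Not at h; have := norm_nonneg (y - c); nlinarith
  have e : -12 * p ^ 2 / s ^ 2 + 24 * ‖y - c‖ ^ 2 * p / s ^ 4
      = (-12 * p ^ 2 + 24 * (‖y - c‖ ^ 2 / s ^ 2) * p) / s ^ 2 := by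
    field_simp
  have hq : ‖y - c‖ ^ 2 / s ^ 2 ≤ 1 := by rw [div_le_one (by positivity)]; exact ht
  have hq0 : 0 ≤ ‖y - c‖ ^ 2 / s ^ 2 := by positivity
  rw [e, abs_div, abs_of_pos (show 0 < s ^ 2 by positivity)]
  gcongr
  rw [abs_le]
  constructor <;> nlinarith [mul_nonneg hq0 h0, mul_le_one₀ hq h0 h1]

lemma integrable_mul_sqKernel {g : Plane → ℝ} (hg : Continuous g) (c : Plane) {s : ℝ}
    (hs : 0 < s) : Integrable (fun y => g y * sqKernel c s y) :=
  (hg.mul (continuous_sqKernel c s)).integrable_of_hasCompactSupport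
    (hasCompactSupport_of_ball (c := c) (s := s)
      fun y hy => by rw [Pi.mul_apply, sqKernel_eq_zero hs hy, mul_zero])

lemma hasDerivAt_integral_sqKernel {g : Plane → ℝ} (hg : Continuous g) (c : Plane) {s : ℝ}
    (hs : 0 < s) :
    HasDerivAt (fun s => ∫ y, g y * sqKernel c s y)
      ((∫ y, g y * lapR (cubeBump c s) y) / (2 * s)) s := by
  obtain ⟨G, hG⟩ := (isCompact_closedBall c (2 * s)).exists_bound_of_continuousOn hg.continuousOn
  have hG0 : 0 ≤ G := (norm_nonneg _).trans (hG c (mem_closedBall_self (by positivity)))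
  have key := hasDerivAt_integral_of_dominated_loc_of_deriv_le (μ := volume)
    (F := fun s y => g y * sqKernel c s y)
    (F' := fun s y => g y * (lapR (cubeBump c s) y / (2 * s))) (x₀ := s)
    (s := Ioo (s / 2) (2 * s))
    (bound := (closedBall c (2 * s)).indicator fun _ => G * (36 / (s / 2) ^ 2 / s))
    (Ioo_mem_nhds (by linarith) (by linarith))
    (Eventually.of_forall fun r => (hg.mul (continuous_sqKernel c r)).aestronglyMeasurable)
    (integrable_mul_sqKernel hg c hs)
    ((hg.mul ((continuous_lapR (isTest_cubeBump c hs).1).div_const _)).aestronglyMeasurable)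
    (Eventually.of_forall fun y r hr => ?_) ?_
    (Eventually.of_forall fun y r hr => ?_)
  · have e : (fun y => g y * (lapR (cubeBump c s) y / (2 * s)))
        = fun y => g y * lapR (cubeBump c s) y / (2 * s) := by ext y; ring
    have := key.2
    simp only [e, integral_div] at this
    exact this
  · have hr0 : 0 < r := by have := hr.1; linarith
    by_cases hy : y ∈ closedBall c (2 * s)
    · rw [indicator_of_mem hy, norm_mul, norm_div, Real.norm_eq_abs (lapR _ _),
        Real.norm_of_nonneg (show (0:ℝ) ≤ 2 * r by linarith)]
      have h2 := abs_lapR_cubeBump_le c y hr0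
      have h3 : 36 / r ^ 2 ≤ 36 / (s / 2) ^ 2 := by have := hr.1; gcongr
      have h4 : s ≤ 2 * r := by have := hr.1; linarith
      have := hG y hy
      gcongr
      exact h2.trans h3
    · rw [indicator_of_notMem hy]
      have h2 : r ≤ ‖y - c‖ := by
        rw [mem_closedBall, dist_eq_norm, not_le] at hy
        have := hr.2; linarith
      rw [lapR_cubeBump, max_bump_eq_zero hr0 h2]
      norm_num
  · rw [integrable_indicator_iff measurableSet_closedBall]
    exact integrableOn_const (isCompact_closedBall c (2 * s)).measure_ne_top
  · have hr0 : 0 < r := by have := hr.1; linarith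
    exact (hasDerivAt_sqKernel c y hr0).const_mul (g y)

lemma volume_real_ball (c : Plane) {r : ℝ} (hr : 0 ≤ r) :
    volume.real (ball c r) = Real.pi * r ^ 2 := by
  rw [measureReal_def, EuclideanSpace.volume_ball_fin_two, ENNReal.toReal_mul, ENNReal.toReal_pow,
    ENNReal.toReal_ofReal hr]
  simp [Real.pi_pos.le]; ring

lemma cubeBump_nonneg (c y : Plane) (s : ℝ) : 0 ≤ cubeBump c s y :=
  pow_nonneg (le_max_right _ _) 3

lemma sqKernel_nonneg (c y : Plane) (s : ℝ) : 0 ≤ sqKernel c s y := by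
  unfold sqKernel; positivity

lemma continuous_integrableOn_ball {g : Plane → ℝ} (hg : Continuous g) (c : Plane) (r : ℝ) :
    IntegrableOn g (ball c r) :=
  (hg.continuousOn.integrableOn_compact (isCompact_closedBall c r)).mono_set ball_subset_closedBall

/-- A mean value inequality for subsolutions. -/
lemma SubSol.mean_value {g : Plane → ℝ} {l : ℝ} (h : SubSol g l) (hl : 0 ≤ l)
    (hg : Continuous g) (hg0 : ∀ x, 0 ≤ g x) {c : Plane} {r S : ℝ} (hr : 0 < r)
    (hS : ∀ y ∈ ball c r, g y ≤ S) :
    g c / 2 ≤ 3 / r ^ 2 * (∫ y in ball c r, g y) + 2 * S ^ 2 * r ^ 2 := by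
  have hS0 : 0 ≤ S := (hg0 c).trans (hS c (mem_ball_self hr))
  set I : ℝ → ℝ := fun s => ∫ y, g y * sqKernel c s y with hI
  have hpi := Real.pi_lt_four
  have hder : ∀ s ∈ Ioc 0 r, HasDerivAt (fun s => I s + 2 * S ^ 2 * s ^ 2)
      ((∫ y, g y * lapR (cubeBump c s) y) / (2 * s) + 2 * S ^ 2 * (2 * s)) s := fun s hs => by
    have := (hasDerivAt_integral_sqKernel hg c hs.1).add
      ((hasDerivAt_pow 2 s).const_mul (2 * S ^ 2))
    refine this.congr_deriv ?_
    norm_num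
  have hpos : ∀ s ∈ Ioc 0 r,
      0 ≤ (∫ y, g y * lapR (cubeBump c s) y) / (2 * s) + 2 * S ^ 2 * (2 * s) := fun s hs => by
    have h1 := h _ (isTest_cubeBump c hs.1) (fun y => cubeBump_nonneg c y s)
    have h2 : - (S ^ 2 * (Real.pi * s ^ 2)) ≤ ∫ x, (l - g x) * g x * cubeBump c s x := by
      have : - (S ^ 2 * (Real.pi * s ^ 2)) = ∫ x, (ball c s).indicator (fun _ => - S ^ 2) x := by
        rw [integral_indicator measurableSet_ball, setIntegral_const,
          volume_real_ball c hs.1.le, smul_eq_mul]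
        ring
      rw [this]
      apply integral_mono
      · rw [integrable_indicator_iff measurableSet_ball]
        exact integrableOn_const measure_ball_lt_top.ne
      · exact (((continuous_const.sub hg).mul hg).mul
          (isTest_cubeBump c hs.1).1.continuous).integrable_of_hasCompactSupport
          (isTest_cubeBump c hs.1).2.mul_left
      · intro y
        by_cases hy : y ∈ ball c s
        · simp only [indicator_of_mem hy]
          have hb : cubeBump c s y ≤ 1 :=
            pow_le_one₀ (le_max_right _ _) (max_bump_le_one c y s)
          have hb0 := cubeBump_nonneg c y s
          have hgS := hS y (ball_subset_ball hs.2 hy)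
          have hgy := hg0 y
          have e1 : g y * g y * cubeBump c s y ≤ S * S * 1 := by gcongr
          have e2 : 0 ≤ l * g y * cubeBump c s y := by positivity
          nlinarith
        · simp only [indicator_of_notMem hy]
          rw [mem_ball, dist_eq_norm, not_lt] at hy
          rw [cubeBump, max_bump_eq_zero hs.1 hy]
          norm_num
    have h3 : - (S ^ 2 * Real.pi * s) ≤ (∫ y, g y * lapR (cubeBump c s) y) / (2 * s) := by
      rw [le_div_iff₀ (by linarith [hs.1])]
      nlinarith
    have : 0 ≤ S ^ 2 * s * (4 - Real.pi) :=
      mul_nonneg (mul_nonneg (sq_nonneg _) hs.1.le) (by linarith)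
    nlinarith
  have hmono : MonotoneOn (fun s => I s + 2 * S ^ 2 * s ^ 2) (Ioc 0 r) := by
    apply monotoneOn_of_deriv_nonneg (convex_Ioc 0 r)
    · exact fun s hs => (hder s hs).continuousAt.continuousWithinAt
    · intro s hs
      rw [interior_Ioc] at hs
      exact (hder s (Ioo_subset_Ioc_self hs)).differentiableAt.differentiableWithinAt
    · intro s hs
      rw [interior_Ioc] at hs
      rw [(hder s (Ioo_subset_Ioc_self hs)).deriv]
      exact hpos s (Ioo_subset_Ioc_self hs)
  have hupper : I r ≤ 3 / r ^ 2 * ∫ y in ball c r, g y := by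
    rw [← integral_const_mul, ← integral_indicator measurableSet_ball]
    apply integral_mono (integrable_mul_sqKernel hg c hr)
    · rw [integrable_indicator_iff measurableSet_ball]
      exact (continuous_integrableOn_ball hg c r).const_mul _
    · intro y
      by_cases hy : y ∈ ball c r
      · simp only [indicator_of_mem hy]
        have : sqKernel c r y ≤ 3 / r ^ 2 := by
          unfold sqKernel
          have := pow_le_one₀ (n := 2) (le_max_right _ _) (max_bump_le_one c y r)
          gcongr
          linarith
        rw [mul_comm]
        exact mul_le_mul_of_nonneg_right this (hg0 y)
      · simp only [indicator_of_notMem hy]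
        rw [mem_ball, dist_eq_norm, not_lt] at hy
        rw [sqKernel_eq_zero hr hy, mul_zero]
  have hint0 : 0 ≤ ∫ y in ball c r, g y := integral_nonneg hg0
  rcases (hg0 c).eq_or_lt with h0 | h0
  · have : 0 ≤ 3 / r ^ 2 * ∫ y in ball c r, g y := mul_nonneg (by positivity) hint0
    have : 0 ≤ 2 * S ^ 2 * r ^ 2 := by positivity
    linarith
  obtain ⟨d, hd, hdg⟩ := Metric.eventually_nhds_iff_ball.1
    (hg.continuousAt.eventually (lt_mem_nhds (half_lt_self h0)))
  set s := min d r with hs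
  have hs0 : 0 < s := lt_min hd hr
  have hlower : g c / 2 ≤ I s := by
    have e1 : g c / 2 ≤ g c / 2 * (27 / 16 / s ^ 2) * (Real.pi * (s / 2) ^ 2) := by
      have : g c / 2 * (27 / 16 / s ^ 2) * (Real.pi * (s / 2) ^ 2)
          = g c / 2 * (27 / 64 * Real.pi) := by field_simp; ring
      rw [this]
      have := Real.pi_gt_three
      nlinarith
    refine e1.trans ?_
    rw [← volume_real_ball c (by positivity : 0 ≤ s / 2), mul_comm, ← smul_eq_mul,
      ← setIntegral_const, ← integral_indicator measurableSet_ball]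
    apply integral_mono _ (integrable_mul_sqKernel hg c hs0)
    · intro y
      by_cases hy : y ∈ ball c (s / 2)
      · simp only [indicator_of_mem hy]
        have h1 : g c / 2 ≤ g y :=
          (hdg y (ball_subset_ball ((half_le_self hs0.le).trans (min_le_left _ _)) hy)).le
        have h2 : 27 / 16 / s ^ 2 ≤ sqKernel c s y := by
          unfold sqKernel
          rw [mem_ball, dist_eq_norm] at hy
          have : 3 / 4 ≤ max (1 - ‖y - c‖ ^ 2 / s ^ 2) 0 := by
            apply le_max_of_le_left
            have : ‖y - c‖ ^ 2 / s ^ 2 ≤ 1 / 4 := by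
              rw [div_le_iff₀ (by positivity)]
              have := norm_nonneg (y - c)
              nlinarith
            linarith
          gcongr
          nlinarith
        have : 0 ≤ 27 / 16 / s ^ 2 := by positivity
        exact mul_le_mul h1 h2 this (hg0 y)
      · simp only [indicator_of_notMem hy]
        exact mul_nonneg (hg0 y) (sqKernel_nonneg c y s)
    · rw [integrable_indicator_iff measurableSet_ball]
      exact integrableOn_const measure_ball_lt_top.ne
  have := hmono ⟨hs0, min_le_right _ _⟩ ⟨hr, le_rfl⟩ (min_le_right d r)
  simp only at this
  have : 0 ≤ 2 * S ^ 2 * s ^ 2 := by positivity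
  linarith

/-- Small mass on a ball controls a nonnegative subsolution at the centre. -/
lemma SubSol.eps_regularity {g : Plane → ℝ} {l : ℝ} (h : SubSol g l) (hl : 0 ≤ l)
    (hg : Continuous g) (hg0 : ∀ x, 0 ≤ g x) {x : Plane} {r : ℝ} (hr : 0 < r)
    (hm : ∫ y in ball x r, g y < 1 / 1536) :
    g x ≤ 48 / r ^ 2 * ∫ y in ball x r, g y := by
  set m := ∫ y in ball x r, g y with hmdef
  have hm0 : 0 ≤ m := integral_nonneg hg0
  obtain ⟨y0, hy0, hmax⟩ := (isCompact_closedBall x r).exists_isMaxOn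
    ⟨x, mem_closedBall_self hr.le⟩
    (f := fun y => (r - dist y x) ^ 2 * g y) (by fun_prop)
  have hmax' : ∀ y ∈ closedBall x r, (r - dist y x) ^ 2 * g y ≤ (r - dist y0 x) ^ 2 * g y0 := hmax
  set b := g y0
  have hx := hmax' x (mem_closedBall_self hr.le)
  rw [dist_self, sub_zero] at hx
  rw [div_mul_eq_mul_div, le_div_iff₀ (by positivity)]
  rcases (hg0 y0).eq_or_lt with hb | hb
  · have : b = 0 := hb.symm
    rw [this, mul_zero] at hx
    linarith
  rcases (mem_closedBall.1 hy0).eq_or_lt with hd | hd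
  · rw [hd, sub_self] at hx
    norm_num at hx
    linarith
  set σ := (r - dist y0 x) / 2 with hσ
  have hσ0 : 0 < σ := by rw [hσ]; linarith
  have hrd : r - dist y0 x = 2 * σ := by rw [hσ]; ring
  rw [hrd] at hx hmax'
  have hb4 : ∀ y ∈ ball y0 σ, g y ≤ 4 * b := by
    intro y hy
    have hyd : dist y x ≤ r - σ := by
      have := dist_triangle y y0 x
      have := mem_ball.1 hy
      linarith
    have h1 := hmax' y (mem_closedBall.2 (by linarith))
    have h2 : σ ^ 2 * g y ≤ (r - dist y x) ^ 2 * g y := by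
      have := hg0 y
      gcongr
      linarith
    have h3 : σ ^ 2 * g y ≤ σ ^ 2 * (4 * b) := by linarith
    exact le_of_mul_le_mul_left h3 (by positivity)
  have key : ∀ ρ, 0 < ρ → ρ ≤ σ → 128 * b * ρ ^ 2 ≤ 1 → ρ ^ 2 * b ≤ 12 * m := by
    intro ρ hρ hρσ hbρ
    have h1 := h.mean_value hl hg hg0 hρ (S := 4 * b) (fun y hy => hb4 y (ball_subset_ball hρσ hy))
    have h2 : ∫ y in ball y0 ρ, g y ≤ m := by
      apply setIntegral_mono_set (continuous_integrableOn_ball hg x r)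
        (Eventually.of_forall fun y => hg0 y)
      apply Eventually.of_forall
      apply ball_subset_ball'
      linarith
    have h3 : b / 2 * ρ ^ 2 ≤ (3 / ρ ^ 2 * m + 2 * (4 * b) ^ 2 * ρ ^ 2) * ρ ^ 2 := by
      apply mul_le_mul_of_nonneg_right _ (by positivity)
      refine h1.trans ?_
      gcongr
    have h4 : (3 / ρ ^ 2 * m + 2 * (4 * b) ^ 2 * ρ ^ 2) * ρ ^ 2
        = 3 * m + 32 * (b * ρ ^ 2) * (b * ρ ^ 2) := by field_simp; ring
    have h5 : 0 ≤ b * ρ ^ 2 := by positivity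
    nlinarith
  have hb' : b ≠ 0 := hb.ne'
  by_cases hc : 128 * b * σ ^ 2 ≤ 1
  · have := key σ hσ0 le_rfl hc
    nlinarith
  · exfalso
    push Not at hc
    have hρ2 : (Real.sqrt (1 / (128 * b))) ^ 2 = 1 / (128 * b) := Real.sq_sqrt (by positivity)
    have hρ0 : 0 < Real.sqrt (1 / (128 * b)) := Real.sqrt_pos.2 (by positivity)
    have := key _ hρ0 ?_ ?_
    · rw [hρ2] at this
      have e : 1 / (128 * b) * b = 1 / 128 := by field_simp
      rw [e] at this
      linarith
    · apply Real.sqrt_le_iff.2 ⟨hσ0.le, ?_⟩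
      rw [div_le_iff₀ (by positivity)]
      linarith
    · rw [hρ2]; apply le_of_eq; field_simp

/-- A smooth profile equal to `1` on `(-∞, 1]` and to `0` on `[2, ∞)`. -/
def cutProfile (s : ℝ) : ℝ := Real.smoothTransition (2 - s)

lemma contDiff_cutProfile {n : ℕ∞} : ContDiff ℝ n cutProfile :=
  Real.smoothTransition.contDiff.comp (contDiff_const.sub contDiff_id)

lemma cutProfile_nonneg (s : ℝ) : 0 ≤ cutProfile s := Real.smoothTransition.nonneg _
lemma cutProfile_le_one (s : ℝ) : cutProfile s ≤ 1 := Real.smoothTransition.le_one _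
lemma cutProfile_of_le {s : ℝ} (h : s ≤ 1) : cutProfile s = 1 :=
  Real.smoothTransition.one_of_one_le (by linarith)
lemma cutProfile_of_ge {s : ℝ} (h : 2 ≤ s) : cutProfile s = 0 :=
  Real.smoothTransition.zero_of_nonpos (by linarith)

lemma hasDerivAt_cutProfile (t : ℝ) : HasDerivAt cutProfile (deriv cutProfile t) t :=
  ((contDiff_cutProfile (n := 1)).differentiable (by norm_num) t).hasDerivAt

lemma contDiff_deriv_cutProfile : ContDiff ℝ 1 (deriv cutProfile) := by
  have := contDiff_cutProfile (n := 2)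
  have e : (((2 : ℕ∞) : WithTop ℕ∞)) = 1 + 1 := by norm_num
  rw [e, contDiff_succ_iff_deriv] at this
  exact this.2.2

lemma hasDerivAt_deriv_cutProfile (t : ℝ) :
    HasDerivAt (deriv cutProfile) (deriv (deriv cutProfile) t) t :=
  (contDiff_deriv_cutProfile.differentiable (by norm_num) t).hasDerivAt

lemma deriv_cutProfile_of_lt {s : ℝ} (h : s < 1) : deriv cutProfile s = 0 := by
  have : cutProfile =ᶠ[𝓝 s] fun _ => 1 := by
    filter_upwards [gt_mem_nhds h] with t ht using cutProfile_of_le ht.le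
  rw [this.deriv_eq, deriv_const]

lemma deriv_cutProfile_of_gt {s : ℝ} (h : 2 < s) : deriv cutProfile s = 0 := by
  have : cutProfile =ᶠ[𝓝 s] fun _ => 0 := by
    filter_upwards [lt_mem_nhds h] with t ht using cutProfile_of_ge ht.le
  rw [this.deriv_eq, deriv_const]

lemma exists_bound_of_zero_outside {f : ℝ → ℝ} (hf : Continuous f)
    (h0 : ∀ s, s < 1 → f s = 0) (h2 : ∀ s, 2 < s → f s = 0) : ∃ K, ∀ s, |f s| ≤ K := by
  obtain ⟨K, hK⟩ := (isCompact_Icc (a := (1 : ℝ)) (b := 2)).exists_bound_of_continuousOn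
    hf.continuousOn
  refine ⟨max K 0, fun s => ?_⟩
  by_cases h : s ∈ Icc (1 : ℝ) 2
  · exact (hK s h).trans (le_max_left _ _)
  · have : f s = 0 := by
      rw [mem_Icc, not_and_or, not_le, not_le] at h
      exact h.elim (h0 s) (h2 s)
    simp [this]

lemma deriv_deriv_cutProfile_of_lt {s : ℝ} (h : s < 1) : deriv (deriv cutProfile) s = 0 := by
  have : deriv cutProfile =ᶠ[𝓝 s] fun _ => 0 := by
    filter_upwards [gt_mem_nhds h] with t ht using deriv_cutProfile_of_lt ht
  rw [this.deriv_eq, deriv_const]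

lemma deriv_deriv_cutProfile_of_gt {s : ℝ} (h : 2 < s) : deriv (deriv cutProfile) s = 0 := by
  have : deriv cutProfile =ᶠ[𝓝 s] fun _ => 0 := by
    filter_upwards [lt_mem_nhds h] with t ht using deriv_cutProfile_of_gt ht
  rw [this.deriv_eq, deriv_const]

lemma exists_cutProfile_bound : ∃ K, 0 < K ∧ (∀ s, |deriv cutProfile s| ≤ K) ∧
    ∀ s, |deriv (deriv cutProfile) s| ≤ K := by
  obtain ⟨K1, h1⟩ := exists_bound_of_zero_outside contDiff_deriv_cutProfile.continuous
    (fun s => deriv_cutProfile_of_lt) (fun s => deriv_cutProfile_of_gt)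
  obtain ⟨K2, h2⟩ := exists_bound_of_zero_outside
    (contDiff_deriv_cutProfile.continuous_deriv (by norm_num))
    (fun s => deriv_deriv_cutProfile_of_lt) (fun s => deriv_deriv_cutProfile_of_gt)
  refine ⟨max 1 (max K1 K2), lt_max_of_lt_left one_pos, fun s => (h1 s).trans ?_,
    fun s => (h2 s).trans ?_⟩
  · exact (le_max_left _ _).trans (le_max_right _ _)
  · exact (le_max_right _ _).trans (le_max_right _ _)

/-- The constant bounding the derivatives of `cutProfile`. -/
def cutConst : ℝ := exists_cutProfile_bound.choose

lemma cutConst_pos : 0 < cutConst := exists_cutProfile_bound.choose_spec.1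
lemma abs_deriv_cutProfile_le (s : ℝ) : |deriv cutProfile s| ≤ cutConst :=
  exists_cutProfile_bound.choose_spec.2.1 s
lemma abs_deriv_deriv_cutProfile_le (s : ℝ) : |deriv (deriv cutProfile) s| ≤ cutConst :=
  exists_cutProfile_bound.choose_spec.2.2 s

/-- The cutoff at scale `ρ` around `c`. -/
def cutoff (c : Plane) (ρ : ℝ) (x : Plane) : ℝ := cutProfile (‖x - c‖ ^ 2 / ρ ^ 2)

lemma cutoff_nonneg (c : Plane) (ρ : ℝ) (x : Plane) : 0 ≤ cutoff c ρ x := cutProfile_nonneg _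
lemma cutoff_le_one (c : Plane) (ρ : ℝ) (x : Plane) : cutoff c ρ x ≤ 1 := cutProfile_le_one _

lemma cutoff_eq_one {c x : Plane} {ρ : ℝ} (hρ : 0 < ρ) (h : ‖x - c‖ ≤ ρ) : cutoff c ρ x = 1 := by
  apply cutProfile_of_le
  rw [div_le_one (by positivity)]
  gcongr

lemma cutoff_eq_zero {c x : Plane} {ρ : ℝ} (hρ : 0 < ρ) (h : 2 * ρ ≤ ‖x - c‖) :
    cutoff c ρ x = 0 := by
  apply cutProfile_of_ge
  rw [le_div_iff₀ (by positivity)]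
  nlinarith

lemma isTest_cutoff (c : Plane) {ρ : ℝ} (hρ : 0 < ρ) : IsTest (cutoff c ρ) := by
  constructor
  · exact contDiff_radial (F := fun t => cutProfile (t / ρ ^ 2))
      ((contDiff_cutProfile (n := 2)).comp (contDiff_id.div_const _)) c
  · apply HasCompactSupport.of_support_subset_isCompact (isCompact_closedBall c (2 * ρ))
    intro x hx
    rw [mem_closedBall, dist_eq_norm]
    by_contra hlt
    exact hx (cutoff_eq_zero hρ (not_le.1 hlt).le)

lemma hasDerivAt_cutProfile_div (ρ t : ℝ) :
    HasDerivAt (fun t => cutProfile (t / ρ ^ 2)) (deriv cutProfile (t / ρ ^ 2) / ρ ^ 2) t := by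
  have := (hasDerivAt_cutProfile (t / ρ ^ 2)).comp t ((hasDerivAt_id t).div_const (ρ ^ 2))
  convert! this using 1
  ring

lemma hasDerivAt_deriv_cutProfile_div (ρ t : ℝ) :
    HasDerivAt (fun t => deriv cutProfile (t / ρ ^ 2) / ρ ^ 2)
      (deriv (deriv cutProfile) (t / ρ ^ 2) / ρ ^ 2 / ρ ^ 2) t := by
  have := ((hasDerivAt_deriv_cutProfile (t / ρ ^ 2)).comp t
    ((hasDerivAt_id t).div_const (ρ ^ 2))).div_const (ρ ^ 2)
  convert! this using 1
  ring

lemma norm_fderiv_cutoff_le (c : Plane) {ρ : ℝ} (hρ : 0 < ρ) (x : Plane) :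
    ‖fderiv ℝ (cutoff c ρ) x‖ ≤ 4 * cutConst / ρ := by
  have := norm_fderiv_radial (c := c) (x := x) (hasDerivAt_cutProfile_div ρ (‖x - c‖ ^ 2))
  change ‖fderiv ℝ (cutoff c ρ) x‖ = _ at this
  rw [this]
  by_cases h : 2 * ρ < ‖x - c‖
  · rw [deriv_cutProfile_of_gt]
    · have := cutConst_pos
      simp; positivity
    · rw [lt_div_iff₀ (by positivity)]
      nlinarith
  · push Not at h
    rw [abs_div, abs_of_nonneg (sq_nonneg ρ)]
    calc 2 * (|deriv cutProfile (‖x - c‖ ^ 2 / ρ ^ 2)| / ρ ^ 2) * ‖x - c‖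
        ≤ 2 * (cutConst / ρ ^ 2) * (2 * ρ) := by
          have := abs_deriv_cutProfile_le (‖x - c‖ ^ 2 / ρ ^ 2)
          have := cutConst_pos
          gcongr
      _ = 4 * cutConst / ρ := by field_simp; ring

lemma abs_lapR_cutoff_le (c : Plane) {ρ : ℝ} (hρ : 0 < ρ) (x : Plane) :
    |lapR (cutoff c ρ) x| ≤ 20 * cutConst / ρ ^ 2 := by
  have := lapR_radial c (hasDerivAt_cutProfile_div ρ) (hasDerivAt_deriv_cutProfile_div ρ) x
  change lapR (cutoff c ρ) x = _ at this
  rw [this]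
  have hK := cutConst_pos
  by_cases h : 2 * ρ < ‖x - c‖
  · have h2 : 2 < ‖x - c‖ ^ 2 / ρ ^ 2 := by
      rw [lt_div_iff₀ (by positivity)]
      nlinarith
    rw [deriv_cutProfile_of_gt h2, deriv_deriv_cutProfile_of_gt h2]
    simp; positivity
  · push Not at h
    refine (abs_add_le _ _).trans ?_
    rw [abs_mul, abs_mul (4 * _), abs_div, abs_div, abs_div, abs_of_nonneg (sq_nonneg ρ),
      abs_of_nonneg (by positivity : 0 ≤ 4 * ‖x - c‖ ^ 2), abs_of_nonneg (by norm_num : (0:ℝ) ≤ 4)]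
    calc _ ≤ 4 * (cutConst / ρ ^ 2) + 4 * (2 * ρ) ^ 2 * (cutConst / ρ ^ 2 / ρ ^ 2) := by
          gcongr
          · exact abs_deriv_cutProfile_le _
          · exact abs_deriv_deriv_cutProfile_le _
      _ = 20 * cutConst / ρ ^ 2 := by field_simp; ring

lemma tendsto_cutoff (c x : Plane) : Tendsto (fun n : ℕ => cutoff c (n + 1) x) atTop (𝓝 1) := by
  apply tendsto_const_nhds.congr'
  obtain ⟨N, hN⟩ := exists_nat_ge ‖x - c‖
  filter_upwards [eventually_ge_atTop N] with n hn
  rw [cutoff_eq_one (by positivity)]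
  have : (N : ℝ) ≤ n := by exact_mod_cast hn
  linarith

lemma abs_lapR_cutoff_mul_sub_le {φ : Plane → ℝ} (hφ : ContDiff ℝ 2 φ) {M : ℝ}
    (h0 : ∀ x, |φ x| ≤ M) (h1 : ∀ x, ‖fderiv ℝ φ x‖ ≤ M) (c x : Plane) (n : ℕ) :
    |lapR (fun y => cutoff c (n + 1) y * φ y) x - cutoff c (n + 1) x * lapR φ x| ≤
      28 * cutConst * M / (n + 1) := by
  have hn : (0 : ℝ) < n + 1 := by positivity
  rw [lapR_mul (isTest_cutoff c hn).1 hφ]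
  have hK := cutConst_pos
  have hM : 0 ≤ M := (abs_nonneg _).trans (h0 x)
  have a1 := (abs_gradDot_le (cutoff c (n + 1)) φ x).trans
    (mul_le_mul (norm_fderiv_cutoff_le c hn x) (h1 x) (norm_nonneg _) (by positivity))
  have a2 : |φ x * lapR (cutoff c (n + 1)) x| ≤ M * (20 * cutConst / (n + 1) ^ 2) := by
    rw [abs_mul]
    exact mul_le_mul (h0 x) (abs_lapR_cutoff_le c hn x) (abs_nonneg _) hM
  have a3 : M * (20 * cutConst / (n + 1) ^ 2) ≤ M * (20 * cutConst / (n + 1)) := by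
    gcongr
    nlinarith
  have e : 28 * cutConst * M / (n + 1)
      = 2 * (4 * cutConst / (n + 1) * M) + M * (20 * cutConst / (n + 1)) := by ring
  rw [e]
  rw [show ∀ a b d : ℝ, a + 2 * b + d - a = 2 * b + d by intros; ring]
  refine (abs_add_le _ _).trans ?_
  rw [abs_mul, abs_two]
  linarith

/-- The subsolution inequality against bounded test functions. -/
lemma SubSol.extend {g : Plane → ℝ} {l : ℝ} (h : SubSol g l) (hg : Continuous g)
    (hi : Integrable g) (hi2 : Integrable fun x => g x ^ 2) {φ : Plane → ℝ}
    (hφ : ContDiff ℝ 2 φ) (hφ0 : ∀ x, 0 ≤ φ x) {M : ℝ}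
    (h0 : ∀ x, |φ x| ≤ M) (h1 : ∀ x, ‖fderiv ℝ φ x‖ ≤ M) (h2 : ∀ x, |lapR φ x| ≤ M) :
    2 * ∫ x, (l - g x) * g x * φ x ≤ ∫ x, g x * lapR φ x := by
  have hM : 0 ≤ M := (abs_nonneg _).trans (h0 0)
  have hK := cutConst_pos
  have hlc : Continuous (lapR φ) := continuous_lapR hφ
  have hn : ∀ n : ℕ, (0 : ℝ) < n + 1 := fun n => by positivity
  have hprod : ∀ n : ℕ, IsTest (fun y => cutoff 0 (n + 1) y * φ y) := fun n =>
    ⟨(isTest_cutoff 0 (hn n)).1.mul hφ, (isTest_cutoff 0 (hn n)).2.mul_right⟩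
  have hlg : Integrable fun x => (l - g x) * g x := by
    have := (hi.const_mul l).sub hi2
    refine this.congr (Eventually.of_forall fun x => ?_)
    simp only [Pi.sub_apply]; ring
  have t1 : Tendsto (fun n : ℕ => 2 * ∫ x, (l - g x) * g x * (cutoff 0 (n + 1) x * φ x)) atTop
      (𝓝 (2 * ∫ x, (l - g x) * g x * φ x)) := by
    apply Tendsto.const_mul
    apply tendsto_integral_of_dominated_convergence (fun x => |(l - g x) * g x| * M)
    · intro n
      have := (hprod n).1.continuous
      exact (by fun_prop : Continuous _).aestronglyMeasurable
    · exact hlg.abs.mul_const M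
    · intro n
      refine Eventually.of_forall fun x => ?_
      rw [Real.norm_eq_abs, abs_mul, abs_mul (cutoff _ _ _)]
      gcongr
      rw [abs_of_nonneg (cutoff_nonneg _ _ _)]
      calc _ ≤ 1 * M := mul_le_mul (cutoff_le_one _ _ _) (h0 x) (abs_nonneg _) zero_le_one
        _ = M := one_mul M
    · refine Eventually.of_forall fun x => ?_
      have := ((tendsto_cutoff 0 x).mul_const (φ x)).const_mul ((l - g x) * g x)
      simpa using this
  have t2 : Tendsto (fun n : ℕ => ∫ x, g x * lapR (fun y => cutoff 0 (n + 1) y * φ y) x) atTop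
      (𝓝 (∫ x, g x * lapR φ x)) := by
    apply tendsto_integral_of_dominated_convergence
      (fun x => |g x| * (M + 28 * cutConst * M))
    · intro n
      have := continuous_lapR (hprod n).1
      exact (by fun_prop : Continuous _).aestronglyMeasurable
    · exact hi.abs.mul_const _
    · intro n
      refine Eventually.of_forall fun x => ?_
      rw [Real.norm_eq_abs, abs_mul]
      gcongr
      have a := abs_lapR_cutoff_mul_sub_le hφ h0 h1 0 x n
      have b : 28 * cutConst * M / (n + 1) ≤ 28 * cutConst * M :=
        div_le_self (by positivity) (by linarith [(Nat.cast_nonneg n : (0 : ℝ) ≤ n)])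
      have c : |cutoff 0 (n + 1) x * lapR φ x| ≤ M := by
        rw [abs_mul, abs_of_nonneg (cutoff_nonneg _ _ _)]
        calc _ ≤ 1 * M := mul_le_mul (cutoff_le_one _ _ _) (h2 x) (abs_nonneg _) zero_le_one
          _ = M := one_mul M
      have d := abs_sub_abs_le_abs_sub (lapR (fun y => cutoff 0 (n + 1) y * φ y) x)
        (cutoff 0 (n + 1) x * lapR φ x)
      linarith
    · refine Eventually.of_forall fun x => ?_
      apply Tendsto.const_mul
      have z : Tendsto (fun n : ℕ => 28 * cutConst * M / ((n : ℝ) + 1)) atTop (𝓝 0) := by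
        have := tendsto_one_div_add_atTop_nhds_zero_nat (𝕜 := ℝ)
        have := this.const_mul (28 * cutConst * M)
        rw [mul_zero] at this
        refine this.congr fun n => ?_
        ring
      have z2 := squeeze_zero_norm (f := fun n : ℕ => lapR (fun y => cutoff 0 (n + 1) y * φ y) x
        - cutoff 0 (n + 1) x * lapR φ x) (fun n => by
          rw [Real.norm_eq_abs]
          exact abs_lapR_cutoff_mul_sub_le hφ h0 h1 0 x n) z
      have := z2.add ((tendsto_cutoff 0 x).mul_const (lapR φ x))
      simpa using this
  refine le_of_tendsto_of_tendsto' t1 t2 fun n => ?_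
  exact h _ (hprod n) fun x => mul_nonneg (cutoff_nonneg _ _ _) (hφ0 x)

/-- The profile `1 / cosh (κ (s - T))`. -/
def sechWave (κ T s : ℝ) : ℝ := (Real.cosh (κ * (s - T)))⁻¹

lemma contDiff_sechWave (κ T : ℝ) : ContDiff ℝ 2 (sechWave κ T) := by
  apply ContDiff.inv
  · exact Real.contDiff_cosh.comp (contDiff_const.mul (contDiff_id.sub contDiff_const))
  · intro x; exact (Real.cosh_pos _).ne'

lemma sechWave_pos (κ T s : ℝ) : 0 < sechWave κ T s := inv_pos.2 (Real.cosh_pos _)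
lemma sechWave_le_one (κ T s : ℝ) : sechWave κ T s ≤ 1 := inv_le_one_of_one_le₀ (Real.one_le_cosh _)

lemma hasDerivAt_sechWave (κ T s : ℝ) : HasDerivAt (sechWave κ T)
    (-(κ * Real.sinh (κ * (s - T)) * (sechWave κ T s) ^ 2)) s := by
  have h1 : HasDerivAt (fun s => κ * (s - T)) κ s := by
    simpa using ((hasDerivAt_id s).sub_const T).const_mul κ
  have := h1.cosh.fun_inv (Real.cosh_pos _).ne'
  refine this.congr_deriv ?_
  unfold sechWave
  field_simp

lemma hasDerivAt_deriv_sechWave (κ T s : ℝ) :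
    HasDerivAt (fun s => -(κ * Real.sinh (κ * (s - T)) * (sechWave κ T s) ^ 2))
    (κ ^ 2 * sechWave κ T s * (1 - 2 * sechWave κ T s ^ 2)) s := by
  have h1 : HasDerivAt (fun s => κ * (s - T)) κ s := by
    simpa using ((hasDerivAt_id s).sub_const T).const_mul κ
  have := ((h1.sinh.const_mul κ).fun_mul ((hasDerivAt_sechWave κ T s).fun_pow 2)).fun_neg
  refine this.congr_deriv ?_
  have h3 : Real.cosh (κ * (s - T)) = (sechWave κ T s)⁻¹ := by rw [sechWave, inv_inv]
  have h2 : Real.sinh (κ * (s - T)) ^ 2 = (sechWave κ T s)⁻¹ ^ 2 - 1 := by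
    have := Real.cosh_sq (κ * (s - T))
    rw [h3] at this; linarith
  have hp := sechWave_pos κ T s
  rw [h3]
  push_cast
  have e : ∀ S k q : ℝ, -(k * (q⁻¹ * k) * q ^ 2 + k * S * (2 * q ^ (2 - 1) * -(k * S * q ^ 2)))
      = -(k * (q⁻¹ * k) * q ^ 2) + 2 * k ^ 2 * S ^ 2 * q ^ 3 := by intros; ring
  rw [e, h2]
  field_simp
  ring

lemma abs_deriv_sechWave_le (κ T s : ℝ) :
    |-(κ * Real.sinh (κ * (s - T)) * (sechWave κ T s) ^ 2)| ≤ |κ| := by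
  have hp := sechWave_pos κ T s
  have h1 := sechWave_le_one κ T s
  have : |Real.sinh (κ * (s - T))| * sechWave κ T s ≤ 1 := by
    rw [sechWave, ← div_eq_mul_inv, div_le_one (Real.cosh_pos _)]
    rw [← Real.cosh_abs, Real.abs_sinh]
    exact (Real.sinh_lt_cosh _).le
  rw [abs_neg, abs_mul, abs_mul, abs_of_pos (pow_pos hp 2)]
  calc |κ| * |Real.sinh (κ * (s - T))| * sechWave κ T s ^ 2
      = |κ| * ((|Real.sinh (κ * (s - T))| * sechWave κ T s) * sechWave κ T s) := by ring
    _ ≤ |κ| * (1 * 1) := by gcongr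
    _ = |κ| := by ring

lemma sechWave_le_exp {κ T s : ℝ} : sechWave κ T s ≤ 2 * Real.exp (-(κ * (T - s))) := by
  have : Real.exp (κ * (T - s)) ≤ 2 * Real.cosh (κ * (s - T)) := by
    rw [Real.cosh_eq, show -(κ * (s - T)) = κ * (T - s) by ring]
    have := Real.exp_pos (κ * (s - T))
    linarith
  rw [sechWave, Real.exp_neg, inv_le_iff_one_le_mul₀ (Real.cosh_pos _)]
  have hp := Real.exp_pos (κ * (T - s))
  calc (1 : ℝ) = (Real.exp (κ * (T - s)))⁻¹ * Real.exp (κ * (T - s)) := by field_simp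
    _ ≤ (Real.exp (κ * (T - s)))⁻¹ * (2 * Real.cosh (κ * (s - T))) := by gcongr
    _ = _ := by ring

/-- Exponential decay of the mass of a subsolution that is small far away. -/
lemma SubSol.mass_decay {g : Plane → ℝ} {l : ℝ} (h : SubSol g l) (hg : Continuous g)
    (hg0 : ∀ x, 0 ≤ g x) (hi : Integrable g) {G κ β θ R r : ℝ} {c x : Plane}
    (hG : ∀ y, g y ≤ G) (hκ : 0 ≤ κ) (hβ : 0 < β) (hr : 0 ≤ r)
    (hθ : ∀ y, R ≤ ‖y - c‖ → g y ≤ θ) (hl : κ ^ 2 + β ≤ 2 * (l - θ)) (hl' : κ ^ 2 ≤ 2 * l)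
    (hx : x ≠ c) :
    β * ∫ y in ball x r, g y ≤
      Real.cosh (κ * r) * ((2 * G + β) * (2 * Real.exp (-(κ * (‖x - c‖ - R))) * ∫ y, g y)) := by
  have hG0 : 0 ≤ G := (hg0 c).trans (hG c)
  set T := ‖x - c‖ with hT
  have hTpos : 0 < T := norm_pos_iff.2 (sub_ne_zero.2 hx)
  set e : Plane := T⁻¹ • (x - c) with he
  have he1 : ‖e‖ = 1 := by
    rw [he, norm_smul, Real.norm_eq_abs, abs_of_pos (inv_pos.2 hTpos), ← hT]
    field_simp
  have hi2 : Integrable fun x => g x ^ 2 := by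
    refine (hi.const_mul G).mono' (by fun_prop) (Eventually.of_forall fun y => ?_)
    rw [Real.norm_of_nonneg (sq_nonneg _), sq]
    exact mul_le_mul_of_nonneg_right (hG y) (hg0 y)
  set φ : Plane → ℝ := fun y => sechWave κ T (inner ℝ e (y - c)) with hφ
  have hφc : ContDiff ℝ 2 φ := contDiff_planeWave (contDiff_sechWave κ T) e c
  have hφ0 : ∀ y, 0 < φ y := fun y => sechWave_pos _ _ _
  have hφ1 : ∀ y, φ y ≤ 1 := fun y => sechWave_le_one _ _ _
  have hlap : ∀ y, lapR φ y = κ ^ 2 * φ y * (1 - 2 * φ y ^ 2) := fun y =>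
    lapR_planeWave e c he1 (hasDerivAt_sechWave κ T) (hasDerivAt_deriv_sechWave κ T) y
  have hφcont : Continuous φ := hφc.continuous
  have hφi : Integrable fun y => g y * φ y := by
    refine hi.mono' (by fun_prop) (Eventually.of_forall fun y => ?_)
    rw [Real.norm_of_nonneg (mul_nonneg (hg0 y) (hφ0 y).le)]
    exact mul_le_of_le_one_right (hg0 y) (hφ1 y)
  have key := h.extend hg hi hi2 hφc (fun y => (hφ0 y).le) (M := 1 + κ + κ ^ 2)
    (fun y => by
      rw [abs_of_pos (hφ0 y)]
      nlinarith [hφ1 y, sq_nonneg κ])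
    (fun y => by
      rw [(hasFDerivAt_planeWave (hasDerivAt_sechWave κ T _)).fderiv, norm_smul,
        innerSL_apply_norm, he1, mul_one, Real.norm_eq_abs]
      refine (abs_deriv_sechWave_le _ _ _).trans ?_
      rw [abs_of_nonneg hκ]
      nlinarith [sq_nonneg κ])
    (fun y => by
      rw [hlap, abs_mul, abs_of_nonneg (mul_nonneg (sq_nonneg κ) (hφ0 y).le)]
      have h1 : |1 - 2 * φ y ^ 2| ≤ 1 := by
        have := hφ0 y
        have := hφ1 y
        rw [abs_le]; constructor <;> nlinarith
      calc κ ^ 2 * φ y * |1 - 2 * φ y ^ 2| ≤ κ ^ 2 * 1 * 1 := by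
            gcongr
            exact hφ1 y
        _ ≤ _ := by linarith)
  have hlgφ : Integrable fun y => (l - g y) * g y * φ y := by
    have h1 : Integrable fun y => l * (g y * φ y) := hφi.const_mul l
    have h2 : Integrable fun y => g y ^ 2 * φ y := by
      refine hi2.mono' (by fun_prop) (Eventually.of_forall fun y => ?_)
      rw [Real.norm_of_nonneg (mul_nonneg (sq_nonneg _) (hφ0 y).le)]
      exact mul_le_of_le_one_right (sq_nonneg _) (hφ1 y)
    refine (h1.sub h2).congr (Eventually.of_forall fun x => ?_)
    simp only [Pi.sub_apply]; ring
  have hglap : Integrable fun y => g y * lapR φ y := by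
    have hlc := continuous_lapR hφc
    refine (hφi.const_mul (κ ^ 2)).mono' (by fun_prop) (Eventually.of_forall fun y => ?_)
    have h1 : |1 - 2 * φ y ^ 2| ≤ 1 := by
      have := hφ0 y
      have := hφ1 y
      rw [abs_le]; constructor <;> nlinarith
    rw [hlap, Real.norm_eq_abs, abs_mul, abs_of_nonneg (hg0 y), abs_mul,
      abs_of_nonneg (mul_nonneg (sq_nonneg κ) (hφ0 y).le)]
    have := mul_nonneg (mul_nonneg (hg0 y) (sq_nonneg κ)) (hφ0 y).le
    nlinarith
  set E := 2 * Real.exp (-(κ * (T - R))) with hE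
  have hE0 : 0 ≤ E := by positivity
  have hpt : ∀ y, β * (g y * φ y) + (g y * lapR φ y - 2 * ((l - g y) * g y * φ y)) ≤
      (2 * G + β) * E * g y := by
    intro y
    have p0 := mul_nonneg (hg0 y) (hφ0 y).le
    have p1 : g y * lapR φ y ≤ κ ^ 2 * (g y * φ y) := by
      rw [hlap]
      have : 0 ≤ κ ^ 2 * (g y * φ y) * (2 * φ y ^ 2) := by positivity
      nlinarith
    have hRHS : 0 ≤ (2 * G + β) * E * g y := by
      have := hg0 y
      positivity
    by_cases hy : R ≤ ‖y - c‖
    · have := hθ y hy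
      have : 0 ≤ (2 * (l - g y) - κ ^ 2 - β) * (g y * φ y) := mul_nonneg (by linarith) p0
      nlinarith
    · push Not at hy
      have q1 : 0 ≤ (2 * G + β - (β + κ ^ 2 - 2 * (l - g y))) * (g y * φ y) :=
        mul_nonneg (by linarith [hG y]) p0
      have q2 : φ y ≤ E := by
        refine sechWave_le_exp.trans ?_
        rw [hE]
        have : inner ℝ e (y - c) ≤ R := by
          refine (real_inner_le_norm _ _).trans ?_
          rw [he1, one_mul]; exact hy.le
        gcongr
      have q3 : (2 * G + β) * (g y * φ y) ≤ (2 * G + β) * (g y * E) := by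
        have := hg0 y
        gcongr
      nlinarith
  have hint := integral_mono ((hφi.const_mul β).add (hglap.sub (hlgφ.const_mul 2)))
    (hi.const_mul ((2 * G + β) * E)) hpt
  have hsplit : ∫ y, (β * (g y * φ y) + (g y * lapR φ y - 2 * ((l - g y) * g y * φ y)))
      = β * (∫ y, g y * φ y) + ((∫ y, g y * lapR φ y) - 2 * ∫ y, (l - g y) * g y * φ y) := by
    have := integral_add (hφi.const_mul β) (hglap.sub (hlgφ.const_mul 2))
    simp only [Pi.sub_apply] at this
    rw [this, integral_sub hglap (hlgφ.const_mul 2), integral_const_mul, integral_const_mul]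
  have hint' : β * ∫ y, g y * φ y ≤ (2 * G + β) * E * ∫ y, g y := by
    rw [← integral_const_mul ((2 * G + β) * E)]
    have := hsplit.symm.le.trans hint
    linarith
  have hball : ∫ y in ball x r, g y ≤ Real.cosh (κ * r) * ∫ y, g y * φ y := by
    rw [← integral_const_mul, ← integral_indicator measurableSet_ball]
    apply integral_mono
    · exact hi.indicator measurableSet_ball
    · exact hφi.const_mul _
    · intro y
      have p0 := mul_nonneg (hg0 y) (hφ0 y).le
      by_cases hy : y ∈ ball x r
      · simp only [indicator_of_mem hy]
        have hTe : inner ℝ e (x - c) = T := by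
          rw [he, real_inner_smul_left, real_inner_self_eq_norm_sq, ← hT]
          field_simp
        have hs : |inner ℝ e (y - c) - T| ≤ r := by
          rw [← hTe, ← inner_sub_right, sub_sub_sub_cancel_right]
          refine (abs_real_inner_le_norm _ _).trans ?_
          rw [he1, one_mul, ← dist_eq_norm]
          exact (mem_ball.1 hy).le
        have h1 : 1 ≤ Real.cosh (κ * r) * φ y := by
          simp only [hφ, sechWave]
          rw [← div_eq_mul_inv, one_le_div (Real.cosh_pos _), Real.cosh_le_cosh, abs_mul, abs_mul,
            abs_of_nonneg hr]
          gcongr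
        calc g y = g y * 1 := (mul_one _).symm
          _ ≤ g y * (Real.cosh (κ * r) * φ y) := by
            have := hg0 y
            gcongr
          _ = _ := by ring
      · simp only [indicator_of_notMem hy]
        exact mul_nonneg (Real.cosh_pos _).le p0
  calc β * ∫ y in ball x r, g y ≤ β * (Real.cosh (κ * r) * ∫ y, g y * φ y) := by gcongr
    _ = Real.cosh (κ * r) * (β * ∫ y, g y * φ y) := by ring
    _ ≤ Real.cosh (κ * r) * ((2 * G + β) * E * ∫ y, g y) := by
      have := Real.cosh_pos (κ * r)
      gcongr
    _ = _ := by ring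

/-- The singular part `(-log |z|)₊` of the logarithmic kernel. -/
def logSing (z : Plane) : ℝ := max (-Real.log ‖z‖) 0

lemma logSing_nonneg (z : Plane) : 0 ≤ logSing z := le_max_right _ _

lemma measurable_logSing : Measurable logSing :=
  ((Real.measurable_log.comp measurable_norm).neg).max measurable_const

lemma logSing_eq_zero {z : Plane} (hz : 1 ≤ ‖z‖) : logSing z = 0 :=
  max_eq_right (by have := Real.log_nonneg hz; linarith)

lemma logSing_sq_le (z : Plane) : logSing z ^ 2 ≤ 4 * ‖z‖ ^ (-1 : ℝ) := by
  rcases (norm_nonneg z).eq_or_lt with h0 | h0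
  · simp [logSing, ← h0]
  have hp : 0 < ‖z‖ ^ (-(1 / 2) : ℝ) := Real.rpow_pos_of_pos h0 _
  have h1 : logSing z ≤ 2 * ‖z‖ ^ (-(1 / 2) : ℝ) := by
    apply max_le _ (by positivity)
    have := Real.log_le_sub_one_of_pos hp
    rw [Real.log_rpow h0] at this
    linarith
  calc logSing z ^ 2 ≤ (2 * ‖z‖ ^ (-(1 / 2) : ℝ)) ^ 2 := by
        have := logSing_nonneg z
        gcongr
    _ = 4 * ‖z‖ ^ (-1 : ℝ) := by
        rw [mul_pow, ← Real.rpow_natCast (‖z‖ ^ _), ← Real.rpow_mul h0.le]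
        norm_num

lemma integrableOn_norm_inv : IntegrableOn (fun z : Plane => ‖z‖ ^ (-1 : ℝ)) (ball 0 1) := by
  rw [integrableOn_fun_norm_addHaar volume (f := fun r : ℝ => r ^ (-1 : ℝ))]
  have : IntegrableOn (fun _ : ℝ => (1 : ℝ)) (Ioo 0 1) := integrableOn_const (by simp)
  refine this.congr_fun (fun y hy => ?_) measurableSet_Ioo
  have : y ≠ 0 := hy.1.ne'
  simp [Real.rpow_neg_one, this]

lemma integrable_logSing_sq : Integrable fun z => logSing z ^ 2 := by
  have h1 := (integrable_indicator_iff measurableSet_ball).2 (integrableOn_norm_inv.const_mul 4)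
  refine h1.mono' (measurable_logSing.pow_const 2).aestronglyMeasurable
    (Eventually.of_forall fun z => ?_)
  rw [Real.norm_of_nonneg (sq_nonneg _)]
  by_cases hz : z ∈ ball (0 : Plane) 1
  · rw [indicator_of_mem hz]; exact logSing_sq_le z
  · rw [indicator_of_notMem hz, logSing_eq_zero (by simpa using hz)]; norm_num

lemma integrable_logSing : Integrable logSing := by
  have h1 : Integrable (indicator (ball (0 : Plane) 1) fun _ => (1 : ℝ)) :=
    (integrable_indicator_iff measurableSet_ball).2 (integrableOn_const measure_ball_lt_top.ne)
  refine (h1.add integrable_logSing_sq).mono' measurable_logSing.aestronglyMeasurable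
    (Eventually.of_forall fun z => ?_)
  rw [Real.norm_of_nonneg (logSing_nonneg _)]
  by_cases hz : z ∈ ball (0 : Plane) 1
  · rw [Pi.add_apply, indicator_of_mem hz]; nlinarith [sq_nonneg (logSing z - 1)]
  · rw [Pi.add_apply, indicator_of_notMem hz, logSing_eq_zero (by simpa using hz)]; norm_num

lemma abs_log_norm_le (z : Plane) : |Real.log ‖z‖| ≤ ‖z‖ + logSing z := by
  rw [abs_le]
  constructor
  · have : -Real.log ‖z‖ ≤ logSing z := le_max_left _ _
    have := norm_nonneg z
    linarith
  · have := Real.log_le_self (norm_nonneg z)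
    have := logSing_nonneg z
    linarith

/-- Densities for which the logarithmic energy is absolutely convergent. -/
structure LogAdm (f : Plane → ℝ) : Prop where
  int : Integrable f
  sq : Integrable fun x => f x ^ 2
  mom : Integrable fun x => ‖x‖ * f x

lemma LogAdm.add {f h : Plane → ℝ} (hf : LogAdm f) (hh : LogAdm h) :
    LogAdm fun x => f x + h x := by
  refine ⟨hf.int.add hh.int, ?_, ?_⟩
  · refine ((hf.sq.const_mul 2).add (hh.sq.const_mul 2)).mono'
      ((hf.int.add hh.int).aestronglyMeasurable.pow 2) (Eventually.of_forall fun x => ?_)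
    rw [Real.norm_of_nonneg (sq_nonneg _)]
    simp only [Pi.add_apply]
    nlinarith [sq_nonneg (f x - h x)]
  · refine (hf.mom.add hh.mom).congr (Eventually.of_forall fun x => ?_)
    simp only [Pi.add_apply]; ring

lemma LogAdm.const_mul {f : Plane → ℝ} (hf : LogAdm f) (c : ℝ) : LogAdm fun x => c * f x := by
  refine ⟨hf.int.const_mul c, ?_, ?_⟩
  · simpa only [mul_pow] using hf.sq.const_mul (c ^ 2)
  · refine (hf.mom.const_mul c).congr (Eventually.of_forall fun x => ?_)
    ring

lemma LogAdm.bdd_mul {f ψ : Plane → ℝ} (hf : LogAdm f) (hψ : Continuous ψ) {M : ℝ}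
    (hM : ∀ x, |ψ x| ≤ M) : LogAdm fun x => ψ x * f x := by
  have hm : AEStronglyMeasurable (fun x => ψ x * f x) volume :=
    hψ.aestronglyMeasurable.mul hf.int.aestronglyMeasurable
  refine ⟨?_, ?_, ?_⟩
  · exact hf.int.bdd_mul hψ.aestronglyMeasurable (Eventually.of_forall hM)
  · have := hf.sq.bdd_mul (f := fun x => ψ x ^ 2) (hψ.pow 2).aestronglyMeasurable (c := M ^ 2)
      (Eventually.of_forall fun x => ?_)
    · simpa only [mul_pow] using this
    · rw [norm_pow]; exact pow_le_pow_left₀ (norm_nonneg _) (hM x) 2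
  · have := hf.mom.bdd_mul hψ.aestronglyMeasurable (Eventually.of_forall hM)
    refine this.congr (Eventually.of_forall fun x => ?_)
    ring

/-- The logarithmic bilinear form. -/
def logForm (f h : Plane → ℝ) : ℝ :=
  ∫ x : Plane, ∫ y : Plane, Real.log ‖x - y‖ * f x * h y

lemma logConv_eq (u : Plane → ℂ) : logConv u = logForm (fun x => ‖u x‖ ^ 2) fun x => ‖u x‖ ^ 2 :=
  rfl

lemma LogAdm.integrable_prod {f h : Plane → ℝ} (hf : LogAdm f) (hh : LogAdm h) :
    Integrable (fun z : Plane × Plane => Real.log ‖z.1 - z.2‖ * f z.1 * h z.2)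
      (volume.prod volume) := by
  have i1 := hf.mom.abs.mul_prod hh.int.abs
  have i2 := hf.int.abs.mul_prod hh.mom.abs
  have i3 := hh.sq.convolution_integrand (ContinuousLinearMap.mul ℝ ℝ) integrable_logSing
    (ν := volume)
  have i4 := (hf.sq.convolution_integrand (ContinuousLinearMap.mul ℝ ℝ) integrable_logSing
    (ν := volume)).swap
  refine ((i1.add i2).add (i3.add i4)).mono' ?_ (Eventually.of_forall fun z => ?_)
  · refine AEStronglyMeasurable.mul (AEStronglyMeasurable.mul ?_ ?_) ?_
    · exact (Real.measurable_log.comp (by fun_prop :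
        Measurable fun z : Plane × Plane => ‖z.1 - z.2‖)).aestronglyMeasurable
    · exact hf.int.aestronglyMeasurable.comp_fst
    · exact hh.int.aestronglyMeasurable.comp_snd
  · simp only [Pi.add_apply, Function.comp_apply, ContinuousLinearMap.mul_apply', Prod.fst_swap,
      Prod.snd_swap, abs_mul, abs_norm]
    have e : logSing (z.2 - z.1) = logSing (z.1 - z.2) := by
      rw [logSing, logSing, norm_sub_rev]
    rw [e, norm_mul, norm_mul, Real.norm_eq_abs, Real.norm_eq_abs, Real.norm_eq_abs]
    have h1 := abs_log_norm_le (z.1 - z.2)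
    have h2 := norm_sub_le z.1 z.2
    have h3 := logSing_nonneg (z.1 - z.2)
    set s := logSing (z.1 - z.2)
    have h4 : |Real.log ‖z.1 - z.2‖| ≤ ‖z.1‖ + ‖z.2‖ + s := by linarith
    have h5 : |f z.1| * |h z.2| ≤ h z.2 ^ 2 + f z.1 ^ 2 := by
      rw [← sq_abs (h z.2), ← sq_abs (f z.1)]
      nlinarith [sq_nonneg (|f z.1| - |h z.2|), sq_nonneg (|f z.1|), sq_nonneg (|h z.2|)]
    calc |Real.log ‖z.1 - z.2‖| * |f z.1| * |h z.2|
        = |Real.log ‖z.1 - z.2‖| * (|f z.1| * |h z.2|) := by ring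
      _ ≤ (‖z.1‖ + ‖z.2‖ + s) * (|f z.1| * |h z.2|) := by gcongr
      _ = ‖z.1‖ * |f z.1| * |h z.2| + |f z.1| * (‖z.2‖ * |h z.2|)
          + s * (|f z.1| * |h z.2|) := by ring
      _ ≤ ‖z.1‖ * |f z.1| * |h z.2| + |f z.1| * (‖z.2‖ * |h z.2|)
          + s * (h z.2 ^ 2 + f z.1 ^ 2) := by gcongr
      _ = _ := by ring

lemma LogAdm.logForm_eq {f h : Plane → ℝ} (hf : LogAdm f) (hh : LogAdm h) :
    logForm f h = ∫ z : Plane × Plane, Real.log ‖z.1 - z.2‖ * f z.1 * h z.2 ∂(volume.prod volume) :=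
  (integral_prod _ (hf.integrable_prod hh)).symm

lemma LogAdm.logForm_comm {f h : Plane → ℝ} (hf : LogAdm f) (hh : LogAdm h) :
    logForm f h = logForm h f := by
  rw [hf.logForm_eq hh, hh.logForm_eq hf, ← integral_prod_swap]
  congr 1
  ext z
  simp only [Prod.fst_swap, Prod.snd_swap]
  rw [norm_sub_rev]; ring

lemma LogAdm.logForm_add_left {f k h : Plane → ℝ} (hf : LogAdm f) (hk : LogAdm k)
    (hh : LogAdm h) : logForm (fun x => f x + k x) h = logForm f h + logForm k h := by
  rw [(hf.add hk).logForm_eq hh, hf.logForm_eq hh, hk.logForm_eq hh,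
    ← integral_add (hf.integrable_prod hh) (hk.integrable_prod hh)]
  congr 1
  ext z
  ring

lemma logForm_const_mul_left (f h : Plane → ℝ) (c : ℝ) :
    logForm (fun x => c * f x) h = c * logForm f h := by
  unfold logForm
  rw [← integral_const_mul]
  congr 1; ext x
  rw [← integral_const_mul]
  congr 1; ext y
  ring

lemma LogAdm.logForm_line {f k : Plane → ℝ} (hf : LogAdm f) (hk : LogAdm k) (c : ℝ) :
    logForm (fun x => f x + c * k x) (fun x => f x + c * k x)
      = logForm f f + 2 * c * logForm f k + c ^ 2 * logForm k k := by
  have hck := hk.const_mul c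
  have hs := hf.add hck
  rw [hf.logForm_add_left hck hs, hf.logForm_comm hs, hck.logForm_comm hs,
    hf.logForm_add_left hck hf, hf.logForm_add_left hck hck, logForm_const_mul_left,
    hf.logForm_comm hck, logForm_const_mul_left, logForm_const_mul_left, hk.logForm_comm hck,
    logForm_const_mul_left, hk.logForm_comm hf]
  ring

/-- The constant `∫ (log |z|)₋²`. -/
def logSqConst : ℝ := ∫ z : Plane, logSing z ^ 2

lemma logSqConst_nonneg : 0 ≤ logSqConst := integral_nonneg fun _ => sq_nonneg _

/-- Lower bound for the logarithmic potential. -/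
lemma logPot_lower {g : Plane → ℝ} (hg : Integrable g) (hg2 : Integrable fun x => g x ^ 2)
    (hg0 : ∀ x, 0 ≤ g x) {s B : ℝ} (hs : 0 < s) (hB : 0 ≤ B)
    (hle : -(Real.log s * ∫ y, g y) + (logSqConst + s ^ 2 * ∫ y, g y ^ 2) / 2 ≤ B) (x : Plane) :
    -B ≤ ∫ y, Real.log ‖x - y‖ * g y := by
  by_cases hi : Integrable fun y => Real.log ‖x - y‖ * g y
  swap
  · rw [integral_undef hi]; linarith
  have hl1 : Integrable fun y => logSing (s⁻¹ • (x - y)) ^ 2 := by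
    have h1 : Integrable fun z => logSing (s⁻¹ • z) ^ 2 :=
      (integrable_comp_smul_iff volume (fun z => logSing z ^ 2) (inv_ne_zero hs.ne')).2
        integrable_logSing_sq
    exact h1.comp_sub_left x
  have hl2 : ∫ y, logSing (s⁻¹ • (x - y)) ^ 2 = s ^ 2 * logSqConst := by
    rw [integral_sub_left_eq_self (fun z => logSing (s⁻¹ • z) ^ 2) volume x,
      Measure.integral_comp_inv_smul volume (fun z => logSing z ^ 2)]
    simp [logSqConst]
  have hpt : ∀ y, Real.log s * g y - (s⁻¹ ^ 2 / 2 * logSing (s⁻¹ • (x - y)) ^ 2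
      + s ^ 2 / 2 * g y ^ 2) ≤ Real.log ‖x - y‖ * g y ∨ y = x := by
    intro y
    by_cases hxy : y = x
    · exact Or.inr hxy
    left
    have hn : 0 < ‖x - y‖ := norm_pos_iff.2 (sub_ne_zero.2 (Ne.symm hxy))
    have h1 : Real.log s - logSing (s⁻¹ • (x - y)) ≤ Real.log ‖x - y‖ := by
      have : -Real.log ‖s⁻¹ • (x - y)‖ ≤ logSing (s⁻¹ • (x - y)) := le_max_left _ _
      rw [norm_smul, Real.norm_of_nonneg (inv_pos.2 hs).le,
        Real.log_mul (inv_ne_zero hs.ne') hn.ne', Real.log_inv] at this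
      linarith
    have h2 := mul_le_mul_of_nonneg_right h1 (hg0 y)
    have h3 : logSing (s⁻¹ • (x - y)) * g y ≤ s⁻¹ ^ 2 / 2 * logSing (s⁻¹ • (x - y)) ^ 2
      + s ^ 2 / 2 * g y ^ 2 := by
      have := sq_nonneg (s⁻¹ * logSing (s⁻¹ • (x - y)) - s * g y)
      have e : s⁻¹ * s = 1 := inv_mul_cancel₀ hs.ne'
      have e2 : (s⁻¹ * logSing (s⁻¹ • (x - y)) - s * g y) ^ 2
        = s⁻¹ ^ 2 * logSing (s⁻¹ • (x - y)) ^ 2 + s ^ 2 * g y ^ 2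
          - 2 * (s⁻¹ * s) * (logSing (s⁻¹ • (x - y)) * g y) := by ring
      rw [e2, e] at this
      linarith
    linarith
  have hae : ∀ᵐ y : Plane, y ≠ x := by
    rw [ae_iff]; simp
  have hint : Integrable fun y => s⁻¹ ^ 2 / 2 * logSing (s⁻¹ • (x - y)) ^ 2 + s ^ 2 / 2 * g y ^ 2 :=
    (hl1.const_mul (s⁻¹ ^ 2 / 2)).add (hg2.const_mul (s ^ 2 / 2))
  have := integral_mono_ae ((hg.const_mul (Real.log s)).sub hint) hi
    (hae.mono fun y hy => (hpt y).resolve_right hy)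
  simp only [Pi.sub_apply] at this
  rw [integral_sub (hg.const_mul (Real.log s)) hint,
    integral_add (hl1.const_mul _) (hg2.const_mul _), integral_const_mul, integral_const_mul,
    integral_const_mul, hl2] at this
  have e : s⁻¹ ^ 2 / 2 * (s ^ 2 * logSqConst) = logSqConst / 2 := by field_simp
  rw [e] at this
  linarith

lemma logForm_lower {f g : Plane → ℝ} (hf : LogAdm f) (hg : LogAdm g) (hf0 : ∀ x, 0 ≤ f x)
    {B : ℝ} (hB : ∀ x, -B ≤ ∫ y, Real.log ‖x - y‖ * g y) :
    -B * ∫ x, f x ≤ logForm f g := by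
  have hi := (hf.integrable_prod hg).integral_prod_left
  rw [logForm, ← integral_const_mul]
  apply integral_mono (hf.int.const_mul _) hi
  intro x
  have : ∫ y, Real.log ‖x - y‖ * f x * g y = f x * ∫ y, Real.log ‖x - y‖ * g y := by
    rw [← integral_const_mul]
    congr 1; ext y; ring
  simp only [this]
  have := mul_le_mul_of_nonneg_left (hB x) (hf0 x)
  linarith

/-- Upper bound for the logarithmic energy of a density concentrated at scale `τ⁻¹`. -/
lemma logForm_upper {g : Plane → ℝ} (hg : LogAdm g) (hg0 : ∀ x, 0 ≤ g x) {τ : ℝ} (hτ : 0 < τ) :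
    logForm g g ≤ -Real.log τ * (∫ x, g x) ^ 2 + 2 * τ * (∫ x, g x) * ∫ x, ‖x‖ * g x := by
  have hp := hg.integrable_prod hg
  have hpt : ∀ x y : Plane, y ≠ x → Real.log ‖x - y‖ ≤ -Real.log τ + τ * (‖x‖ + ‖y‖) := by
    intro x y hxy
    have hn : 0 < ‖x - y‖ := norm_pos_iff.2 (sub_ne_zero.2 (Ne.symm hxy))
    have h1 := Real.log_le_self (mul_pos hτ hn).le
    rw [Real.log_mul hτ.ne' hn.ne'] at h1
    have h2 := mul_le_mul_of_nonneg_left (norm_sub_le x y) hτ.le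
    linarith
  set m := ∫ x, g x with hm
  set m1 := ∫ x, ‖x‖ * g x with hm1
  have hin : ∀ᵐ x : Plane, ∫ y, Real.log ‖x - y‖ * g x * g y ≤
      (-Real.log τ * m + τ * m1) * g x + τ * m * (‖x‖ * g x) := by
    filter_upwards [hp.prod_right_ae] with x hx
    have hae : ∀ᵐ y : Plane, y ≠ x := by
      rw [ae_iff]; simp
    have i1 := hg.int.const_mul ((-Real.log τ + τ * ‖x‖) * g x)
    have i2 := hg.mom.const_mul (τ * g x)
    have := integral_mono_ae hx (i1.add i2) (hae.mono fun y hy => by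
      have h1 := mul_le_mul_of_nonneg_right (mul_le_mul_of_nonneg_right (hpt x y hy) (hg0 x)) (hg0 y)
      refine h1.trans (le_of_eq ?_)
      simp only [Pi.add_apply]; ring)
    refine this.trans (le_of_eq ?_)
    simp only [Pi.add_apply]
    rw [integral_add i1 i2, integral_const_mul, integral_const_mul]
    ring
  have i3 := hg.int.const_mul (-Real.log τ * m + τ * m1)
  have i4 := hg.mom.const_mul (τ * m)
  have := integral_mono_ae hp.integral_prod_left (i3.add i4) hin
  refine this.trans (le_of_eq ?_)
  simp only [Pi.add_apply]
  rw [integral_add i3 i4, integral_const_mul, integral_const_mul]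
  ring

section Pointwise

variable {u : Plane → ℂ} {ψ : Plane → ℝ} {x : Plane}

lemma fderiv_ofReal_mul (hψ : DifferentiableAt ℝ ψ x) (hu : DifferentiableAt ℝ u x) (e : Plane) :
    fderiv ℝ (fun y => (ψ y : ℂ) * u y) x e
      = (ψ x : ℂ) * fderiv ℝ u x e + ((fderiv ℝ ψ x e : ℝ) : ℂ) * u x := by
  have h1 : HasFDerivAt (fun y => ψ y • u y) _ x := hψ.hasFDerivAt.smul hu.hasFDerivAt
  simp only [Complex.real_smul] at h1
  rw [h1.fderiv]
  simp

lemma fderiv_normSq (hu : DifferentiableAt ℝ u x) (e : Plane) :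
    fderiv ℝ (fun y => ‖u y‖ ^ 2) x e = 2 * ((starRingEnd ℂ) (u x) * fderiv ℝ u x e).re := by
  rw [hu.hasFDerivAt.norm_sq.fderiv]
  simp [two_smul, Complex.inner]
  ring

lemma fderiv_norm_of_ne (hu : DifferentiableAt ℝ u x) (h0 : u x ≠ 0) (e : Plane) :
    fderiv ℝ (fun y => ‖u y‖) x e = ((starRingEnd ℂ) (u x) * fderiv ℝ u x e).re / ‖u x‖ := by
  have h1 := hu.norm ℂ h0
  have h2 := (h1.hasFDerivAt.pow 2).fderiv
  have h3 := fderiv_normSq hu e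
  change fderiv ℝ (fun y => ‖u y‖ ^ 2) x = _ at h2
  rw [h2] at h3
  have : ‖u x‖ ≠ 0 := norm_ne_zero_iff.2 h0
  rw [eq_div_iff this]
  simp only [Nat.add_one_sub_one, pow_one, nsmul_eq_mul, Nat.cast_ofNat, FunLike.coe_smul,
    Pi.smul_apply, smul_eq_mul] at h3
  linarith

lemma fderiv_norm_of_eq_zero (h0 : u x = 0) : fderiv ℝ (fun y => ‖u y‖) x = 0 := by
  apply IsLocalMin.fderiv_eq_zero
  refine Eventually.of_forall fun y => ?_
  simp [h0]

lemma gradAbsSq_nonneg (u : Plane → ℂ) (x : Plane) : 0 ≤ gradAbsSq u x := sq_nonneg _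

lemma gradSq_nonneg (u : Plane → ℂ) (x : Plane) : 0 ≤ gradSq u x :=
  add_nonneg (sq_nonneg _) (sq_nonneg _)

/-- The pointwise diamagnetic inequality. -/
lemma gradAbsSq_le (hu : DifferentiableAt ℝ u x) (Ω : ℝ) :
    gradAbsSq u x ≤ gradSq u x - Ω * momentum u x + Ω ^ 2 / 4 * ‖x‖ ^ 2 * ‖u x‖ ^ 2 := by
  by_cases h0 : u x = 0
  · have := gradSq_nonneg u x
    simpa [gradAbsSq, fderiv_norm_of_eq_zero h0, momentum, h0] using this
  have hn : 0 < ‖u x‖ := norm_pos_iff.2 h0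
  have hsq : ∀ w : ℂ, ‖w‖ ^ 2 = ((((starRingEnd ℂ) (u x) * w).re) / ‖u x‖) ^ 2
      + ((((starRingEnd ℂ) (u x) * w).im) / ‖u x‖) ^ 2 := by
    intro w
    have h1 : ‖(starRingEnd ℂ) (u x) * w‖ ^ 2 = ‖u x‖ ^ 2 * ‖w‖ ^ 2 := by
      rw [norm_mul, Complex.norm_conj, mul_pow]
    rw [← Complex.normSq_eq_norm_sq, Complex.normSq_apply] at h1
    rw [div_pow, div_pow, ← add_div, eq_div_iff (by positivity)]
    nlinarith
  rw [gradAbsSq, opNorm_sq_eq, fderiv_norm_of_ne hu h0, fderiv_norm_of_ne hu h0, gradSq,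
    hsq (d0 u x), hsq (d1 u x), momentum, norm_sq_plane]
  simp only [d0, d1]
  set a0 := ((starRingEnd ℂ) (u x) * fderiv ℝ u x e0).im with ha0
  set a1 := ((starRingEnd ℂ) (u x) * fderiv ℝ u x e1).im with ha1
  have e0' : a0 = a0 / ‖u x‖ * ‖u x‖ := by field_simp
  have e1' : a1 = a1 / ‖u x‖ * ‖u x‖ := by field_simp
  set b0 := a0 / ‖u x‖
  set b1 := a1 / ‖u x‖
  rw [e0', e1']
  nlinarith [sq_nonneg (b0 + Ω / 2 * x 1 * ‖u x‖), sq_nonneg (b1 - Ω / 2 * x 0 * ‖u x‖)]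

lemma gradAbsSq_le_gradSq (hu : DifferentiableAt ℝ u x) : gradAbsSq u x ≤ gradSq u x := by
  simpa using gradAbsSq_le hu 0

lemma gradSq_ofReal_mul (hψ : DifferentiableAt ℝ ψ x) (hu : DifferentiableAt ℝ u x) :
    gradSq (fun y => (ψ y : ℂ) * u y) x = ψ x ^ 2 * gradSq u x
      + ψ x * gradDot ψ (fun y => ‖u y‖ ^ 2) x + ‖fderiv ℝ ψ x‖ ^ 2 * ‖u x‖ ^ 2 := by
  have key : ∀ (r s : ℝ) (w z : ℂ), ‖(r : ℂ) * w + (s : ℂ) * z‖ ^ 2 = r ^ 2 * ‖w‖ ^ 2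
      + r * (s * (2 * ((starRingEnd ℂ) z * w).re)) + s ^ 2 * ‖z‖ ^ 2 := by
    intro r s w z
    rw [← Complex.normSq_eq_norm_sq, ← Complex.normSq_eq_norm_sq, ← Complex.normSq_eq_norm_sq]
    simp only [Complex.normSq_apply, Complex.add_re, Complex.add_im, Complex.mul_re,
      Complex.mul_im, Complex.ofReal_re, Complex.ofReal_im, Complex.conj_re, Complex.conj_im]
    ring
  simp only [gradSq, d0, d1, gradDot, d0R, d1R]
  rw [fderiv_ofReal_mul hψ hu, fderiv_ofReal_mul hψ hu, fderiv_normSq hu, fderiv_normSq hu,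
    key, key, opNorm_sq_eq]
  ring

lemma momentum_ofReal_mul (hψ : DifferentiableAt ℝ ψ x) (hu : DifferentiableAt ℝ u x) :
    momentum (fun y => (ψ y : ℂ) * u y) x = ψ x ^ 2 * momentum u x := by
  simp only [momentum, d0, d1]
  rw [fderiv_ofReal_mul hψ hu, fderiv_ofReal_mul hψ hu]
  simp only [Complex.add_re, Complex.add_im, Complex.mul_re, Complex.mul_im, Complex.ofReal_re,
    Complex.ofReal_im, Complex.conj_re, Complex.conj_im]
  ring

lemma abs_momentum_le (u : Plane → ℂ) (x : Plane) :
    |momentum u x| ≤ ‖x‖ ^ 2 * ‖u x‖ ^ 2 + gradSq u x := by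
  have h : ∀ w : ℂ, |((starRingEnd ℂ) (u x) * w).im| ≤ ‖u x‖ * ‖w‖ := fun w => by
    refine (Complex.abs_im_le_norm _).trans ?_
    rw [norm_mul, Complex.norm_conj]
  have h0 := h (d0 u x)
  have h1 := h (d1 u x)
  rw [momentum, gradSq, norm_sq_plane]
  refine (abs_add_le _ _).trans ?_
  rw [abs_mul, abs_mul, abs_neg]
  have k0 := mul_le_mul_of_nonneg_left h0 (abs_nonneg (x 1))
  have k1 := mul_le_mul_of_nonneg_left h1 (abs_nonneg (x 0))
  have s0 := sq_abs (x 0)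
  have s1 := sq_abs (x 1)
  rw [← s0, ← s1]
  nlinarith [sq_nonneg (|x 1| * ‖u x‖ - ‖d0 u x‖), sq_nonneg (|x 0| * ‖u x‖ - ‖d1 u x‖),
    sq_nonneg (‖d0 u x‖), sq_nonneg (‖d1 u x‖), sq_nonneg (|x 1| * ‖u x‖),
    sq_nonneg (|x 0| * ‖u x‖)]

end Pointwise

lemma measurable_d0 (u : Plane → ℂ) : Measurable (d0 u) := measurable_fderiv_apply_const ℝ u e0
lemma measurable_d1 (u : Plane → ℂ) : Measurable (d1 u) := measurable_fderiv_apply_const ℝ u e1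

lemma measurable_gradSq (u : Plane → ℂ) : Measurable (gradSq u) :=
  ((measurable_d0 u).norm.pow_const 2).add ((measurable_d1 u).norm.pow_const 2)

lemma measurable_gradAbsSq (u : Plane → ℂ) : Measurable (gradAbsSq u) :=
  (measurable_fderiv ℝ _).norm.pow_const 2

lemma measurable_momentum {u : Plane → ℂ} (hu : Continuous u) : Measurable (momentum u) := by
  have hc : Measurable fun x => (starRingEnd ℂ) (u x) := (Complex.continuous_conj.comp hu).measurable
  exact ((by fun_prop : Measurable fun x : Plane => -(x 1)).mul
    (Complex.measurable_im.comp (hc.mul (measurable_d0 u)))).add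
    ((by fun_prop : Measurable fun x : Plane => x 0).mul
    (Complex.measurable_im.comp (hc.mul (measurable_d1 u))))

lemma InH1.integrable_gradAbsSq {u : Plane → ℂ} (hu : InH1 u) : Integrable (gradAbsSq u) :=
  hu.2.2.mono' (measurable_gradAbsSq u).aestronglyMeasurable (Eventually.of_forall fun x => by
    rw [Real.norm_of_nonneg (gradAbsSq_nonneg u x)]
    exact gradAbsSq_le_gradSq (hu.1 x))

/-- Fatou's lemma for Bochner integrals of nonnegative functions. -/
lemma integrable_of_tendsto_of_integral_le {F : ℕ → Plane → ℝ} {f : Plane → ℝ} {c : ℕ → ℝ} {C : ℝ}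
    (hF : ∀ n, Integrable (F n)) (hF0 : ∀ n x, 0 ≤ F n x)
    (hlim : ∀ x, Tendsto (fun n => F n x) atTop (𝓝 (f x))) (hc : ∀ n, ∫ x, F n x ≤ c n)
    (hC : Tendsto c atTop (𝓝 C)) : Integrable f ∧ ∫ x, f x ≤ C := by
  have hf0 : ∀ x, 0 ≤ f x := fun x => ge_of_tendsto' (hlim x) fun n => hF0 n x
  have hC0 : 0 ≤ C := ge_of_tendsto' hC fun n => (integral_nonneg (hF0 n)).trans (hc n)
  have hm : AEStronglyMeasurable f volume :=
    aestronglyMeasurable_of_tendsto_ae atTop (fun n => (hF n).aestronglyMeasurable)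
      (Eventually.of_forall hlim)
  have key : ∫⁻ x, ENNReal.ofReal (f x) ≤ ENNReal.ofReal C := by
    calc ∫⁻ x, ENNReal.ofReal (f x)
        = ∫⁻ x, liminf (fun n => ENNReal.ofReal (F n x)) atTop := by
          congr 1; ext x
          exact ((ENNReal.continuous_ofReal.tendsto _).comp (hlim x)).liminf_eq.symm
      _ ≤ liminf (fun n => ∫⁻ x, ENNReal.ofReal (F n x)) atTop :=
          lintegral_liminf_le' fun n => (hF n).aestronglyMeasurable.aemeasurable.ennreal_ofReal
      _ ≤ liminf (fun n => ENNReal.ofReal (c n)) atTop := by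
          refine liminf_le_liminf (Eventually.of_forall fun n => ?_)
          rw [← ofReal_integral_eq_lintegral_ofReal (hF n) (Eventually.of_forall (hF0 n))]
          exact ENNReal.ofReal_le_ofReal (hc n)
      _ = ENNReal.ofReal C := ((ENNReal.continuous_ofReal.tendsto _).comp hC).liminf_eq
  have hi : Integrable f :=
    ⟨hm, (hasFiniteIntegral_iff_ofReal (Eventually.of_forall hf0)).2
      (key.trans_lt ENNReal.ofReal_lt_top)⟩
  refine ⟨hi, ?_⟩
  rw [← ofReal_integral_eq_lintegral_ofReal hi (Eventually.of_forall hf0)] at key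
  exact (ENNReal.ofReal_le_ofReal_iff hC0).1 key

/-- A differentiable regularisation of `χ |v|`. -/
def regAbs (χ : Plane → ℝ) (δ : ℝ) (v : Plane → ℂ) (x : Plane) : ℝ :=
  Real.sqrt ((χ x * ‖v x‖) ^ 2 + δ ^ 2) - δ

section RegAbs

variable {χ : Plane → ℝ} {δ : ℝ} {v : Plane → ℂ} {x : Plane}

lemma regAbs_nonneg : 0 ≤ regAbs χ δ v x := by
  rw [regAbs, sub_nonneg]
  apply Real.le_sqrt_of_sq_le
  linarith [sq_nonneg (χ x * ‖v x‖)]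

lemma regAbs_le (hδ : 0 ≤ δ) (hχ : 0 ≤ χ x) : regAbs χ δ v x ≤ χ x * ‖v x‖ := by
  have : 0 ≤ χ x * ‖v x‖ := mul_nonneg hχ (norm_nonneg _)
  rw [regAbs, sub_le_iff_le_add]
  apply Real.sqrt_le_iff.2 ⟨by positivity, ?_⟩
  nlinarith

lemma differentiable_regAbs (hδ : 0 < δ) (hχ : Differentiable ℝ χ) (hv : Differentiable ℝ v) :
    Differentiable ℝ (regAbs χ δ v) := by
  intro x
  have h1 : DifferentiableAt ℝ (fun y => χ y ^ 2 * ‖v y‖ ^ 2 + δ ^ 2) x :=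
    (((hχ x).pow 2).mul ((hv x).norm_sq ℂ)).add_const _
  have : regAbs χ δ v = fun y => Real.sqrt (χ y ^ 2 * ‖v y‖ ^ 2 + δ ^ 2) - δ := by
    ext y; rw [regAbs, mul_pow]
  rw [this]
  exact (h1.sqrt (by positivity)).sub_const δ

lemma norm_fderiv_regAbs_le (hδ : 0 < δ) (hχ : Differentiable ℝ χ) (hv : Differentiable ℝ v)
    (hχ0 : 0 ≤ χ x) (hχ1 : χ x ≤ 1) :
    ‖fderiv ℝ (regAbs χ δ v) x‖ ≤ ‖fderiv ℝ (fun y => ‖v y‖) x‖ + ‖fderiv ℝ χ x‖ * ‖v x‖ := by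
  by_cases h0 : v x = 0
  · have : fderiv ℝ (regAbs χ δ v) x = 0 := by
      apply IsLocalMin.fderiv_eq_zero
      refine Eventually.of_forall fun y => ?_
      have : regAbs χ δ v x = 0 := by simp [regAbs, h0, Real.sqrt_sq hδ.le]
      rw [this]; exact regAbs_nonneg
    rw [this, norm_zero]
    positivity
  have hn := (hv x).norm ℂ h0
  have hh := (hχ x).hasFDerivAt.mul hn.hasFDerivAt
  have hs : HasFDerivAt (regAbs χ δ v) _ x :=
    ((hh.pow 2).add_const (δ ^ 2)).sqrt (by positivity) |>.sub_const δ
  rw [hs.fderiv]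
  simp only [Nat.add_one_sub_one, pow_one, nsmul_eq_mul, Nat.cast_ofNat, Pi.mul_apply]
  rw [smul_smul, norm_smul]
  have hle : ‖1 / (2 * Real.sqrt ((χ x * ‖v x‖) ^ 2 + δ ^ 2)) * (2 * (χ x * ‖v x‖))‖ ≤ 1 := by
    have hp : 0 < Real.sqrt ((χ x * ‖v x‖) ^ 2 + δ ^ 2) := Real.sqrt_pos.2 (by positivity)
    have : 0 ≤ χ x * ‖v x‖ := by positivity
    rw [Real.norm_of_nonneg (by positivity), div_mul_eq_mul_div, one_mul,
      mul_div_mul_left _ _ two_ne_zero, div_le_one hp]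
    apply Real.le_sqrt_of_sq_le
    linarith [sq_nonneg δ]
  refine (mul_le_of_le_one_left (norm_nonneg _) hle).trans ?_
  refine (norm_add_le _ _).trans ?_
  rw [norm_smul, norm_smul, Real.norm_of_nonneg hχ0, Real.norm_of_nonneg (norm_nonneg _),
    mul_comm ‖v x‖]
  have := mul_le_of_le_one_left (norm_nonneg (fderiv ℝ (fun y => ‖v y‖) x)) hχ1
  linarith

end RegAbs

lemma integral_comp_scale (F : Plane → ℝ) (τ : ℝ) :
    ∫ x, F (τ • x) = (τ ^ 2)⁻¹ * ∫ x, F x := by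
  rw [Measure.integral_comp_smul]
  simp

lemma integrable_comp_scale {F : Plane → ℝ} (hF : Integrable F) {τ : ℝ} (hτ : 0 < τ) :
    Integrable fun x => F (τ • x) := (integrable_comp_smul_iff volume F hτ.ne').2 hF

lemma hasFDerivAt_scale {f : Plane → ℝ} (hf : Differentiable ℝ f) (c τ : ℝ) (x : Plane) :
    HasFDerivAt (fun y => c * f (τ • y)) ((c * τ) • fderiv ℝ f (τ • x)) x := by
  have h1 : HasFDerivAt (fun y : Plane => τ • y) (τ • ContinuousLinearMap.id ℝ Plane) x :=
    (hasFDerivAt_id x).const_smul τ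
  have h2 := ((hf (τ • x)).hasFDerivAt.comp x h1).const_mul c
  refine h2.congr_fderiv ?_
  ext v
  simp [mul_assoc]

lemma fderiv_ofReal_comp {h : Plane → ℝ} {x : Plane} (hh : DifferentiableAt ℝ h x) (e : Plane) :
    fderiv ℝ (fun y => (h y : ℂ)) x e = ((fderiv ℝ h x e : ℝ) : ℂ) := by
  have := (Complex.ofRealCLM.hasFDerivAt.comp x hh.hasFDerivAt).fderiv
  change fderiv ℝ (fun y => (h y : ℂ)) x = _ at this
  rw [this]; simp

lemma gradSq_ofReal {h : Plane → ℝ} {x : Plane} (hh : DifferentiableAt ℝ h x) :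
    gradSq (fun y => (h y : ℂ)) x = ‖fderiv ℝ h x‖ ^ 2 := by
  rw [gradSq, d0, d1, fderiv_ofReal_comp hh, fderiv_ofReal_comp hh, opNorm_sq_eq]
  simp

lemma momentum_ofReal {h : Plane → ℝ} {x : Plane} (hh : DifferentiableAt ℝ h x) :
    momentum (fun y => (h y : ℂ)) x = 0 := by
  rw [momentum, d0, d1, fderiv_ofReal_comp hh, fderiv_ofReal_comp hh]
  simp

/-- The energy of a rescaled real profile bounds the energy of a minimizer. -/
lemma IsMinimizer.energy_le_profile {V : Plane → ℝ} {Ω a : ℝ} {w : Plane → ℂ}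
    (hw : IsMinimizer V Ω a w) (ha : 0 < a) {f : Plane → ℝ} (hf : Differentiable ℝ f)
    (h2 : Integrable fun x => f x ^ 2) (h4 : Integrable fun x => f x ^ 4)
    (hd : Integrable fun x => ‖fderiv ℝ f x‖ ^ 2) (hm : Integrable fun x => ‖x‖ * f x ^ 2)
    (hpos : 0 < ∫ x, f x ^ 2) {τ K : ℝ} (hτ : 0 < τ)
    (hVi : Integrable fun x => V (τ⁻¹ • x) * f x ^ 2) (hVK : ∫ x, V (τ⁻¹ • x) * f x ^ 2 ≤ K) :
    Ea V Ω w ≤ a / (∫ x, f x ^ 2) * (τ ^ 2 * (∫ x, ‖fderiv ℝ f x‖ ^ 2) + K)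
      - (a / ∫ x, f x ^ 2) ^ 2 / 2 * τ ^ 2 * (∫ x, f x ^ 4)
      + 1 / 2 * (-Real.log τ * a ^ 2 + 2 * a * (a / ∫ x, f x ^ 2) * ∫ x, ‖x‖ * f x ^ 2) := by
  set m := ∫ x, f x ^ 2 with hmdef
  set c := Real.sqrt (a / m) with hc
  have hc2 : c ^ 2 = a / m := Real.sq_sqrt (by positivity)
  set h : Plane → ℝ := fun y => c * τ * f (τ • y) with hh
  have hfd : ∀ x, HasFDerivAt h ((c * τ * τ) • fderiv ℝ f (τ • x)) x :=
    hasFDerivAt_scale hf (c * τ) τ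
  set v : Plane → ℂ := fun y => (h y : ℂ) with hv
  have hvn : ∀ y, ‖v y‖ ^ 2 = c ^ 2 * τ ^ 2 * f (τ • y) ^ 2 := fun y => by
    simp only [hv, hh, Complex.norm_real, Real.norm_eq_abs, sq_abs]; ring
  have hvn4 : ∀ y, ‖v y‖ ^ 4 = c ^ 4 * τ ^ 4 * f (τ • y) ^ 4 := fun y => by
    rw [show ‖v y‖ ^ 4 = (‖v y‖ ^ 2) ^ 2 by ring, hvn]; ring
  have hgrad : ∀ y, gradSq v y = c ^ 2 * τ ^ 4 * ‖fderiv ℝ f (τ • y)‖ ^ 2 := fun y => by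
    rw [gradSq_ofReal (hfd y).differentiableAt, (hfd y).fderiv, norm_smul, mul_pow,
      Real.norm_eq_abs, sq_abs]; ring
  have i2 : Integrable fun y => ‖v y‖ ^ 2 := by
    simp only [hvn]; exact (integrable_comp_scale h2 hτ).const_mul _
  have ig : Integrable (gradSq v) := by
    refine Integrable.congr ?_ (Eventually.of_forall fun y => (hgrad y).symm)
    exact (integrable_comp_scale hd hτ).const_mul _
  have eV : ∀ y, V y * ‖v y‖ ^ 2 = c ^ 2 * τ ^ 2 * (V (τ⁻¹ • τ • y) * f (τ • y) ^ 2) := fun y => by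
    rw [hvn, inv_smul_smul₀ hτ.ne']; ring
  have iV : Integrable fun y => V y * ‖v y‖ ^ 2 := by
    simp only [eV]
    exact (integrable_comp_scale (F := fun x => V (τ⁻¹ • x) * f x ^ 2) hVi hτ).const_mul _
  have hmass : ∫ y, ‖v y‖ ^ 2 = a := by
    simp only [hvn]
    rw [integral_const_mul, integral_comp_scale (fun x => f x ^ 2) τ, hc2]
    rw [← hmdef]
    have := hpos.ne'
    field_simp
  have hvdiff : Differentiable ℝ v := fun y =>
    Complex.ofRealCLM.differentiableAt.comp y (hfd y).differentiableAt
  have hvS : v ∈ Sset V a := ⟨⟨⟨hvdiff, i2, ig⟩, iV⟩, hmass⟩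
  refine (hw.2 v hvS).trans ?_
  have hmom : ∫ y, momentum v y = 0 := by
    rw [integral_congr_ae (Eventually.of_forall fun y => momentum_ofReal (hfd y).differentiableAt)]
    simp
  have hadm : LogAdm fun y => ‖v y‖ ^ 2 := by
    refine ⟨i2, ?_, ?_⟩
    · have e : ∀ y, (‖v y‖ ^ 2) ^ 2 = c ^ 4 * τ ^ 4 * f (τ • y) ^ 4 := fun y => by
        rw [← hvn4]; ring
      simp only [e]
      exact (integrable_comp_scale h4 hτ).const_mul _
    · have e : ∀ y, ‖y‖ * ‖v y‖ ^ 2 = c ^ 2 * τ * (‖τ • y‖ * f (τ • y) ^ 2) := fun y => by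
        rw [hvn, norm_smul, Real.norm_of_nonneg hτ.le]; ring
      simp only [e]
      exact (integrable_comp_scale hm hτ).const_mul _
  have hlog := logForm_upper hadm (fun y => sq_nonneg _) hτ
  rw [← logConv_eq, hmass] at hlog
  have hmom1 : ∫ y, ‖y‖ * ‖v y‖ ^ 2 = c ^ 2 * τ⁻¹ * ∫ x, ‖x‖ * f x ^ 2 := by
    have e : ∀ y, ‖y‖ * ‖v y‖ ^ 2 = c ^ 2 * τ * (‖τ • y‖ * f (τ • y) ^ 2) := fun y => by
      rw [hvn, norm_smul, Real.norm_of_nonneg hτ.le]; ring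
    simp only [e]
    rw [integral_const_mul, integral_comp_scale (fun x => ‖x‖ * f x ^ 2) τ]
    field_simp
  have hkin : ∫ y, (gradSq v y + V y * ‖v y‖ ^ 2)
      = c ^ 2 * (τ ^ 2 * (∫ x, ‖fderiv ℝ f x‖ ^ 2) + ∫ x, V (τ⁻¹ • x) * f x ^ 2) := by
    rw [integral_add ig iV, integral_congr_ae (Eventually.of_forall hgrad),
      integral_congr_ae (Eventually.of_forall eV), integral_const_mul, integral_const_mul,
      integral_comp_scale (fun x => ‖fderiv ℝ f x‖ ^ 2) τ,
      integral_comp_scale (fun x => V (τ⁻¹ • x) * f x ^ 2) τ]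
    field_simp
  have hq : ∫ y, ‖v y‖ ^ 4 = c ^ 4 * τ ^ 2 * ∫ x, f x ^ 4 := by
    simp only [hvn4]
    rw [integral_const_mul, integral_comp_scale (fun x => f x ^ 4) τ]
    field_simp
  rw [Ea, hmom, hkin, hq, mul_zero, sub_zero, ← hc2]
  rw [hmom1] at hlog
  have e1 : 2 * τ * a * (c ^ 2 * τ⁻¹ * ∫ x, ‖x‖ * f x ^ 2)
      = 2 * a * c ^ 2 * ∫ x, ‖x‖ * f x ^ 2 := by field_simp
  rw [e1] at hlog
  have e2 : c ^ 2 * (τ ^ 2 * (∫ x, ‖fderiv ℝ f x‖ ^ 2) + ∫ x, V (τ⁻¹ • x) * f x ^ 2)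
      ≤ c ^ 2 * (τ ^ 2 * (∫ x, ‖fderiv ℝ f x‖ ^ 2) + K) := by gcongr
  have e3 : c ^ 4 = (c ^ 2) ^ 2 := by ring
  rw [e3]
  linarith

/-- The Gagliardo--Nirenberg inequality for `u`, with sharp constant `2 / A`, on compactly
supported profiles. -/
lemma gn_of_compactSupport {V : Plane → ℝ} {Ω A : ℝ} (hV : V110 V) (hA : 0 < A)
    {u : ℝ → Plane → ℂ} (hmin : ∀ a ∈ Ioo (0 : ℝ) A, IsMinimizer V Ω a (u a))
    {f : Plane → ℝ} (hf : Differentiable ℝ f) (hc : HasCompactSupport f)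
    (hd : Integrable fun x => ‖fderiv ℝ f x‖ ^ 2) :
    A / 2 * ∫ x, f x ^ 4 ≤ (∫ x, f x ^ 2) * ∫ x, ‖fderiv ℝ f x‖ ^ 2 := by
  have hfc := hf.continuous
  have h2 : Integrable fun x => f x ^ 2 := (hfc.pow 2).integrable_of_hasCompactSupport
    (by simpa only [sq] using hc.mul_left)
  have h4 : Integrable fun x => f x ^ 4 := (hfc.pow 4).integrable_of_hasCompactSupport
    (by simpa only [pow_succ _ 3] using hc.mul_left)
  have hm : Integrable fun x => ‖x‖ * f x ^ 2 :=
    (continuous_norm.mul (hfc.pow 2)).integrable_of_hasCompactSupport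
      (by simpa only [sq, ← mul_assoc] using hc.mul_left)
  set D := ∫ x, ‖fderiv ℝ f x‖ ^ 2 with hD
  set m := ∫ x, f x ^ 2 with hmdef
  set q := ∫ x, f x ^ 4 with hq
  have hm0 : 0 ≤ m := integral_nonneg fun _ => sq_nonneg _
  rcases hm0.eq_or_lt with h0 | hpos
  · have hz : (fun x => f x ^ 2) =ᵐ[volume] 0 :=
      (integral_eq_zero_iff_of_nonneg (fun _ => sq_nonneg _) h2).1 h0.symm
    have : q = 0 := by
      rw [hq, ← integral_zero Plane ℝ]
      apply integral_congr_ae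
      filter_upwards [hz] with x hx
      have : f x ^ 2 = 0 := hx
      rw [show f x ^ 4 = (f x ^ 2) ^ 2 by ring, this]; norm_num
    rw [this, ← h0]; simp
  obtain ⟨R, hR⟩ := hc.isCompact.isBounded.subset_closedBall (0 : Plane)
  obtain ⟨C, hC⟩ := hV.2.2.1 R
  have hVb : ∀ τ : ℝ, 1 ≤ τ → ∀ x, V (τ⁻¹ • x) * f x ^ 2 ≤ C * f x ^ 2 := by
    intro τ hτ x
    by_cases hx : f x = 0
    · simp [hx]
    · have hxR := hR (subset_tsupport f hx)
      rw [mem_closedBall_zero_iff] at hxR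
      have : ‖τ⁻¹ • x‖ ≤ R := by
        rw [norm_smul, Real.norm_of_nonneg (by positivity)]
        exact (mul_le_of_le_one_left (norm_nonneg _) (inv_le_one_of_one_le₀ hτ)).trans hxR
      have := hC _ this
      gcongr
  have hVi : ∀ τ : ℝ, 1 ≤ τ → Integrable fun x => V (τ⁻¹ • x) * f x ^ 2 := by
    intro τ hτ
    refine (h2.const_mul C).mono' ?_ (Eventually.of_forall fun x => ?_)
    · exact ((hV.1.comp (measurable_const_smul _)).mul (hfc.measurable.pow_const 2)).aestronglyMeasurable
    · rw [Real.norm_of_nonneg (mul_nonneg (hV.2.1 _) (sq_nonneg _))]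
      exact hVb τ hτ x
  have hVK : ∀ τ : ℝ, 1 ≤ τ → ∫ x, V (τ⁻¹ • x) * f x ^ 2 ≤ C * m := by
    intro τ hτ
    rw [hmdef, ← integral_const_mul]
    exact integral_mono (hVi τ hτ) (h2.const_mul C) (hVb τ hτ)
  have key : ∀ a ∈ Ioo (0 : ℝ) A, a / 2 * q ≤ m * D := by
    intro a ha
    by_contra! hlt
    have hX : a / m * D - (a / m) ^ 2 / 2 * q < 0 := by
      have : a / m * D - (a / m) ^ 2 / 2 * q = a / m ^ 2 * (m * D - a / 2 * q) := by
        field_simp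
      rw [this]
      have := ha.1
      exact mul_neg_of_pos_of_neg (by positivity) (by linarith)
    set X := a / m * D - (a / m) ^ 2 / 2 * q
    set Y := a / m * (C * m) + a * (a / m) * ∫ x, ‖x‖ * f x ^ 2
    set E := Ea V Ω (u a)
    have hb : ∀ τ : ℝ, 1 ≤ τ → E ≤ τ ^ 2 * X + Y := by
      intro τ hτ
      have hτ0 : 0 < τ := by linarith
      have := (hmin a ha).energy_le_profile ha.1 hf h2 h4 hd hm hpos hτ0 (hVi τ hτ) (hVK τ hτ)
      have hl := mul_nonneg (Real.log_nonneg hτ) (sq_nonneg a)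
      have e : τ ^ 2 * X + Y = a / m * (τ ^ 2 * D + C * m) - (a / m) ^ 2 / 2 * τ ^ 2 * q
        + 1 / 2 * (2 * a * (a / m) * ∫ x, ‖x‖ * f x ^ 2) := by ring
      rw [e]
      linarith
    have hlim : Tendsto (fun τ : ℝ => τ ^ 2 * X + Y) atTop atBot := by
      apply tendsto_atBot_add_const_right
      exact (tendsto_pow_atTop two_ne_zero).atTop_mul_const_of_neg hX
    obtain ⟨τ, h1, h2⟩ := ((hlim.eventually_lt_atBot E).and (eventually_ge_atTop 1)).exists
    exact absurd (hb τ h2) (not_le.2 h1)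
  have hlim : Tendsto (fun a : ℝ => a / 2 * q) (𝓝[<] A) (𝓝 (A / 2 * q)) := by
    have : Continuous fun a : ℝ => a / 2 * q := by fun_prop
    exact (this.tendsto A).mono_left nhdsWithin_le_nhds
  apply le_of_tendsto hlim
  filter_upwards [Ioo_mem_nhdsLT hA] with a ha using key a ha

/-- The Gagliardo--Nirenberg inequality with sharp constant `2 / A`. -/
def GN (A : ℝ) : Prop := ∀ v : Plane → ℂ, InH1 v → Integrable (fun x => ‖v x‖ ^ 4) ∧
  A / 2 * ∫ x, ‖v x‖ ^ 4 ≤ (∫ x, ‖v x‖ ^ 2) * ∫ x, gradAbsSq v x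

lemma gn_of_minimizers {V : Plane → ℝ} {Ω A : ℝ} (hV : V110 V) (hA : 0 < A)
    {u : ℝ → Plane → ℂ} (hmin : ∀ a ∈ Ioo (0 : ℝ) A, IsMinimizer V Ω a (u a)) : GN A := by
  intro v hv
  have hvc := hv.1.continuous
  have hgi := hv.integrable_gradAbsSq
  set δ : ℕ → ℝ := fun n => 1 / ((n : ℝ) + 1) with hδ
  have hδ0 : ∀ n, 0 < δ n := fun n => by simp only [hδ]; positivity
  have hδlim : Tendsto δ atTop (𝓝 0) := tendsto_one_div_add_atTop_nhds_zero_nat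
  have hn : ∀ n : ℕ, (0 : ℝ) < n + 1 := fun n => by positivity
  set χ : ℕ → Plane → ℝ := fun n => cutoff 0 (n + 1) with hχ
  have hχd : ∀ n, Differentiable ℝ (χ n) := fun n =>
    differentiable_of_contDiff_two (isTest_cutoff 0 (hn n)).1
  set f : ℕ → Plane → ℝ := fun n => regAbs (χ n) (δ n) v with hfdef
  have hfd : ∀ n, Differentiable ℝ (f n) := fun n => differentiable_regAbs (hδ0 n) (hχd n) hv.1
  have hf0 : ∀ n x, 0 ≤ f n x := fun n x => regAbs_nonneg
  have hfle : ∀ n x, f n x ≤ χ n x * ‖v x‖ := fun n x =>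
    regAbs_le (hδ0 n).le (cutoff_nonneg _ _ _)
  have hfv : ∀ n x, f n x ≤ ‖v x‖ := fun n x =>
    (hfle n x).trans (mul_le_of_le_one_left (norm_nonneg _) (cutoff_le_one _ _ _))
  have hcs : ∀ n, HasCompactSupport (f n) := fun n => by
    refine (isTest_cutoff 0 (hn n)).2.mono fun x hx => ?_
    intro h0
    apply hx
    have h1 := hfle n x
    have : χ n x = 0 := h0
    rw [this, zero_mul] at h1
    exact le_antisymm h1 (hf0 n x)
  have hK := cutConst_pos
  set M := ∫ x, ‖v x‖ ^ 2 with hM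
  set D := ∫ x, gradAbsSq v x with hD
  have hM0 : 0 ≤ M := integral_nonneg fun _ => sq_nonneg _
  have hD0 : 0 ≤ D := integral_nonneg fun x => gradAbsSq_nonneg v x
  have hgradpt : ∀ n x, ‖fderiv ℝ (f n) x‖ ^ 2 ≤
      (1 + δ n) * gradAbsSq v x + (16 * cutConst ^ 2 * (δ n + δ n ^ 2)) * ‖v x‖ ^ 2 := by
    intro n x
    have h1 := norm_fderiv_regAbs_le (hδ0 n) (hχd n) hv.1 (cutoff_nonneg 0 (n + 1) x)
      (cutoff_le_one 0 (n + 1) x)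
    have h2 : ‖fderiv ℝ (χ n) x‖ ≤ 4 * cutConst * δ n := by
      refine (norm_fderiv_cutoff_le 0 (hn n) x).trans (le_of_eq ?_)
      simp only [hδ]; ring
    have h3 : ‖fderiv ℝ (f n) x‖ ≤ ‖fderiv ℝ (fun y => ‖v y‖) x‖ + 4 * cutConst * δ n * ‖v x‖ :=
      h1.trans (by gcongr)
    have h4 := pow_le_pow_left₀ (norm_nonneg _) h3 2
    refine h4.trans ?_
    rw [gradAbsSq]
    set p := ‖fderiv ℝ (fun y => ‖v y‖) x‖
    set q := ‖v x‖
    have hd := hδ0 n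
    have := mul_nonneg hd.le (sq_nonneg (p - 4 * cutConst * q))
    nlinarith
  have hdi : ∀ n, Integrable fun x => ‖fderiv ℝ (f n) x‖ ^ 2 := fun n =>
    ((hgi.const_mul (1 + δ n)).add (hv.2.1.const_mul (16 * cutConst ^ 2 * (δ n + δ n ^ 2)))).mono'
      ((measurable_fderiv ℝ _).norm.pow_const 2).aestronglyMeasurable
      (Eventually.of_forall fun x => by
        rw [Real.norm_of_nonneg (sq_nonneg _)]; exact hgradpt n x)
  have hdle : ∀ n, ∫ x, ‖fderiv ℝ (f n) x‖ ^ 2 ≤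
      (1 + δ n) * D + (16 * cutConst ^ 2 * (δ n + δ n ^ 2)) * M := fun n => by
    rw [hD, hM, ← integral_const_mul, ← integral_const_mul,
      ← integral_add (hgi.const_mul _) (hv.2.1.const_mul _)]
    exact integral_mono (hdi n) ((hgi.const_mul _).add (hv.2.1.const_mul _)) (hgradpt n)
  have hf2 : ∀ n, ∫ x, f n x ^ 2 ≤ M := fun n => by
    apply integral_mono _ hv.2.1 fun x => pow_le_pow_left₀ (hf0 n x) (hfv n x) 2
    exact ((hfd n).continuous.pow 2).integrable_of_hasCompactSupport
      (by simpa only [sq] using (hcs n).mul_left)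
  have hgn : ∀ n, ∫ x, f n x ^ 4 ≤
      2 / A * (M * ((1 + δ n) * D + (16 * cutConst ^ 2 * (δ n + δ n ^ 2)) * M)) := fun n => by
    have h1 := gn_of_compactSupport hV hA hmin (hfd n) (hcs n) (hdi n)
    have h2 : (∫ x, f n x ^ 2) * ∫ x, ‖fderiv ℝ (f n) x‖ ^ 2 ≤
        M * ((1 + δ n) * D + (16 * cutConst ^ 2 * (δ n + δ n ^ 2)) * M) :=
      mul_le_mul (hf2 n) (hdle n) (integral_nonneg fun _ => sq_nonneg _) hM0
    rw [div_mul_eq_mul_div, le_div_iff₀ hA]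
    linarith
  have hlimC : Tendsto (fun n => 2 / A * (M * ((1 + δ n) * D
      + (16 * cutConst ^ 2 * (δ n + δ n ^ 2)) * M))) atTop (𝓝 (2 / A * (M * D))) := by
    have hcont : Continuous fun t : ℝ => 2 / A * (M * ((1 + t) * D
      + (16 * cutConst ^ 2 * (t + t ^ 2)) * M)) := by fun_prop
    have := (hcont.tendsto 0).comp hδlim
    simpa [Function.comp_def] using this
  have hlim : ∀ x, Tendsto (fun n => f n x ^ 4) atTop (𝓝 (‖v x‖ ^ 4)) := by
    intro x
    have h1 : Tendsto (fun n => f n x) atTop (𝓝 ‖v x‖) := by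
      have hcont : Continuous fun p : ℝ × ℝ => Real.sqrt ((p.1 * ‖v x‖) ^ 2 + p.2 ^ 2) - p.2 := by
        fun_prop
      have := (hcont.tendsto (1, 0)).comp ((tendsto_cutoff 0 x).prodMk_nhds hδlim)
      simpa [Function.comp_def, hfdef, regAbs, hχ] using this
    exact h1.pow 4
  have hi4 : ∀ n, Integrable fun x => f n x ^ 4 := fun n =>
    ((hfd n).continuous.pow 4).integrable_of_hasCompactSupport
      (by simpa only [pow_succ _ 3] using (hcs n).mul_left)
  obtain ⟨r1, r2⟩ := integrable_of_tendsto_of_integral_le hi4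
    (fun n x => pow_nonneg (hf0 n x) 4) hlim hgn hlimC
  refine ⟨r1, ?_⟩
  calc A / 2 * ∫ x, ‖v x‖ ^ 4 ≤ A / 2 * (2 / A * (M * D)) := by gcongr
    _ = M * D := by field_simp

lemma V110.norm_sq_le {V : Plane → ℝ} (hV : V110 V) :
    ∃ K : ℝ, 0 ≤ K ∧ ∀ x, ‖x‖ ^ 2 ≤ K + K * V x := by
  obtain ⟨-, hV0, -, c, hc, R, hR⟩ := hV
  refine ⟨R ^ 2 + c⁻¹, by positivity, fun x => ?_⟩
  have h1 : 0 ≤ R ^ 2 * V x := mul_nonneg (sq_nonneg _) (hV0 x)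
  have h2 : 0 ≤ c⁻¹ * V x := mul_nonneg (by positivity) (hV0 x)
  have h3 : 0 < c⁻¹ := by positivity
  rcases le_total R ‖x‖ with h | h
  · have h4 := hR x h
    have h5 : ‖x‖ ^ 2 ≤ c⁻¹ * V x := by
      rw [inv_mul_eq_div, le_div_iff₀ hc]; linarith
    nlinarith [sq_nonneg R]
  · have h4 : ‖x‖ ^ 2 ≤ R ^ 2 := pow_le_pow_left₀ (norm_nonneg _) h 2
    nlinarith

section Basics

variable {V : Plane → ℝ} {u : Plane → ℂ}

lemma InH.integrable_norm_sq_mul (hV : V110 V) (hu : InH V u) :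
    Integrable fun x => ‖x‖ ^ 2 * ‖u x‖ ^ 2 := by
  obtain ⟨K, -, h⟩ := hV.norm_sq_le
  have hc := hu.1.1.continuous
  refine ((hu.1.2.1.const_mul K).add (hu.2.const_mul K)).mono'
    (by fun_prop : Continuous fun x => ‖x‖ ^ 2 * ‖u x‖ ^ 2).aestronglyMeasurable
    (Eventually.of_forall fun x => ?_)
  rw [Real.norm_of_nonneg (by positivity)]
  have := mul_le_mul_of_nonneg_right (h x) (sq_nonneg ‖u x‖)
  simp only [Pi.add_apply]
  linarith

lemma InH.integrable_momentum (hV : V110 V) (hu : InH V u) : Integrable (momentum u) :=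
  ((hu.integrable_norm_sq_mul hV).add hu.1.2.2).mono'
    (measurable_momentum hu.1.1.continuous).aestronglyMeasurable
    (Eventually.of_forall fun x => abs_momentum_le u x)

lemma InH.logAdm (hV : V110 V) (hu : InH V u) {A : ℝ} (hGN : GN A) :
    LogAdm fun x => ‖u x‖ ^ 2 := by
  have hc := hu.1.1.continuous
  refine ⟨hu.1.2.1, ?_, ?_⟩
  · simpa only [← pow_mul] using (hGN u hu.1).1
  · refine (hu.1.2.1.add (hu.integrable_norm_sq_mul hV)).mono'
      (by fun_prop : Continuous fun x => ‖x‖ * ‖u x‖ ^ 2).aestronglyMeasurable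
      (Eventually.of_forall fun x => ?_)
    rw [Real.norm_of_nonneg (by positivity)]
    simp only [Pi.add_apply]
    nlinarith [sq_nonneg ‖u x‖, mul_nonneg (sq_nonneg (‖x‖ - 1)) (sq_nonneg ‖u x‖),
      mul_nonneg (sq_nonneg ‖x‖) (sq_nonneg ‖u x‖)]

/-- The density of the quadratic part of the energy. -/
def quadDensity (V : Plane → ℝ) (Ω : ℝ) (u : Plane → ℂ) (x : Plane) : ℝ :=
  gradSq u x + V x * ‖u x‖ ^ 2 - Ω * momentum u x

lemma InH.integrable_quadDensity (hV : V110 V) (hu : InH V u) (Ω : ℝ) :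
    Integrable (quadDensity V Ω u) :=
  (hu.1.2.2.add hu.2).sub ((hu.integrable_momentum hV).const_mul Ω)

lemma InH.Ea_eq (hV : V110 V) (hu : InH V u) (Ω : ℝ) :
    Ea V Ω u = (∫ x, quadDensity V Ω u x) + 1 / 2 * logConv u - 1 / 2 * ∫ x, ‖u x‖ ^ 4 := by
  have : ∫ x, quadDensity V Ω u x
      = (∫ x, (gradSq u x + V x * ‖u x‖ ^ 2)) - Ω * ∫ x, momentum u x := by
    rw [← integral_const_mul]
    exact integral_sub (hu.1.2.2.add hu.2) ((hu.integrable_momentum hV).const_mul Ω)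
  rw [Ea, this]; ring

lemma gradAbsSq_add_le_quadDensity (hu : Differentiable ℝ u) (Ω : ℝ) (x : Plane) :
    gradAbsSq u x + (V x - Ω ^ 2 / 4 * ‖x‖ ^ 2) * ‖u x‖ ^ 2 ≤ quadDensity V Ω u x := by
  have := gradAbsSq_le (hu x) Ω
  rw [quadDensity]; linarith

lemma gradAbsSq_le_quadDensity (hu : Differentiable ℝ u) {Ω : ℝ}
    (hV0 : ∀ x, 0 ≤ V x - Ω ^ 2 / 4 * ‖x‖ ^ 2) (x : Plane) :
    gradAbsSq u x ≤ quadDensity V Ω u x := by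
  have h1 := gradAbsSq_add_le_quadDensity (V := V) hu Ω x
  have h2 := mul_nonneg (hV0 x) (sq_nonneg ‖u x‖)
  linarith

end Basics

lemma exists_abs_le_of_hasCompactSupport {f : Plane → ℝ} (hf : Continuous f)
    (hc : HasCompactSupport f) : ∃ M : ℝ, 0 < M ∧ ∀ x, |f x| ≤ M := by
  obtain ⟨M, hM⟩ := hf.bounded_above_of_compact_support hc
  exact ⟨max M 1, by positivity, fun x => (hM x).trans (le_max_left _ _)⟩

lemma IsTest.exists_norm_fderiv_le {φ : Plane → ℝ} (hφ : IsTest φ) :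
    ∃ M : ℝ, 0 < M ∧ ∀ x, ‖fderiv ℝ φ x‖ ≤ M := by
  obtain ⟨M, hM⟩ := (hφ.1.continuous_fderiv (by norm_num)).bounded_above_of_compact_support
    (hφ.2.fderiv (𝕜 := ℝ))
  exact ⟨max M 1, by positivity, fun x => (hM x).trans (le_max_left _ _)⟩

lemma abs_d_normSq_le {u : Plane → ℂ} {x : Plane} (hu : DifferentiableAt ℝ u x) :
    |d0R (fun y => ‖u y‖ ^ 2) x| ≤ ‖u x‖ ^ 2 + gradSq u x ∧
    |d1R (fun y => ‖u y‖ ^ 2) x| ≤ ‖u x‖ ^ 2 + gradSq u x := by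
  have key : ∀ w : ℂ, |2 * ((starRingEnd ℂ) (u x) * w).re| ≤ ‖u x‖ ^ 2 + ‖w‖ ^ 2 := fun w => by
    rw [abs_mul, abs_two]
    have := Complex.abs_re_le_norm ((starRingEnd ℂ) (u x) * w)
    rw [norm_mul, Complex.norm_conj] at this
    nlinarith [sq_nonneg (‖u x‖ - ‖w‖)]
  constructor
  · rw [d0R, fderiv_normSq hu]
    refine (key _).trans ?_
    rw [gradSq, d0]
    linarith [sq_nonneg ‖d1 u x‖]
  · rw [d1R, fderiv_normSq hu]
    refine (key _).trans ?_
    rw [gradSq, d1]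
    linarith [sq_nonneg ‖d0 u x‖]

lemma measurable_d0R (h : Plane → ℝ) : Measurable (d0R h) := measurable_fderiv_apply_const ℝ h e0
lemma measurable_d1R (h : Plane → ℝ) : Measurable (d1R h) := measurable_fderiv_apply_const ℝ h e1

lemma InH1.integrable_mul_d_normSq {u : Plane → ℂ} (hu : InH1 u) {f : Plane → ℝ}
    (hf : Continuous f) {M : ℝ} (hM : ∀ x, |f x| ≤ M) :
    Integrable (fun x => d0R (fun y => ‖u y‖ ^ 2) x * f x) ∧
    Integrable (fun x => d1R (fun y => ‖u y‖ ^ 2) x * f x) := by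
  have h : Integrable fun x => ‖u x‖ ^ 2 + gradSq u x := hu.2.1.add hu.2.2
  constructor
  · exact (h.mono' (measurable_d0R _).aestronglyMeasurable (Eventually.of_forall fun x =>
      (abs_d_normSq_le (hu.1 x)).1)).mul_bdd hf.aestronglyMeasurable (Eventually.of_forall hM)
  · exact (h.mono' (measurable_d1R _).aestronglyMeasurable (Eventually.of_forall fun x =>
      (abs_d_normSq_le (hu.1 x)).2)).mul_bdd hf.aestronglyMeasurable (Eventually.of_forall hM)

lemma abs_d_le_fderiv (φ : Plane → ℝ) (x : Plane) :
    |d0R φ x| ≤ ‖fderiv ℝ φ x‖ ∧ |d1R φ x| ≤ ‖fderiv ℝ φ x‖ := by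
  have h := opNorm_sq_eq (fderiv ℝ φ x)
  constructor
  · exact abs_le_of_sq_le_sq (by rw [h, d0R]; linarith [sq_nonneg (fderiv ℝ φ x e1)]) (norm_nonneg _)
  · exact abs_le_of_sq_le_sq (by rw [h, d1R]; linarith [sq_nonneg (fderiv ℝ φ x e0)]) (norm_nonneg _)

/-- Gradient of `√p · u`. -/
lemma gradSq_sqrt_mul {p : Plane → ℝ} {u : Plane → ℂ} {x : Plane} (hp : DifferentiableAt ℝ p x)
    (h0 : 0 < p x) (hu : DifferentiableAt ℝ u x) :
    gradSq (fun y => ((Real.sqrt (p y) : ℝ) : ℂ) * u y) x = p x * gradSq u x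
      + 1 / 2 * gradDot p (fun y => ‖u y‖ ^ 2) x
      + ‖fderiv ℝ p x‖ ^ 2 / (4 * p x) * ‖u x‖ ^ 2 := by
  have hd := (hp.hasFDerivAt.sqrt h0.ne')
  have hs := Real.sqrt_pos.2 h0
  rw [gradSq_ofReal_mul hd.differentiableAt hu, gradDot, d0R, d1R, hd.fderiv, Real.sq_sqrt h0.le,
    norm_smul, gradDot, d0R, d1R, mul_pow]
  have e : ‖(1 / (2 * Real.sqrt (p x)) : ℝ)‖ ^ 2 = 1 / (4 * p x) := by
    rw [Real.norm_eq_abs, sq_abs, div_pow, mul_pow, Real.sq_sqrt h0.le]; norm_num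
  rw [e]
  simp only [smul_apply, smul_eq_mul, d0R, d1R]
  field_simp

/-- The first variation of the energy along `√(1 + s φ) · u`. -/
lemma IsMinimizer.first_variation {V : Plane → ℝ} {Ω a A : ℝ} {u : Plane → ℂ} (hV : V110 V)
    (hGN : GN A) (hw : IsMinimizer V Ω a u) (ha : 0 < a) {φ : Plane → ℝ} (hφ : IsTest φ) :
    a * ((∫ x, (φ x * quadDensity V Ω u x + 1 / 2 * gradDot φ (fun y => ‖u y‖ ^ 2) x))
        + (logForm (fun x => ‖u x‖ ^ 2) (fun x => φ x * ‖u x‖ ^ 2) - ∫ x, φ x * ‖u x‖ ^ 4))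
      = (Ea V Ω u + 1 / 2 * logConv u - 1 / 2 * ∫ x, ‖u x‖ ^ 4) * ∫ x, φ x * ‖u x‖ ^ 2 := by
  obtain ⟨⟨hu, hmass⟩, hmin⟩ := hw
  have hφc := hφ.1.continuous
  have hφd := differentiable_of_contDiff_two hφ.1
  obtain ⟨M, hM0, hM⟩ := exists_abs_le_of_hasCompactSupport hφc hφ.2
  obtain ⟨M', hM'0, hM'⟩ := hφ.exists_norm_fderiv_le
  set g : Plane → ℝ := fun x => ‖u x‖ ^ 2 with hg
  have hadm : LogAdm g := hu.logAdm hV hGN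
  have hkadm : LogAdm fun x => φ x * g x := hadm.bdd_mul hφc hM
  have i4 : Integrable fun x => ‖u x‖ ^ 4 := (hGN u hu.1).1
  have iq := hu.integrable_quadDensity hV Ω
  have iφq : Integrable fun x => φ x * quadDensity V Ω u x :=
    iq.bdd_mul hφc.aestronglyMeasurable (Eventually.of_forall hM)
  have igd : Integrable (gradDot φ g) := by
    have h0 := (hu.1.integrable_mul_d_normSq (contDiff_d0R hφ.1).continuous
      (fun x => (abs_d_le_fderiv φ x).1.trans (hM' x))).1
    have h1 := (hu.1.integrable_mul_d_normSq (contDiff_d1R hφ.1).continuous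
      (fun x => (abs_d_le_fderiv φ x).2.trans (hM' x))).2
    refine (h0.add h1).congr (Eventually.of_forall fun x => ?_)
    simp only [Pi.add_apply, gradDot]; ring
  have iφ4 : Integrable fun x => φ x * ‖u x‖ ^ 4 :=
    i4.bdd_mul hφc.aestronglyMeasurable (Eventually.of_forall hM)
  have iφφ4 : Integrable fun x => φ x ^ 2 * ‖u x‖ ^ 4 := by
    refine (iφ4.bdd_mul hφc.aestronglyMeasurable (Eventually.of_forall hM)).congr
      (Eventually.of_forall fun x => ?_)
    ring
  have iC : Integrable fun x => ‖fderiv ℝ φ x‖ ^ 2 * g x :=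
    hadm.int.bdd_mul (c := M' ^ 2)
      ((hφ.1.continuous_fderiv (by norm_num)).norm.pow 2).aestronglyMeasurable
      (Eventually.of_forall fun x => by
        rw [Real.norm_of_nonneg (sq_nonneg _)]
        exact pow_le_pow_left₀ (norm_nonneg _) (hM' x) 2)
  set A0 := ∫ x, quadDensity V Ω u x with hA0
  set A1 := ∫ x, (φ x * quadDensity V Ω u x + 1 / 2 * gradDot φ g x) with hA1
  set C := ∫ x, ‖fderiv ℝ φ x‖ ^ 2 * g x with hC
  set L0 := logForm g g with hL0
  set L1 := logForm g fun x => φ x * g x with hL1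
  set L2 := logForm (fun x => φ x * g x) fun x => φ x * g x with hL2
  set G0 := ∫ x, ‖u x‖ ^ 4 with hG0
  set G1 := ∫ x, φ x * ‖u x‖ ^ 4 with hG1
  set G2 := ∫ x, φ x ^ 2 * ‖u x‖ ^ 4 with hG2
  set m1 := ∫ x, φ x * g x with hm1
  have hE : Ea V Ω u = A0 + 1 / 2 * L0 - 1 / 2 * G0 := hu.Ea_eq hV Ω
  set E := Ea V Ω u with hEdef
  have key : ∀ s : ℝ, |s| * M ≤ 1 / 2 → 0 < a + s * m1 →
      E * (a + s * m1) ^ 2 ≤ a * (a + s * m1) * (A0 + s * A1 + s ^ 2 * C)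
        + a ^ 2 / 2 * ((L0 + 2 * s * L1 + s ^ 2 * L2) - (G0 + 2 * s * G1 + s ^ 2 * G2)) := by
    intro s hs hm
    have hsφ : ∀ x, |s * φ x| ≤ 1 / 2 := fun x => by
      rw [abs_mul]
      exact (mul_le_mul_of_nonneg_left (hM x) (abs_nonneg s)).trans hs
    have hψ : ∀ x, 1 / 2 ≤ 1 + s * φ x := fun x => by
      have := (abs_le.1 (hsφ x)).1; linarith
    have hψ' : ∀ x, 1 + s * φ x ≤ 3 / 2 := fun x => by
      have := (abs_le.1 (hsφ x)).2; linarith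
    set t := a / (a + s * m1) with ht
    have ht0 : 0 < t := by positivity
    set p : Plane → ℝ := fun x => t * (1 + s * φ x) with hp
    have hp0 : ∀ x, 0 < p x := fun x => mul_pos ht0 (by linarith [hψ x])
    have hpd : ∀ x, HasFDerivAt p ((t * s) • fderiv ℝ φ x) x := fun x => by
      have := (((hφd x).hasFDerivAt.const_mul s).const_add 1).const_mul t
      rw [smul_smul] at this
      exact this
    set v : Plane → ℂ := fun y => ((Real.sqrt (p y) : ℝ) : ℂ) * u y with hv
    have hvn : ∀ x, ‖v x‖ ^ 2 = t * (g x + s * (φ x * g x)) := fun x => by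
      simp only [hv]
      rw [norm_mul, Complex.norm_real, Real.norm_of_nonneg (Real.sqrt_nonneg _), mul_pow,
        Real.sq_sqrt (hp0 x).le]
      simp only [hp, hg]; ring
    have hvn4 : ∀ x, ‖v x‖ ^ 4
        = t ^ 2 * (‖u x‖ ^ 4 + (2 * s * (φ x * ‖u x‖ ^ 4) + s ^ 2 * (φ x ^ 2 * ‖u x‖ ^ 4))) :=
      fun x => by
        rw [show ‖v x‖ ^ 4 = (‖v x‖ ^ 2) ^ 2 by ring, hvn]
        simp only [hg]; ring
    have hvd : Differentiable ℝ v := fun x =>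
      (Complex.ofRealCLM.differentiableAt.comp x
        ((hpd x).sqrt (hp0 x).ne').differentiableAt).mul (hu.1.1 x)
    have hgrad : ∀ x, gradSq v x = t * (1 + s * φ x) * gradSq u x + t * s * (1 / 2 * gradDot φ g x)
        + (t * s) ^ 2 / (4 * p x) * (‖fderiv ℝ φ x‖ ^ 2 * g x) := fun x => by
      rw [gradSq_sqrt_mul (hpd x).differentiableAt (hp0 x) (hu.1.1 x), gradDot, gradDot, d0R, d1R,
        (hpd x).fderiv, norm_smul, mul_pow, Real.norm_eq_abs, sq_abs]
      simp only [smul_apply, smul_eq_mul]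
      simp only [hp, d0R, d1R, hg]
      ring
    have hcoef : ∀ x, (t * s) ^ 2 / (4 * p x) ≤ t * s ^ 2 := fun x => by
      have h2 := hψ x
      rw [div_le_iff₀ (by linarith [hp0 x])]
      simp only [hp]
      nlinarith [mul_nonneg (sq_nonneg (t * s)) (by linarith : 0 ≤ 4 * (1 + s * φ x) - 1)]
    have hgradle : ∀ x, gradSq v x ≤ t * (1 + s * φ x) * gradSq u x
        + t * s * (1 / 2 * gradDot φ g x) + t * s ^ 2 * (‖fderiv ℝ φ x‖ ^ 2 * g x) := fun x => by
      rw [hgrad]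
      have := mul_le_mul_of_nonneg_right (hcoef x)
        (mul_nonneg (sq_nonneg ‖fderiv ℝ φ x‖) (sq_nonneg ‖u x‖))
      linarith
    have hpb : ∀ x, ‖t * (1 + s * φ x)‖ ≤ t * (3 / 2) := fun x => by
      rw [Real.norm_of_nonneg (hp0 x).le]
      exact mul_le_mul_of_nonneg_left (hψ' x) ht0.le
    have hpc : Continuous fun x => t * (1 + s * φ x) := by fun_prop
    have hig : Integrable (gradSq v) := by
      have i0 : Integrable fun x => t * (1 + s * φ x) * gradSq u x
          + t * s * (1 / 2 * gradDot φ g x) + t * s ^ 2 * (‖fderiv ℝ φ x‖ ^ 2 * g x) :=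
        ((hu.1.2.2.bdd_mul hpc.aestronglyMeasurable (Eventually.of_forall hpb)).add
          ((igd.const_mul (1 / 2)).const_mul (t * s))).add (iC.const_mul (t * s ^ 2))
      refine i0.mono' (measurable_gradSq v).aestronglyMeasurable (Eventually.of_forall fun x => ?_)
      rw [Real.norm_of_nonneg (gradSq_nonneg v x)]
      exact hgradle x
    have hvm : Integrable fun x => ‖v x‖ ^ 2 := by
      simp only [hvn]
      exact (hadm.int.add (hkadm.int.const_mul s)).const_mul t
    have hvV : Integrable fun x => V x * ‖v x‖ ^ 2 := by
      refine (hu.2.bdd_mul hpc.aestronglyMeasurable (Eventually.of_forall hpb)).congr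
        (Eventually.of_forall fun x => ?_)
      simp only [hvn, hg]; ring
    have hvmass : ∫ x, ‖v x‖ ^ 2 = a := by
      simp only [hvn]
      rw [integral_const_mul, integral_add hadm.int (hkadm.int.const_mul s), integral_const_mul,
        ← hm1, hmass, ht]
      field_simp
    have hvH : InH V v := ⟨⟨hvd, hvm, hig⟩, hvV⟩
    have hle := hmin v ⟨hvH, hvmass⟩
    rw [hvH.Ea_eq hV] at hle
    have hmomv : ∀ x, momentum v x = p x * momentum u x := fun x => by
      rw [← Real.sq_sqrt (hp0 x).le]
      exact momentum_ofReal_mul ((hpd x).sqrt (hp0 x).ne').differentiableAt (hu.1.1 x)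
    have hden : ∫ x, quadDensity V Ω v x ≤ t * (A0 + s * A1 + s ^ 2 * C) := by
      have i1 : Integrable fun x => φ x * quadDensity V Ω u x + 1 / 2 * gradDot φ g x :=
        iφq.add (igd.const_mul _)
      have i2 : Integrable fun x => quadDensity V Ω u x
          + s * (φ x * quadDensity V Ω u x + 1 / 2 * gradDot φ g x) := iq.add (i1.const_mul s)
      rw [hA0, hA1, hC, ← integral_const_mul, ← integral_const_mul, ← integral_add iq (i1.const_mul s),
        ← integral_add i2 (iC.const_mul _), ← integral_const_mul]
      apply integral_mono (hvH.integrable_quadDensity hV Ω) ((i2.add (iC.const_mul _)).const_mul t)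
      intro x
      have h1 := hgradle x
      simp only [quadDensity, hmomv, hvn, Pi.add_apply]
      simp only [hp, hg] at h1 ⊢
      linarith
    have hlog : logConv v = t ^ 2 * (L0 + 2 * s * L1 + s ^ 2 * L2) := by
      rw [logConv_eq, hL0, hL1, hL2, ← hadm.logForm_line hkadm s]
      simp only [hvn]
      have hs := hadm.add (hkadm.const_mul s)
      rw [logForm_const_mul_left, hs.logForm_comm (hs.const_mul t), logForm_const_mul_left]
      ring
    have hquart : ∫ x, ‖v x‖ ^ 4 = t ^ 2 * (G0 + 2 * s * G1 + s ^ 2 * G2) := by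
      simp only [hvn4]
      have i5 : Integrable fun x => 2 * s * (φ x * ‖u x‖ ^ 4) + s ^ 2 * (φ x ^ 2 * ‖u x‖ ^ 4) :=
        (iφ4.const_mul _).add (iφφ4.const_mul _)
      rw [integral_const_mul, integral_add i4 i5, integral_add (iφ4.const_mul _) (iφφ4.const_mul _),
        integral_const_mul, integral_const_mul]
      ring
    rw [hlog, hquart] at hle
    have htm : t * (a + s * m1) = a := by rw [ht]; field_simp
    have h5 : E ≤ t * (A0 + s * A1 + s ^ 2 * C) + t ^ 2 / 2 *
        ((L0 + 2 * s * L1 + s ^ 2 * L2) - (G0 + 2 * s * G1 + s ^ 2 * G2)) := by linarith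
    have h6 := mul_le_mul_of_nonneg_right h5 (sq_nonneg (a + s * m1))
    refine h6.trans (le_of_eq ?_)
    set W := (L0 + 2 * s * L1 + s ^ 2 * L2) - (G0 + 2 * s * G1 + s ^ 2 * G2)
    set Z := A0 + s * A1 + s ^ 2 * C
    calc (t * Z + t ^ 2 / 2 * W) * (a + s * m1) ^ 2
        = (t * (a + s * m1)) * (a + s * m1) * Z + (t * (a + s * m1)) ^ 2 / 2 * W := by ring
      _ = _ := by rw [htm]
  set H : ℝ → ℝ := fun s => a * (a + s * m1) * (A0 + s * A1 + s ^ 2 * C)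
        + a ^ 2 / 2 * ((L0 + 2 * s * L1 + s ^ 2 * L2) - (G0 + 2 * s * G1 + s ^ 2 * G2))
        - E * (a + s * m1) ^ 2 with hH
  have hH0 : H 0 = 0 := by simp only [hH, hE]; ring
  have hmin0 : IsLocalMin H 0 := by
    have e1 : ∀ᶠ s : ℝ in 𝓝 0, |s| * M < 1 / 2 := by
      have : Continuous fun s : ℝ => |s| * M := by fun_prop
      exact this.tendsto' 0 0 (by simp) |>.eventually_lt_const (by norm_num)
    have e2 : ∀ᶠ s : ℝ in 𝓝 0, 0 < a + s * m1 := by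
      have : Continuous fun s : ℝ => a + s * m1 := by fun_prop
      exact this.tendsto' 0 a (by simp) |>.eventually_const_lt ha
    filter_upwards [e1, e2] with s h1 h2
    rw [hH0]
    have := key s h1.le h2
    simp only [hH]; linarith
  have hderiv : HasDerivAt H (a * (m1 * A0 + a * A1) + a ^ 2 * (L1 - G1) - E * (2 * a * m1)) 0 := by
    have hid := hasDerivAt_id (0 : ℝ)
    have hm : HasDerivAt (fun s : ℝ => a + s * m1) (1 * m1) 0 := (hid.mul_const m1).const_add a
    have q : ∀ b c d : ℝ, HasDerivAt (fun s : ℝ => b + s * c + s ^ 2 * d) c 0 := fun b c d => by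
      have := ((hid.mul_const c).const_add b).fun_add ((hid.fun_pow 2).mul_const d)
      simpa using this
    have hq := ((hm.const_mul a).mul (q A0 A1 C)).add
      ((((q L0 (2 * L1) L2).sub (q G0 (2 * G1) G2))).const_mul (a ^ 2 / 2)) |>.sub
      ((hm.pow 2).const_mul E)
    convert! hq using 1
    · ext s; simp only [hH, Pi.add_apply, Pi.sub_apply, Pi.mul_apply, Pi.pow_apply]; ring
    · simp; ring
  have hz := hmin0.hasDerivAt_eq_zero hderiv
  have : a * (a * (A1 + (L1 - G1)) - (E + 1 / 2 * L0 - 1 / 2 * G0) * m1) = 0 := by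
    rw [← hz, hE]; ring
  have := (mul_eq_zero.1 this).resolve_left ha.ne'
  have hlc : logConv u = L0 := logConv_eq u
  rw [hlc]
  linarith

/-- The density of a minimizer is a weak subsolution. -/
lemma IsMinimizer.subSol {V : Plane → ℝ} {Ω a A : ℝ} {u : Plane → ℂ} (hV : V110 V)
    (hV0 : ∀ x, 0 ≤ V x - Ω ^ 2 / 4 * ‖x‖ ^ 2)
    (hGN : GN A) (hw : IsMinimizer V Ω a u) (ha : 0 < a) {B : ℝ}
    (hB : ∀ x, -B ≤ ∫ y, Real.log ‖x - y‖ * ‖u y‖ ^ 2) :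
    SubSol (fun x => ‖u x‖ ^ 2)
      (-(Ea V Ω u + 1 / 2 * logConv u - 1 / 2 * ∫ x, ‖u x‖ ^ 4) / a - B) := by
  intro φ hφ hφ0
  have hfv := hw.first_variation hV hGN ha hφ
  set μ := Ea V Ω u + 1 / 2 * logConv u - 1 / 2 * ∫ x, ‖u x‖ ^ 4
  have hu := hw.1.1
  have hφc := hφ.1.continuous
  obtain ⟨M, hM0, hM⟩ := exists_abs_le_of_hasCompactSupport hφc hφ.2
  obtain ⟨M', hM'0, hM'⟩ := hφ.exists_norm_fderiv_le
  set g : Plane → ℝ := fun x => ‖u x‖ ^ 2 with hg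
  have hadm : LogAdm g := hu.logAdm hV hGN
  have hkadm : LogAdm fun x => φ x * g x := hadm.bdd_mul hφc hM
  have hgd : Differentiable ℝ g := fun x => (hu.1.1 x).norm_sq ℂ
  have h0 := (hu.1.integrable_mul_d_normSq (contDiff_d0R hφ.1).continuous
      (fun x => (abs_d_le_fderiv φ x).1.trans (hM' x))).1
  have h1 := (hu.1.integrable_mul_d_normSq (contDiff_d1R hφ.1).continuous
      (fun x => (abs_d_le_fderiv φ x).2.trans (hM' x))).2
  have igd : Integrable (gradDot φ g) := by
    refine (h0.add h1).congr (Eventually.of_forall fun x => ?_)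
    simp only [Pi.add_apply, gradDot]; ring
  have iφ4 : Integrable fun x => φ x * ‖u x‖ ^ 4 :=
    (hGN u hu.1).1.bdd_mul hφc.aestronglyMeasurable (Eventually.of_forall hM)
  have iφq : Integrable fun x => φ x * quadDensity V Ω u x :=
    (hu.integrable_quadDensity hV Ω).bdd_mul hφc.aestronglyMeasurable (Eventually.of_forall hM)
  have hparts := integral_mul_lapR hgd hφ h0 h1
  have hcomm : ∫ x, gradDot g φ x = ∫ x, gradDot φ g x := by
    congr 1; ext x; simp only [gradDot]; ring
  have hq0 : 0 ≤ ∫ x, φ x * quadDensity V Ω u x := integral_nonneg fun x =>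
    mul_nonneg (hφ0 x) ((gradAbsSq_nonneg u x).trans (gradAbsSq_le_quadDensity hu.1.1 hV0 x))
  have hL := logForm_lower hkadm hadm (fun x => mul_nonneg (hφ0 x) (sq_nonneg _)) hB
  rw [hkadm.logForm_comm hadm] at hL
  have hsplit : ∫ x, (φ x * quadDensity V Ω u x + 1 / 2 * gradDot φ g x)
      = (∫ x, φ x * quadDensity V Ω u x) + 1 / 2 * ∫ x, gradDot φ g x := by
    rw [integral_add iφq (igd.const_mul _), integral_const_mul]
  have hlhs : ∫ x, (-μ / a - B - g x) * g x * φ x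
      = (-μ / a - B) * (∫ x, φ x * g x) - ∫ x, φ x * ‖u x‖ ^ 4 := by
    rw [← integral_const_mul, ← integral_sub (hkadm.int.const_mul _) iφ4]
    congr 1; ext x; simp only [hg]; ring
  rw [hlhs, hparts, hcomm]
  rw [hsplit] at hfv
  have hdiv : (∫ x, φ x * quadDensity V Ω u x) + 1 / 2 * (∫ x, gradDot φ g x)
      + (logForm g (fun x => φ x * g x) - ∫ x, φ x * ‖u x‖ ^ 4)
      = μ / a * ∫ x, φ x * g x := by
    rw [div_mul_eq_mul_div (a := μ), eq_div_iff ha.ne']; linarith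
  have : (-μ / a - B) * (∫ x, φ x * g x)
      = -(μ / a * ∫ x, φ x * g x) - B * ∫ x, φ x * g x := by ring
  linarith

lemma SubSol.exp_decay {g : Plane → ℝ} {l : ℝ} (h : SubSol g l) (hl : 0 ≤ l) (hg : Continuous g)
    (hg0 : ∀ x, 0 ≤ g x) (hi : Integrable g) {G κ β r ρ η : ℝ} {c : Plane}
    (hG : ∀ y, g y ≤ G) (hκ : 0 ≤ κ) (hβ : 0 < β) (hr : 0 < r) (hη : η < 1 / 1536)
    (htail : ∀ y, ρ ≤ ‖y - c‖ → ∫ z in ball y r, g z ≤ η)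
    (hlκ : κ ^ 2 + β ≤ 2 * (l - 48 / r ^ 2 * η)) (hlκ' : κ ^ 2 ≤ 2 * l)
    {x : Plane} (hx : x ≠ c) (hxρ : ρ ≤ ‖x - c‖) :
    g x ≤ 48 / r ^ 2 * (Real.cosh (κ * r) *
      ((2 * G + β) * (2 * Real.exp (-(κ * (‖x - c‖ - ρ))) * ∫ y, g y)) / β) := by
  have hθ : ∀ y, ρ ≤ ‖y - c‖ → g y ≤ 48 / r ^ 2 * η := fun y hy =>
    (h.eps_regularity hl hg hg0 hr ((htail y hy).trans_lt hη)).trans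
      (mul_le_mul_of_nonneg_left (htail y hy) (by positivity))
  refine (h.eps_regularity hl hg hg0 hr ((htail x hxρ).trans_lt hη)).trans
    (mul_le_mul_of_nonneg_left ?_ (by positivity))
  rw [le_div_iff₀ hβ, mul_comm]
  exact h.mass_decay hg hg0 hi hG hκ hβ hr.le hθ hlκ hlκ' hx

lemma fderiv_cutoff_eq_zero_of_lt {c x : Plane} {ρ : ℝ} (hρ : 0 < ρ) (h : ‖x - c‖ < ρ) :
    fderiv ℝ (cutoff c ρ) x = 0 := by
  have : cutoff c ρ =ᶠ[𝓝 x] fun _ => 1 := by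
    have hc : Continuous fun y : Plane => ‖y - c‖ := by fun_prop
    filter_upwards [hc.continuousAt.eventually_lt_const h] with y hy using cutoff_eq_one hρ hy.le
  rw [this.fderiv_eq]; simp

lemma fderiv_cutoff_eq_zero_of_gt {c x : Plane} {ρ : ℝ} (hρ : 0 < ρ) (h : 2 * ρ < ‖x - c‖) :
    fderiv ℝ (cutoff c ρ) x = 0 := by
  have : cutoff c ρ =ᶠ[𝓝 x] fun _ => 0 := by
    have hc : Continuous fun y : Plane => ‖y - c‖ := by fun_prop
    filter_upwards [hc.continuousAt.eventually_const_lt h] with y hy using cutoff_eq_zero hρ hy.le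
  rw [this.fderiv_eq]; simp

lemma IsTest.integrable_gradDot_parts {h φ : Plane → ℝ} (hh : ContDiff ℝ 2 h) (hφ : IsTest φ) :
    Integrable (fun x => d0R h x * d0R φ x) ∧ Integrable (fun x => d1R h x * d1R φ x) :=
  ⟨((contDiff_d0R hh).continuous.mul (contDiff_d0R hφ.1).continuous).integrable_of_hasCompactSupport
      (hasCompactSupport_d0R hφ.2).mul_left,
    ((contDiff_d1R hh).continuous.mul (contDiff_d1R hφ.1).continuous).integrable_of_hasCompactSupport
      (hasCompactSupport_d1R hφ.2).mul_left⟩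

/-- Green's identity against a test function. -/
lemma integral_mul_lapR_symm {h φ : Plane → ℝ} (hh : ContDiff ℝ 2 h) (hφ : IsTest φ) :
    ∫ x, h x * lapR φ x = ∫ x, φ x * lapR h x := by
  obtain ⟨R, hR⟩ := hφ.2.isCompact.isBounded.subset_closedBall (0 : Plane)
  set ρ := max R 0 + 1 with hρdef
  have hρ : 0 < ρ := by positivity
  have hχ := isTest_cutoff (0 : Plane) hρ
  set f : Plane → ℝ := fun x => cutoff 0 ρ x * h x with hf
  have hft : IsTest f := ⟨hχ.1.mul hh, hχ.2.mul_right⟩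
  have hball : ∀ x ∈ tsupport φ, ‖x - 0‖ < ρ := fun x hx => by
    have := hR hx
    rw [mem_closedBall_zero_iff] at this
    have h1 := le_max_left R 0
    rw [sub_zero, hρdef]
    linarith
  have heq : ∀ x ∈ tsupport φ, f =ᶠ[𝓝 x] h := fun x hx => by
    have hc : Continuous fun y : Plane => ‖y - 0‖ := by fun_prop
    filter_upwards [hc.continuousAt.eventually_lt_const (hball x hx)] with y hy
    simp only [hf]
    rw [cutoff_eq_one hρ hy.le, one_mul]
  have hlap : ∀ x ∈ tsupport φ, lapR f x = lapR h x := fun x hx => by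
    have e0 : d0R f =ᶠ[𝓝 x] d0R h := (heq x hx).fderiv.mono fun y hy => by rw [d0R, d0R, hy]
    have e1 : d1R f =ᶠ[𝓝 x] d1R h := (heq x hx).fderiv.mono fun y hy => by rw [d1R, d1R, hy]
    rw [lapR, lapR, e0.fderiv_eq, e1.fderiv_eq]
  have a1 : ∫ x, φ x * lapR f x = ∫ x, φ x * lapR h x := by
    congr 1; ext x
    by_cases hx : x ∈ tsupport φ
    · rw [hlap x hx]
    · rw [image_eq_zero_of_notMem_tsupport hx, zero_mul, zero_mul]
  have p1 := IsTest.integrable_gradDot_parts hφ.1 hft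
  have p2 := IsTest.integrable_gradDot_parts hh hφ
  rw [← a1, integral_mul_lapR (differentiable_of_contDiff_two hφ.1) hft p1.1 p1.2,
    integral_mul_lapR (differentiable_of_contDiff_two hh) hφ p2.1 p2.2]
  congr 2; ext x
  by_cases hx : x ∈ tsupport φ
  · have := (heq x hx).fderiv_eq (𝕜 := ℝ)
    rw [gradDot, gradDot]; simp only [d0R, d1R, this]; ring
  · have := image_eq_zero_of_notMem_tsupport fun h => hx (tsupport_fderiv_subset ℝ h)
    rw [gradDot, gradDot]; simp [d0R, d1R, this]

lemma d0R_d1R_comm {h : Plane → ℝ} (hh : ContDiff ℝ 2 h) (x : Plane) :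
    fderiv ℝ (d1R h) x e0 = fderiv ℝ (d0R h) x e1 := by
  have hd : DifferentiableAt ℝ (fderiv ℝ h) x :=
    (hh.fderiv_right (m := 1) (by norm_num)).differentiable (by norm_num) x
  have hs : IsSymmSndFDerivAt ℝ h x :=
    hh.contDiffAt.isSymmSndFDerivAt (by simp)
  have k : ∀ v w : Plane, fderiv ℝ (fun y => fderiv ℝ h y v) x w = fderiv ℝ (fderiv ℝ h) x w v := by
    intro v w
    rw [fderiv_clm_apply hd (differentiableAt_const _)]; simp
  change fderiv ℝ (fun y => fderiv ℝ h y e1) x e0 = fderiv ℝ (fun y => fderiv ℝ h y e0) x e1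
  rw [k, k]; exact hs _ _

section GroundState

variable {Q : Plane → ℝ}

lemma IsGroundState.lapR_eq (hQ : IsGroundState Q) (x : Plane) : lapR Q x = Q x - Q x ^ 3 := by
  have := hQ.2.2.2.2.2 x; linarith

lemma IsGroundState.lapR_sq (hQ : IsGroundState Q) (x : Plane) :
    lapR (fun y => Q y ^ 2) x = 2 * (Q x ^ 2 - Q x ^ 4 + ‖fderiv ℝ Q x‖ ^ 2) := by
  have h := lapR_mul hQ.1 hQ.1 x
  rw [hQ.lapR_eq] at h
  simp only [← sq] at h
  rw [h, opNorm_sq_eq, gradDot, d0R, d1R]; ring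

lemma IsGroundState.subSol (hQ : IsGroundState Q) : SubSol (fun x => Q x ^ 2) 1 := by
  intro φ hφ hφ0
  have hQc := hQ.1.continuous
  have hφc := hφ.1.continuous
  have hf := hQ.1.continuous_fderiv (by norm_num)
  rw [integral_mul_lapR_symm (hQ.1.pow 2) hφ, ← integral_const_mul]
  simp only [hQ.lapR_sq]
  apply integral_mono
  · exact (by fun_prop : Continuous fun x => 2 * ((1 - Q x ^ 2) * Q x ^ 2 * φ x)).integrable_of_hasCompactSupport
      (HasCompactSupport.mul_left (f := fun _ => (2 : ℝ)) hφ.2.mul_left)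
  · exact (by fun_prop : Continuous fun x => φ x * (2 * (Q x ^ 2 - Q x ^ 4
      + ‖fderiv ℝ Q x‖ ^ 2))).integrable_of_hasCompactSupport hφ.2.mul_right
  · intro x
    have := mul_nonneg (hφ0 x) (sq_nonneg ‖fderiv ℝ Q x‖)
    simp only
    nlinarith

lemma IsGroundState.inH1 (hQ : IsGroundState Q) : InH1 fun x => (Q x : ℂ) := by
  have hd := differentiable_of_contDiff_two hQ.1
  refine ⟨fun x => Complex.ofRealCLM.differentiableAt.comp x (hd x), ?_, ?_⟩
  · simpa only [Complex.norm_real, Real.norm_eq_abs, sq_abs] using hQ.2.2.2.1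
  · exact hQ.2.2.2.2.1.congr (Eventually.of_forall fun x => (gradSq_ofReal (hd x)).symm)

lemma IsGroundState.integrable_pow_four (hQ : IsGroundState Q) {A : ℝ} (hGN : GN A) :
    Integrable fun x => Q x ^ 4 := by
  have := (hGN _ hQ.inH1).1
  simpa only [Complex.norm_real, Real.norm_eq_abs, (by decide : Even 4).pow_abs] using this

lemma integral_eq_zero_of_cutoff {f : Plane → ℝ} (hf : Integrable f) {F : ℕ → Plane → ℝ}
    (h : ∀ n : ℕ, ∫ x, cutoff 0 (n + 1) x * f x = ∫ x, F n x) {S : Plane → ℝ} (hS : Integrable S)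
    (hm : ∀ n, Continuous (F n)) (hb : ∀ n x, |F n x| ≤ S x)
    (hl : ∀ x, Tendsto (fun n => F n x) atTop (𝓝 0)) : ∫ x, f x = 0 := by
  have t1 : Tendsto (fun n : ℕ => ∫ x, cutoff 0 (n + 1) x * f x) atTop (𝓝 (∫ x, f x)) := by
    refine tendsto_integral_of_dominated_convergence (fun x => |f x|) (fun n => ?_) hf.abs
      (fun n => Eventually.of_forall fun x => ?_) (Eventually.of_forall fun x => ?_)
    · exact (isTest_cutoff 0 (by positivity)).1.continuous.aestronglyMeasurable.mul
        hf.aestronglyMeasurable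
    · rw [Real.norm_eq_abs, abs_mul, abs_of_nonneg (cutoff_nonneg _ _ _)]
      exact mul_le_of_le_one_left (abs_nonneg _) (cutoff_le_one _ _ _)
    · simpa using (tendsto_cutoff 0 x).mul_const (f x)
  have t2 : Tendsto (fun n : ℕ => ∫ x, F n x) atTop (𝓝 (∫ _ : Plane, (0 : ℝ))) :=
    tendsto_integral_of_dominated_convergence S (fun n => (hm n).aestronglyMeasurable) hS
      (fun n => Eventually.of_forall (hb n)) (Eventually.of_forall hl)
  simp only [h] at t1
  rw [integral_zero] at t2
  exact tendsto_nhds_unique t1 t2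

lemma IsGroundState.energy_identity (hQ : IsGroundState Q) (h4 : Integrable fun x => Q x ^ 4) :
    (∫ x, ‖fderiv ℝ Q x‖ ^ 2) + (∫ x, Q x ^ 2) = ∫ x, Q x ^ 4 := by
  obtain ⟨hc, -, -, h2, hd, -⟩ := id hQ
  have hQc := hc.continuous
  have i1 : Integrable fun x => Q x ^ 2 - Q x ^ 4 := h2.sub h4
  have i2 : Integrable fun x => Q x ^ 2 - Q x ^ 4 + ‖fderiv ℝ Q x‖ ^ 2 := i1.add hd
  have hK := cutConst_pos
  have h0 : ∫ x, 2 * (Q x ^ 2 - Q x ^ 4 + ‖fderiv ℝ Q x‖ ^ 2) = 0 := by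
    refine integral_eq_zero_of_cutoff (i2.const_mul 2)
      (F := fun n x => Q x ^ 2 * lapR (cutoff 0 (n + 1)) x)
      (S := fun x => 20 * cutConst * Q x ^ 2) (fun n => ?_) (h2.const_mul _) (fun n => ?_)
      (fun n x => ?_) (fun x => ?_)
    · rw [integral_mul_lapR_symm (hc.pow 2) (isTest_cutoff 0 (by positivity))]
      simp only [hQ.lapR_sq]
    · exact (hQc.pow 2).mul (continuous_lapR (isTest_cutoff 0 (by positivity)).1)
    · rw [abs_mul, abs_of_nonneg (sq_nonneg _), mul_comm]
      refine mul_le_mul_of_nonneg_right ?_ (sq_nonneg _)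
      refine (abs_lapR_cutoff_le 0 (by positivity) x).trans (div_le_self (by positivity) ?_)
      have : (0 : ℝ) ≤ n := by positivity
      nlinarith
    · have hlim : Tendsto (fun n : ℕ => Q x ^ 2 * (20 * cutConst * (1 / ((n : ℝ) + 1)) ^ 2)) atTop
          (𝓝 (Q x ^ 2 * (20 * cutConst * 0 ^ 2))) :=
        ((tendsto_one_div_add_atTop_nhds_zero_nat.pow 2).const_mul _).const_mul _
      simp only [ne_eq, OfNat.ofNat_ne_zero, not_false_eq_true, zero_pow, mul_zero] at hlim
      refine squeeze_zero_norm (fun n => ?_) hlim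
      rw [Real.norm_eq_abs, abs_mul, abs_of_nonneg (sq_nonneg _)]
      refine mul_le_mul_of_nonneg_left ?_ (sq_nonneg _)
      refine (abs_lapR_cutoff_le 0 (by positivity) x).trans (le_of_eq ?_)
      field_simp
  rw [integral_const_mul, integral_add i1 hd, integral_sub h2 h4] at h0
  linarith

lemma IsGroundState.pohozaev (hQ : IsGroundState Q) (h4 : Integrable fun x => Q x ^ 4) :
    ∫ x, Q x ^ 2 = 1 / 2 * ∫ x, Q x ^ 4 := by
  obtain ⟨hc, -, -, h2, hd, -⟩ := id hQ
  have hQc := hc.continuous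
  have hQd := differentiable_of_contDiff_two hc
  set p := d0R Q with hp
  set q := d1R Q with hq
  have hpc : ContDiff ℝ 1 p := contDiff_d0R hc
  have hqc : ContDiff ℝ 1 q := contDiff_d1R hc
  have hc1 : ContDiff ℝ 1 Q := hc.of_le (by norm_num)
  have hpd := hpc.differentiable (by norm_num)
  have hqd := hqc.differentiable (by norm_num)
  have hX : ∀ i : Fin 2, ContDiff ℝ 1 fun x : Plane => x i := fun i =>
    (EuclideanSpace.proj i : Plane →L[ℝ] ℝ).contDiff
  set F0 : Plane → ℝ := fun x => x 0 * ((p x ^ 2 - q x ^ 2) / 2 + (Q x ^ 4 / 4 - Q x ^ 2 / 2))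
    + x 1 * (p x * q x) with hF0
  set F1 : Plane → ℝ := fun x => x 1 * ((q x ^ 2 - p x ^ 2) / 2 + (Q x ^ 4 / 4 - Q x ^ 2 / 2))
    + x 0 * (p x * q x) with hF1
  have cF0 : ContDiff ℝ 1 F0 := by fun_prop
  have cF1 : ContDiff ℝ 1 F1 := by fun_prop
  have hdiv : ∀ x, fderiv ℝ F0 x e0 + fderiv ℝ F1 x e1 = Q x ^ 4 / 2 - Q x ^ 2 := by
    intro x
    have A0 := hasFDerivAt_coord 0 x
    have A1 := hasFDerivAt_coord 1 x
    have P := (hpd x).hasFDerivAt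
    have R := (hqd x).hasFDerivAt
    have T := (hQd x).hasFDerivAt
    have W := ((T.pow 4).mul_const (1 / 4)).fun_sub ((T.pow 2).mul_const (1 / 2))
    have D0 := (A0.fun_mul ((((P.pow 2).fun_sub (R.pow 2)).mul_const (1 / 2)).fun_add W)).fun_add
      (A1.fun_mul (P.fun_mul R))
    have D1 := (A1.fun_mul ((((R.pow 2).fun_sub (P.pow 2)).mul_const (1 / 2)).fun_add W)).fun_add
      (A0.fun_mul (P.fun_mul R))
    have E0 : F0 = fun x => x 0 * ((p x ^ 2 - q x ^ 2) * (1 / 2) + (Q x ^ 4 * (1 / 4) - Q x ^ 2 * (1 / 2)))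
      + x 1 * (p x * q x) := by ext x; simp only [hF0]; ring
    have E1 : F1 = fun x => x 1 * ((q x ^ 2 - p x ^ 2) * (1 / 2) + (Q x ^ 4 * (1 / 4) - Q x ^ 2 * (1 / 2)))
      + x 0 * (p x * q x) := by ext x; simp only [hF1]; ring
    have hsym := d0R_d1R_comm hc x
    have hlap := hQ.lapR_eq x
    rw [lapR] at hlap
    rw [← hp, ← hq] at hsym hlap
    have hpx : fderiv ℝ Q x e0 = p x := rfl
    have hqx : fderiv ℝ Q x e1 = q x := rfl
    have c00 : (EuclideanSpace.proj 0 : Plane →L[ℝ] ℝ) e0 = 1 := by simp [e0]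
    have c01 : (EuclideanSpace.proj 0 : Plane →L[ℝ] ℝ) e1 = 0 := by simp [e1]
    have c10 : (EuclideanSpace.proj 1 : Plane →L[ℝ] ℝ) e0 = 0 := by simp [e0]
    have c11 : (EuclideanSpace.proj 1 : Plane →L[ℝ] ℝ) e1 = 1 := by simp [e1]
    rw [E0, E1, D0.fderiv, D1.fderiv]
    simp only [add_apply, sub_apply, smul_apply, smul_eq_mul, c00, c01, c10, c11, hpx, hqx, hsym,
      nsmul_eq_mul]
    have hlap' : fderiv ℝ q x e1 = Q x - Q x ^ 3 - fderiv ℝ p x e0 := by linarith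
    rw [hlap']
    push_cast
    ring
  have hK := cutConst_pos
  set S : Plane → ℝ := fun x => 32 * cutConst * (‖fderiv ℝ Q x‖ ^ 2 + (Q x ^ 2 + Q x ^ 4)) with hS
  have hSi : Integrable S := (hd.add (h2.add h4)).const_mul _
  have hFb : ∀ x, |F0 x| ≤ ‖x‖ * (2 * (‖fderiv ℝ Q x‖ ^ 2 + (Q x ^ 2 + Q x ^ 4))) ∧
      |F1 x| ≤ ‖x‖ * (2 * (‖fderiv ℝ Q x‖ ^ 2 + (Q x ^ 2 + Q x ^ 4))) := by
    intro x
    have hn : ‖fderiv ℝ Q x‖ ^ 2 = p x ^ 2 + q x ^ 2 := opNorm_sq_eq _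
    have hx0 : |x 0| ≤ ‖x‖ := abs_le_of_sq_le_sq
      (by rw [norm_sq_plane]; linarith [sq_nonneg (x 1)]) (norm_nonneg _)
    have hx1 : |x 1| ≤ ‖x‖ := abs_le_of_sq_le_sq
      (by rw [norm_sq_plane]; linarith [sq_nonneg (x 0)]) (norm_nonneg _)
    have b1 : |(p x ^ 2 - q x ^ 2) / 2 + (Q x ^ 4 / 4 - Q x ^ 2 / 2)| ≤
        (p x ^ 2 + q x ^ 2) + (Q x ^ 2 + Q x ^ 4) := by
      rw [abs_le]
      constructor <;> nlinarith [sq_nonneg (p x), sq_nonneg (q x), sq_nonneg (Q x), sq_nonneg (Q x ^ 2)]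
    have b2 : |(q x ^ 2 - p x ^ 2) / 2 + (Q x ^ 4 / 4 - Q x ^ 2 / 2)| ≤
        (p x ^ 2 + q x ^ 2) + (Q x ^ 2 + Q x ^ 4) := by
      rw [abs_le]
      constructor <;> nlinarith [sq_nonneg (p x), sq_nonneg (q x), sq_nonneg (Q x), sq_nonneg (Q x ^ 2)]
    have b3 : |p x * q x| ≤ (p x ^ 2 + q x ^ 2) + (Q x ^ 2 + Q x ^ 4) := by
      rw [abs_le]
      constructor <;> nlinarith [sq_nonneg (p x + q x), sq_nonneg (p x - q x), sq_nonneg (Q x),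
        sq_nonneg (Q x ^ 2)]
    rw [hn]
    constructor
    · refine (abs_add_le _ _).trans ?_
      rw [abs_mul, abs_mul]
      have := mul_le_mul hx0 b1 (abs_nonneg _) (norm_nonneg _)
      have := mul_le_mul hx1 b3 (abs_nonneg _) (norm_nonneg _)
      linarith
    · refine (abs_add_le _ _).trans ?_
      rw [abs_mul, abs_mul]
      have := mul_le_mul hx1 b2 (abs_nonneg _) (norm_nonneg _)
      have := mul_le_mul hx0 b3 (abs_nonneg _) (norm_nonneg _)
      linarith
  have i1 : Integrable fun x => Q x ^ 4 / 2 - Q x ^ 2 := (h4.div_const 2).sub h2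
  have h0 : ∫ x, (Q x ^ 4 / 2 - Q x ^ 2) = 0 := by
    refine integral_eq_zero_of_cutoff i1
      (F := fun n x => -(F0 x * d0R (cutoff 0 (n + 1)) x + F1 x * d1R (cutoff 0 (n + 1)) x))
      (S := S) (fun n => ?_) hSi (fun n => ?_) (fun n x => ?_) (fun x => ?_)
    · have hχ := isTest_cutoff (0 : Plane) (by positivity : (0 : ℝ) < n + 1)
      have cχ := hχ.1.continuous
      have j0 : Integrable fun x => F0 x * d0R (cutoff 0 (n + 1)) x :=
        (cF0.continuous.mul (contDiff_d0R hχ.1).continuous).integrable_of_hasCompactSupport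
          (hasCompactSupport_d0R hχ.2).mul_left
      have j1 : Integrable fun x => F1 x * d1R (cutoff 0 (n + 1)) x :=
        (cF1.continuous.mul (contDiff_d1R hχ.1).continuous).integrable_of_hasCompactSupport
          (hasCompactSupport_d1R hχ.2).mul_left
      have k0 : Integrable fun x => fderiv ℝ F0 x e0 * cutoff 0 (n + 1) x :=
        (((cF0.continuous_fderiv (by norm_num)).clm_apply continuous_const).mul
          cχ).integrable_of_hasCompactSupport hχ.2.mul_left
      have k1 : Integrable fun x => fderiv ℝ F1 x e1 * cutoff 0 (n + 1) x :=
        (((cF1.continuous_fderiv (by norm_num)).clm_apply continuous_const).mul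
          cχ).integrable_of_hasCompactSupport hχ.2.mul_left
      have p0 := integral_mul_fderiv_eq_neg_fderiv_mul_of_integrable (μ := volume)
        (f := F0) (g := cutoff 0 (n + 1)) (v := e0) k0 j0
        ((cF0.continuous.mul cχ).integrable_of_hasCompactSupport hχ.2.mul_left)
        (fun x _ => cF0.differentiable (by norm_num) x)
        (fun x _ => hχ.1.differentiable (by norm_num) x)
      have p1 := integral_mul_fderiv_eq_neg_fderiv_mul_of_integrable (μ := volume)
        (f := F1) (g := cutoff 0 (n + 1)) (v := e1) k1 j1
        ((cF1.continuous.mul cχ).integrable_of_hasCompactSupport hχ.2.mul_left)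
        (fun x _ => cF1.differentiable (by norm_num) x)
        (fun x _ => hχ.1.differentiable (by norm_num) x)
      have q0 : ∫ x, F0 x * d0R (cutoff 0 (n + 1)) x = -∫ x, fderiv ℝ F0 x e0 * cutoff 0 (n + 1) x := p0
      have q1 : ∫ x, F1 x * d1R (cutoff 0 (n + 1)) x = -∫ x, fderiv ℝ F1 x e1 * cutoff 0 (n + 1) x := p1
      rw [integral_neg, integral_add j0 j1, q0, q1, neg_add, neg_neg, neg_neg, ← integral_add k0 k1]
      congr 1; ext x
      rw [← hdiv]; ring
    · have hχ := isTest_cutoff (0 : Plane) (by positivity : (0 : ℝ) < n + 1)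
      exact ((cF0.continuous.mul (contDiff_d0R hχ.1).continuous).add
        (cF1.continuous.mul (contDiff_d1R hχ.1).continuous)).neg
    · have hn : (0 : ℝ) < n + 1 := by positivity
      by_cases hx : 2 * ((n : ℝ) + 1) < ‖x - 0‖
      · have := fderiv_cutoff_eq_zero_of_gt hn hx
        simp only [d0R, d1R, this]
        simp only [zero_apply, mul_zero, add_zero, neg_zero, abs_zero, hS]
        positivity
      · rw [sub_zero, not_lt] at hx
        have hb := norm_fderiv_cutoff_le (0 : Plane) hn x
        have hd0 := (abs_d_le_fderiv (cutoff 0 ((n : ℝ) + 1)) x).1.trans hb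
        have hd1 := (abs_d_le_fderiv (cutoff 0 ((n : ℝ) + 1)) x).2.trans hb
        rw [abs_neg]
        refine (abs_add_le _ _).trans ?_
        rw [abs_mul, abs_mul]
        set Y := ‖fderiv ℝ Q x‖ ^ 2 + (Q x ^ 2 + Q x ^ 4) with hY
        have hY0 : 0 ≤ Y := by positivity
        have m0 := mul_le_mul (hFb x).1 hd0 (abs_nonneg _) (by positivity)
        have m1 := mul_le_mul (hFb x).2 hd1 (abs_nonneg _) (by positivity)
        have m2 : ‖x‖ * (2 * Y) * (4 * cutConst / (n + 1)) ≤ 16 * cutConst * Y := by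
          rw [mul_div_assoc', div_le_iff₀ hn]
          have := mul_le_mul_of_nonneg_right hx (by positivity : 0 ≤ 8 * cutConst * Y)
          linarith
        simp only [hS]
        linarith
    · apply tendsto_const_nhds.congr'
      obtain ⟨N, hN⟩ := exists_nat_gt ‖x - 0‖
      filter_upwards [eventually_ge_atTop N] with n hn
      have hn' : (N : ℝ) ≤ n := by exact_mod_cast hn
      have := fderiv_cutoff_eq_zero_of_lt (c := 0) (x := x) (ρ := n + 1) (by positivity) (by linarith)
      simp [d0R, d1R, this]
  rw [integral_sub (h4.div_const 2) h2, integral_div] at h0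
  linarith

end GroundState

lemma integrable_exp_neg_norm {c : ℝ} (hc : 0 < c) :
    Integrable fun x : Plane => Real.exp (-(c * ‖x‖)) := by
  rw [integrable_fun_norm_addHaar volume (f := fun t => Real.exp (-(c * t)))]
  have h := integrableOn_rpow_mul_exp_neg_mul_rpow (p := 1) (s := 1) (b := c) (by norm_num)
    (by norm_num) hc
  refine h.congr_fun (fun t ht => ?_) measurableSet_Ioi
  simp [Real.rpow_one]

lemma exists_tail_le {g : Plane → ℝ} (hg : Integrable g) (hg0 : ∀ x, 0 ≤ g x) {η : ℝ}
    (hη : 0 < η) : ∃ ρ : ℝ, 1 ≤ ρ ∧ ∀ y : Plane, ρ ≤ ‖y‖ → ∫ z in ball y 1, g z ≤ η := by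
  have ht := tendsto_setIntegral_of_antitone (μ := volume) (f := g)
    (s := fun n : ℕ => (closedBall (0 : Plane) n)ᶜ) (fun n => measurableSet_closedBall.compl)
    (fun m n hmn => compl_subset_compl.2 (closedBall_subset_closedBall (by exact_mod_cast hmn)))
    ⟨0, hg.integrableOn⟩
  have he : (⋂ n : ℕ, (closedBall (0 : Plane) n)ᶜ) = ∅ := by
    rw [eq_empty_iff_forall_notMem]
    intro x hx
    obtain ⟨n, hn⟩ := exists_nat_ge ‖x‖
    exact mem_iInter.1 hx n (mem_closedBall_zero_iff.2 hn)
  rw [he, setIntegral_empty] at ht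
  obtain ⟨n, hn⟩ := (ht.eventually_lt_const hη).exists
  refine ⟨n + 2, by linarith [Nat.cast_nonneg (α := ℝ) n], fun y hy => ?_⟩
  refine (setIntegral_mono_set hg.integrableOn (Eventually.of_forall hg0) ?_).trans hn.le
  refine LE.le.eventuallyLE fun z hz => ?_
  rw [mem_compl_iff, mem_closedBall_zero_iff, not_le]
  rw [mem_ball, dist_eq_norm] at hz
  have := norm_sub_norm_le y z
  rw [norm_sub_rev] at this
  linarith

section GroundState

variable {Q : Plane → ℝ}

lemma IsGroundState.exists_sq_le_exp (hQ : IsGroundState Q) :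
    ∃ C : ℝ, 0 ≤ C ∧ ∀ x, Q x ^ 2 ≤ C * Real.exp (-‖x‖) := by
  have hs := hQ.subSol
  have hc : Continuous fun x => Q x ^ 2 := hQ.1.continuous.pow 2
  have h0 : ∀ x, 0 ≤ Q x ^ 2 := fun x => sq_nonneg _
  have hi := hQ.2.2.2.1
  obtain ⟨ρ, hρ, htail⟩ := exists_tail_le hi h0 (η := 1 / 2000) (by norm_num)
  obtain ⟨G, hG⟩ := (isCompact_closedBall (0 : Plane) ρ).bddAbove_image hc.continuousOn
  have hGm : ∀ x, Q x ^ 2 ≤ max G 1 := fun x => by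
    rcases le_total ‖x‖ ρ with hx | hx
    · exact (hG (mem_image_of_mem _ (mem_closedBall_zero_iff.2 hx))).trans (le_max_left _ _)
    · have h1 := htail x hx
      have h2 := hs.eps_regularity zero_le_one hc h0 one_pos (h1.trans_lt (by norm_num))
      exact (h2.trans (by linarith)).trans (le_max_right _ _)
  set K := 48 / 1 ^ 2 * (Real.cosh (1 * 1) *
      ((2 * max G 1 + 1 / 2) * (2 * ∫ y, Q y ^ 2)) / (1 / 2)) with hK
  have hm : 0 ≤ ∫ y, Q y ^ 2 := integral_nonneg h0
  have hG1 : 1 ≤ max G 1 := le_max_right _ _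
  have hch := (Real.cosh_pos (1 * 1)).le
  have hK0 : 0 ≤ K := by positivity
  refine ⟨(K + max G 1) * Real.exp ρ, by positivity, fun x => ?_⟩
  rw [mul_assoc, ← Real.exp_add, add_mul]
  rcases le_total ‖x‖ ρ with hx | hx
  · have : 1 ≤ Real.exp (ρ + -‖x‖) := Real.one_le_exp (by linarith)
    have h1 := mul_le_mul_of_nonneg_left this (by positivity : 0 ≤ max G 1)
    have h2 : 0 ≤ K * Real.exp (ρ + -‖x‖) := by positivity
    linarith [hGm x]
  · have hx0 : x ≠ 0 := norm_pos_iff.1 (by linarith)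
    have h1 := hs.exp_decay zero_le_one hc h0 hi (κ := 1) (β := 1 / 2) (r := 1) (ρ := ρ)
      (η := 1 / 2000) (c := 0) hGm zero_le_one (by norm_num) one_pos (by norm_num)
      (fun y hy => htail y (by rwa [sub_zero] at hy)) (by norm_num) (by norm_num) hx0
      (by rwa [sub_zero])
    have h3 : 48 / 1 ^ 2 * (Real.cosh (1 * 1) * ((2 * max G 1 + 1 / 2) *
        (2 * Real.exp (-(1 * (‖x - 0‖ - ρ))) * ∫ y, Q y ^ 2)) / (1 / 2)) =
        K * Real.exp (ρ + -‖x‖) := by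
      rw [hK, sub_zero, show -(1 * (‖x‖ - ρ)) = ρ + -‖x‖ by ring]; ring
    have h2 : 0 ≤ max G 1 * Real.exp (ρ + -‖x‖) := by positivity
    linarith

lemma IsGroundState.integral_sq_pos (hQ : IsGroundState Q) : 0 < ∫ x, Q x ^ 2 := by
  rw [integral_pos_iff_support_of_nonneg (fun x => sq_nonneg _) hQ.2.2.2.1]
  have : Function.support (fun x => Q x ^ 2) = univ := by
    ext x; simp [(hQ.2.1 x).ne']
  rw [this]
  exact isOpen_univ.measure_pos _ univ_nonempty

/-- The minimal energy tends to `-∞` at the critical mass. -/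
lemma IsGroundState.eventually_Ea_le (hQ : IsGroundState Q) {V : Plane → ℝ} {Ω A : ℝ}
    (hV : V110 V) (hVe : ∃ C γ : ℝ, 0 < γ ∧ ∀ x : Plane, V x ≤ C * Real.exp (γ * ‖x‖))
    (hA : A = ∫ x, Q x ^ 2) (hGN : GN A) {u : ℝ → Plane → ℂ}
    (hmin : ∀ a ∈ Ioo (0 : ℝ) A, IsMinimizer V Ω a (u a)) (M : ℝ) :
    ∀ᶠ a in 𝓝[<] A, Ea V Ω (u a) ≤ M := by
  have hA0 : 0 < A := hA ▸ hQ.integral_sq_pos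
  have h4 := hQ.integrable_pow_four hGN
  obtain ⟨hc, hpos, -, h2, hd, -⟩ := id hQ
  obtain ⟨C', hC', hQe⟩ := hQ.exists_sq_le_exp
  obtain ⟨C, γ, hγ, hVe⟩ := hVe
  have hQc := hc.continuous
  have hexp := integrable_exp_neg_norm (c := 1 / 2) (by norm_num)
  have hm : Integrable fun x => ‖x‖ * Q x ^ 2 := by
    refine (hexp.const_mul (2 * C')).mono' (by fun_prop) (Eventually.of_forall fun x => ?_)
    rw [Real.norm_eq_abs, abs_of_nonneg (by positivity)]
    have e1 := Real.add_one_le_exp (1 / 2 * ‖x‖)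
    have e2 : Real.exp (-‖x‖) * Real.exp (1 / 2 * ‖x‖) = Real.exp (-(1 / 2 * ‖x‖)) := by
      rw [← Real.exp_add]; ring_nf
    calc ‖x‖ * Q x ^ 2 ≤ (2 * Real.exp (1 / 2 * ‖x‖)) * (C' * Real.exp (-‖x‖)) :=
          mul_le_mul (by linarith) (hQe x) (sq_nonneg _) (by positivity)
      _ = 2 * C' * (Real.exp (-‖x‖) * Real.exp (1 / 2 * ‖x‖)) := by ring
      _ = _ := by rw [e2]
  set P := ∫ x, ‖x‖ * Q x ^ 2
  set K := ∫ x : Plane, |C| * C' * Real.exp (-(1 / 2 * ‖x‖))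
  have hV1 : ∀ τ : ℝ, 0 < τ → 2 * γ ≤ τ → ∀ x : Plane,
      ‖V (τ⁻¹ • x) * Q x ^ 2‖ ≤ |C| * C' * Real.exp (-(1 / 2 * ‖x‖)) := fun τ hτ hγτ x => by
    rw [Real.norm_eq_abs, abs_of_nonneg (mul_nonneg (hV.2.1 _) (sq_nonneg _))]
    have b1 : γ * ‖τ⁻¹ • x‖ ≤ 1 / 2 * ‖x‖ := by
      rw [norm_smul, norm_inv, Real.norm_eq_abs, abs_of_pos hτ, ← mul_assoc]
      refine mul_le_mul_of_nonneg_right ?_ (norm_nonneg _)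
      rw [← div_eq_mul_inv, div_le_iff₀ hτ]; linarith
    have b2 : V (τ⁻¹ • x) ≤ |C| * Real.exp (1 / 2 * ‖x‖) :=
      (hVe _).trans (mul_le_mul (le_abs_self C) (Real.exp_le_exp.2 b1) (Real.exp_pos _).le
        (abs_nonneg _))
    have e2 : Real.exp (-‖x‖) * Real.exp (1 / 2 * ‖x‖) = Real.exp (-(1 / 2 * ‖x‖)) := by
      rw [← Real.exp_add]; ring_nf
    calc V (τ⁻¹ • x) * Q x ^ 2 ≤ (|C| * Real.exp (1 / 2 * ‖x‖)) * (C' * Real.exp (-‖x‖)) :=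
          mul_le_mul b2 (hQe x) (sq_nonneg _) (by positivity)
      _ = |C| * C' * (Real.exp (-‖x‖) * Real.exp (1 / 2 * ‖x‖)) := by ring
      _ = _ := by rw [e2]
  have hVi : ∀ τ : ℝ, 0 < τ → 2 * γ ≤ τ → Integrable fun x => V (τ⁻¹ • x) * Q x ^ 2 :=
    fun τ hτ hγτ => (hexp.const_mul (|C| * C')).mono'
      ((hV.1.comp (measurable_const_smul τ⁻¹)).aestronglyMeasurable.mul
        (hQc.pow 2).aestronglyMeasurable) (Eventually.of_forall (hV1 τ hτ hγτ))
  have hVK : ∀ τ : ℝ, 0 < τ → 2 * γ ≤ τ → ∫ x, V (τ⁻¹ • x) * Q x ^ 2 ≤ K := fun τ hτ hγτ =>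
    integral_mono (hVi τ hτ hγτ) (hexp.const_mul (|C| * C')) fun x =>
      (le_abs_self _).trans (hV1 τ hτ hγτ x)
  have hq : ∫ x, Q x ^ 4 = 2 * A := by have := hQ.pohozaev h4; rw [← hA] at this; linarith
  have hD : ∫ x, ‖fderiv ℝ Q x‖ ^ 2 = A := by
    have := hQ.energy_identity h4; rw [← hA, hq] at this; linarith
  have hτ : Tendsto (fun τ : ℝ => K + A * P - A ^ 2 / 2 * Real.log τ) atTop atBot := by
    have : Tendsto (fun τ : ℝ => A ^ 2 / 2 * Real.log τ) atTop atTop :=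
      Real.tendsto_log_atTop.const_mul_atTop (by positivity)
    simpa [sub_eq_add_neg] using tendsto_atBot_add_const_left _ (K + A * P) (tendsto_neg_atTop_atBot.comp this)
  obtain ⟨τ, h1, h2γ, h3⟩ := ((hτ.eventually_lt_atBot M).and
    ((eventually_ge_atTop (2 * γ)).and (eventually_gt_atTop 0))).exists
  have hcont : Continuous fun a : ℝ => a / A * (τ ^ 2 * A + K) - (a / A) ^ 2 / 2 * τ ^ 2 * (2 * A)
      + 1 / 2 * (-Real.log τ * a ^ 2 + 2 * a * (a / A) * P) := by fun_prop
  have hlim := (hcont.tendsto A).mono_left (nhdsWithin_le_nhds (s := Iio A))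
  have hval : A / A * (τ ^ 2 * A + K) - (A / A) ^ 2 / 2 * τ ^ 2 * (2 * A)
      + 1 / 2 * (-Real.log τ * A ^ 2 + 2 * A * (A / A) * P)
      = K + A * P - A ^ 2 / 2 * Real.log τ := by
    rw [div_self hA0.ne']; ring
  rw [hval] at hlim
  filter_upwards [hlim.eventually_lt_const h1, Ioo_mem_nhdsLT hA0] with a ha1 ha
  have := (hmin a ha).energy_le_profile ha.1 (differentiable_of_contDiff_two hc) h2 h4 hd hm
    hQ.integral_sq_pos h3 (hVi τ h3 h2γ) (hVK τ h3 h2γ)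
  rw [← hA, hq, hD] at this
  linarith

end GroundState

lemma InH1.ofReal_mul {u : Plane → ℂ} (hu : InH1 u) {ψ : Plane → ℝ} (hψ : Differentiable ℝ ψ)
    (h1 : ∀ x, |ψ x| ≤ 1) {M : ℝ} (hM : ∀ x, ‖fderiv ℝ ψ x‖ ≤ M) :
    InH1 fun x => (ψ x : ℂ) * u x := by
  have hn : ∀ x, ‖(ψ x : ℂ) * u x‖ ^ 2 = ψ x ^ 2 * ‖u x‖ ^ 2 := fun x => by
    rw [norm_mul, mul_pow, Complex.norm_real, Real.norm_eq_abs, sq_abs]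
  have hψ1 : ∀ x, ψ x ^ 2 ≤ 1 := fun x => (sq_le_one_iff_abs_le_one _).2 (h1 x)
  have hd : Differentiable ℝ fun x => (ψ x : ℂ) * u x := fun x =>
    (Complex.ofRealCLM.differentiableAt.comp x (hψ x)).mul (hu.1 x)
  refine ⟨hd, ?_, ?_⟩
  · refine hu.2.1.mono' (hd.continuous.norm.pow 2).aestronglyMeasurable
      (Eventually.of_forall fun x => ?_)
    rw [hn, Real.norm_eq_abs, abs_of_nonneg (by positivity)]
    exact mul_le_of_le_one_left (sq_nonneg _) (hψ1 x)
  · have hi : Integrable fun x => 2 * gradSq u x + 4 * M ^ 2 * ‖u x‖ ^ 2 :=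
      (hu.2.2.const_mul _).add (hu.2.1.const_mul _)
    refine hi.mono' (measurable_gradSq _).aestronglyMeasurable (Eventually.of_forall fun x => ?_)
    rw [Real.norm_eq_abs, abs_of_nonneg (gradSq_nonneg _ _)]
    have key : ∀ e : Plane, |fderiv ℝ ψ x e| ≤ M →
        ‖fderiv ℝ (fun y => (ψ y : ℂ) * u y) x e‖ ^ 2 ≤
          2 * ‖fderiv ℝ u x e‖ ^ 2 + 2 * (M ^ 2 * ‖u x‖ ^ 2) := fun e he => by
      rw [fderiv_ofReal_mul (hψ x) (hu.1 x)]
      have b1 := norm_add_le ((ψ x : ℂ) * fderiv ℝ u x e) (((fderiv ℝ ψ x e : ℝ) : ℂ) * u x)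
      rw [norm_mul, norm_mul, Complex.norm_real, Complex.norm_real, Real.norm_eq_abs,
        Real.norm_eq_abs] at b1
      have b2 := mul_le_of_le_one_left (norm_nonneg (fderiv ℝ u x e)) (h1 x)
      have b3 := mul_le_mul_of_nonneg_right he (norm_nonneg (u x))
      have b4 := pow_le_pow_left₀ (norm_nonneg _) (b1.trans (add_le_add b2 b3)) 2
      refine b4.trans ?_
      nlinarith [sq_nonneg (‖fderiv ℝ u x e‖ - M * ‖u x‖)]
    have k0 := key e0 ((abs_d_le_fderiv ψ x).1.trans (hM x))
    have k1 := key e1 ((abs_d_le_fderiv ψ x).2.trans (hM x))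
    rw [gradSq, gradSq, d0, d1, d0, d1]
    linarith

/-- The IMS localization formula for a trigonometric partition of unity. -/
lemma gradAbsSq_cos_add_sin {u : Plane → ℂ} {ϑ : Plane → ℝ} {x : Plane}
    (hu : DifferentiableAt ℝ u x) (hϑ : DifferentiableAt ℝ ϑ x) (h0 : ∀ y, 0 ≤ ϑ y)
    (h1 : ∀ y, ϑ y ≤ Real.pi / 2) :
    gradAbsSq (fun y => (Real.cos (ϑ y) : ℂ) * u y) x
      + gradAbsSq (fun y => (Real.sin (ϑ y) : ℂ) * u y) x
      ≤ gradAbsSq u x + ‖fderiv ℝ ϑ x‖ ^ 2 * ‖u x‖ ^ 2 := by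
  by_cases hz : u x = 0
  · have z1 : (Real.cos (ϑ x) : ℂ) * u x = 0 := by rw [hz, mul_zero]
    have z2 : (Real.sin (ϑ x) : ℂ) * u x = 0 := by rw [hz, mul_zero]
    rw [gradAbsSq, gradAbsSq, gradAbsSq,
      fderiv_norm_of_eq_zero (u := fun y => (Real.cos (ϑ y) : ℂ) * u y) z1,
      fderiv_norm_of_eq_zero (u := fun y => (Real.sin (ϑ y) : ℂ) * u y) z2]
    rw [norm_zero, zero_pow two_ne_zero, add_zero]
    positivity
  have hN := (hu.norm ℂ hz).hasFDerivAt
  have hc := hϑ.hasFDerivAt.cos.fun_mul hN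
  have hs := hϑ.hasFDerivAt.sin.fun_mul hN
  have ec : (fun y => ‖(Real.cos (ϑ y) : ℂ) * u y‖) = fun y => Real.cos (ϑ y) * ‖u y‖ := by
    ext y
    rw [norm_mul, Complex.norm_real, Real.norm_eq_abs, abs_of_nonneg
      (Real.cos_nonneg_of_mem_Icc ⟨by linarith [h0 y, Real.pi_pos], h1 y⟩)]
  have es : (fun y => ‖(Real.sin (ϑ y) : ℂ) * u y‖) = fun y => Real.sin (ϑ y) * ‖u y‖ := by
    ext y
    rw [norm_mul, Complex.norm_real, Real.norm_eq_abs, abs_of_nonneg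
      (Real.sin_nonneg_of_nonneg_of_le_pi (h0 y) (by linarith [h1 y, Real.pi_pos]))]
  rw [gradAbsSq, gradAbsSq, gradAbsSq, ec, es, hc.fderiv, hs.fderiv, opNorm_sq_eq, opNorm_sq_eq,
    opNorm_sq_eq, opNorm_sq_eq]
  simp only [add_apply, smul_apply, smul_eq_mul]
  have := Real.sin_sq_add_cos_sq (ϑ x)
  set c := Real.cos (ϑ x)
  set s := Real.sin (ϑ x)
  set n0 := fderiv ℝ (fun y => ‖u y‖) x e0
  set n1 := fderiv ℝ (fun y => ‖u y‖) x e1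
  set t0 := fderiv ℝ ϑ x e0
  set t1 := fderiv ℝ ϑ x e1
  apply le_of_eq
  linear_combination (n0 ^ 2 + n1 ^ 2 + (t0 ^ 2 + t1 ^ 2) * ‖u x‖ ^ 2) * this

/-- An almost optimizer of the Gagliardo–Nirenberg inequality does not split its mass. -/
lemma InH1.mass_concentration {u : Plane → ℂ} {A : ℝ} (hGN : GN A) (hA : 0 < A) (hu : InH1 u)
    {c : Plane} {ρ D M m δ η₀ : ℝ} (hρ : 0 < ρ) (hD0 : 0 < D) (hD : ∫ x, gradAbsSq u x ≤ D)
    (hρD : 1 / ρ ^ 2 ≤ D) (ha : ∫ x, ‖u x‖ ^ 2 ≤ A) (hM : ∀ x, ‖u x‖ ^ 2 ≤ M * D)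
    (hm : (∫ x in ball c (2 * ρ), ‖u x‖ ^ 2) - (∫ x in ball c ρ, ‖u x‖ ^ 2) ≤ m)
    (hη : η₀ ≤ ∫ x in ball c ρ, ‖u x‖ ^ 2) (hG : 2 * (1 - δ) * D ≤ ∫ x, ‖u x‖ ^ 4)
    (hsmall : A * (δ + (M / 4 + (2 * Real.pi * cutConst) ^ 2) * m) < η₀) :
    (∫ x, ‖u x‖ ^ 2) - (∫ x in ball c (2 * ρ), ‖u x‖ ^ 2)
      ≤ A * (δ + (M / 4 + (2 * Real.pi * cutConst) ^ 2) * m) := by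
  set g : Plane → ℝ := fun x => ‖u x‖ ^ 2 with hg
  have hgi : Integrable g := hu.2.1
  have hg0 : ∀ x, 0 ≤ g x := fun x => sq_nonneg _
  have hgc : Continuous g := hu.1.continuous.norm.pow 2
  set C := (2 * Real.pi * cutConst) ^ 2 with hC
  have hC0 : 0 ≤ C := sq_nonneg _
  have hM0 : 0 ≤ M := by
    have := (hg0 c).trans (hM c)
    exact nonneg_of_mul_nonneg_left this hD0
  set S := ball c (2 * ρ) \ ball c ρ with hS
  have hSm : MeasurableSet S := measurableSet_ball.diff measurableSet_ball
  have hmS : ∫ x, S.indicator g x ≤ m := by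
    rw [integral_indicator hSm, hS, setIntegral_sdiff measurableSet_ball hgi.integrableOn
      (ball_subset_ball (by linarith))]
    exact hm
  have hiS : Integrable (S.indicator g) := hgi.indicator hSm
  set ϑ : Plane → ℝ := fun x => Real.pi / 2 * (1 - cutoff c ρ x) with hϑ
  have hcd : Differentiable ℝ (cutoff c ρ) := differentiable_of_contDiff_two (isTest_cutoff c hρ).1
  have hϑd : Differentiable ℝ ϑ := by fun_prop
  have hϑ0 : ∀ y, 0 ≤ ϑ y := fun y =>
    mul_nonneg (by positivity) (sub_nonneg.2 (cutoff_le_one _ _ _))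
  have hϑ1 : ∀ y, ϑ y ≤ Real.pi / 2 := fun y =>
    mul_le_of_le_one_right (by positivity) (by linarith [cutoff_nonneg c ρ y])
  have hϑf : ∀ x, fderiv ℝ ϑ x = -(Real.pi / 2) • fderiv ℝ (cutoff c ρ) x := fun x => by
    rw [((((hcd x).hasFDerivAt.const_sub 1).const_mul (Real.pi / 2))).fderiv]
    simp
  have hϑn : ∀ x, ‖fderiv ℝ ϑ x‖ ≤ 2 * Real.pi * cutConst / ρ := fun x => by
    rw [hϑf, norm_smul, norm_neg, Real.norm_eq_abs, abs_of_pos (by positivity)]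
    refine (mul_le_mul_of_nonneg_left (norm_fderiv_cutoff_le c hρ x) (by positivity)).trans
      (le_of_eq ?_)
    ring
  have hmin : ∀ x ∉ S, (‖x - c‖ < ρ ∧ cutoff c ρ x = 1) ∨ (cutoff c ρ x = 0) := fun x hx => by
    rw [hS, Set.mem_sdiff, not_and, not_not, mem_ball, mem_ball, dist_eq_norm] at hx
    by_cases h : ‖x - c‖ < 2 * ρ
    · exact Or.inl ⟨hx h, cutoff_eq_one hρ (hx h).le⟩
    · exact Or.inr (cutoff_eq_zero hρ (not_lt.1 h))
  have hϑS : ∀ x, ‖fderiv ℝ ϑ x‖ ^ 2 * ‖u x‖ ^ 2 ≤ C * D * S.indicator g x := fun x => by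
    by_cases hx : x ∈ S
    · rw [indicator_of_mem hx]
      refine mul_le_mul_of_nonneg_right ?_ (hg0 x)
      refine (pow_le_pow_left₀ (norm_nonneg _) (hϑn x) 2).trans ?_
      rw [div_pow, ← hC, div_eq_mul_one_div]
      exact mul_le_mul_of_nonneg_left hρD hC0
    · have hf : fderiv ℝ (cutoff c ρ) x = 0 := by
        rcases hmin x hx with ⟨-, h⟩ | h
        · refine IsLocalMax.fderiv_eq_zero (Eventually.of_forall fun y => ?_)
          rw [h]; exact cutoff_le_one _ _ _
        · refine IsLocalMin.fderiv_eq_zero (Eventually.of_forall fun y => ?_)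
          rw [h]; exact cutoff_nonneg _ _ _
      rw [hϑf, hf, indicator_of_notMem hx]; simp
  have hcosd : Differentiable ℝ fun x => Real.cos (ϑ x) := hϑd.cos
  have hsind : Differentiable ℝ fun x => Real.sin (ϑ x) := hϑd.sin
  have H1 : InH1 fun x => (Real.cos (ϑ x) : ℂ) * u x := by
    refine hu.ofReal_mul hcosd (fun x => Real.abs_cos_le_one _)
      (M := 2 * Real.pi * cutConst / ρ) fun x => ?_
    rw [(hϑd x).hasFDerivAt.cos.fderiv, norm_smul, norm_neg]
    exact (mul_le_of_le_one_left (norm_nonneg _) (Real.abs_sin_le_one _)).trans (hϑn x)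
  have H2 : InH1 fun x => (Real.sin (ϑ x) : ℂ) * u x := by
    refine hu.ofReal_mul hsind (fun x => Real.abs_sin_le_one _)
      (M := 2 * Real.pi * cutConst / ρ) fun x => ?_
    rw [(hϑd x).hasFDerivAt.sin.fderiv, norm_smul]
    exact (mul_le_of_le_one_left (norm_nonneg _) (Real.abs_cos_le_one _)).trans (hϑn x)
  obtain ⟨J1, G1⟩ := hGN _ H1
  obtain ⟨J2, G2⟩ := hGN _ H2
  have K1 := H1.2.1
  have K2 := H2.2.1
  have L1 := H1.integrable_gradAbsSq
  have L2 := H2.integrable_gradAbsSq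
  have LD0 := integral_nonneg (f := gradAbsSq _) (μ := volume) (gradAbsSq_nonneg fun x => (Real.cos (ϑ x) : ℂ) * u x)
  have LD1 := integral_nonneg (f := gradAbsSq _) (μ := volume) (gradAbsSq_nonneg fun x => (Real.sin (ϑ x) : ℂ) * u x)
  have nc : ∀ (r : ℝ) (z : ℂ) (k : ℕ), Even k → ‖(r : ℂ) * z‖ ^ k = r ^ k * ‖z‖ ^ k := by
    intro r z k hk
    rw [norm_mul, mul_pow, Complex.norm_real, Real.norm_eq_abs, hk.pow_abs]
  have n2 := fun r z => nc r z 2 (by decide)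
  have n4 := fun r z => nc r z 4 (by decide)
  simp only [n2, n4] at J1 J2 G1 G2 K1 K2
  set m1 := ∫ x, Real.cos (ϑ x) ^ 2 * ‖u x‖ ^ 2
  set m2 := ∫ x, Real.sin (ϑ x) ^ 2 * ‖u x‖ ^ 2
  set Q1 := ∫ x, Real.cos (ϑ x) ^ 4 * ‖u x‖ ^ 4
  set Q2 := ∫ x, Real.sin (ϑ x) ^ 4 * ‖u x‖ ^ 4
  set D1 := ∫ x, gradAbsSq (fun x => (Real.cos (ϑ x) : ℂ) * u x) x
  set D2 := ∫ x, gradAbsSq (fun x => (Real.sin (ϑ x) : ℂ) * u x) x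
  have hsum : m1 + m2 = ∫ x, g x := by
    rw [← integral_add K1 K2]
    congr 1; ext x
    rw [← add_mul, Real.cos_sq_add_sin_sq, one_mul]
  have hDD : D1 + D2 ≤ D + C * D * m := by
    have h : D1 + D2 ≤ ∫ x, (gradAbsSq u x + C * D * S.indicator g x) := by
      rw [← integral_add L1 L2]
      refine integral_mono (L1.add L2) (hu.integrable_gradAbsSq.add (hiS.const_mul _)) fun x => ?_
      exact (gradAbsSq_cos_add_sin (hu.1 x) (hϑd x) hϑ0 hϑ1).trans
        (add_le_add_right (hϑS x) _)
    rw [integral_add hu.integrable_gradAbsSq (hiS.const_mul _), integral_const_mul] at h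
    have := mul_le_mul_of_nonneg_left hmS (by positivity : 0 ≤ C * D)
    linarith
  have hQQ : 2 * (1 - δ) * D ≤ Q1 + Q2 + M * D / 2 * m := by
    have h : ∫ x, ‖u x‖ ^ 4 ≤ ∫ x, (Real.cos (ϑ x) ^ 4 * ‖u x‖ ^ 4
        + Real.sin (ϑ x) ^ 4 * ‖u x‖ ^ 4 + M * D / 2 * S.indicator g x) := by
      refine integral_mono (hGN u hu).1 ((J1.add J2).add (hiS.const_mul _)) fun x => ?_
      have e1 := Real.cos_sq_add_sin_sq (ϑ x)
      have e4 : ‖u x‖ ^ 4 = g x * g x := by simp only [hg]; ring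
      by_cases hx : x ∈ S
      · simp only [indicator_of_mem hx, e4]
        have b := mul_le_mul_of_nonneg_right (hM x) (hg0 x)
        set p := Real.cos (ϑ x)
        set q := Real.sin (ϑ x)
        have e2 : 1 / 2 ≤ p ^ 4 + q ^ 4 := by
          nlinarith [sq_nonneg (p ^ 2 - q ^ 2)]
        have := mul_le_mul_of_nonneg_right e2 (mul_nonneg (hg0 x) (hg0 x))
        change g x * g x ≤ M * D * g x at b
        linarith
      · simp only [indicator_of_notMem hx]
        rcases hmin x hx with ⟨-, h⟩ | h
        · have : ϑ x = 0 := by simp only [hϑ, h]; ring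
          rw [this]; simp
        · have : ϑ x = Real.pi / 2 := by simp only [hϑ, h]; ring
          rw [this]; simp
    have J12 : Integrable fun x => Real.cos (ϑ x) ^ 4 * ‖u x‖ ^ 4
      + Real.sin (ϑ x) ^ 4 * ‖u x‖ ^ 4 := J1.add J2
    rw [integral_add J12 (hiS.const_mul _), integral_add J1 J2, integral_const_mul] at h
    have := mul_le_mul_of_nonneg_left hmS (by positivity : 0 ≤ M * D / 2)
    linarith
  have hm1 : η₀ ≤ m1 := by
    refine hη.trans ?_
    rw [← integral_indicator measurableSet_ball]
    refine integral_mono (hgi.indicator measurableSet_ball) K1 fun x => ?_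
    by_cases hx : x ∈ ball c ρ
    · rw [mem_ball, dist_eq_norm] at hx
      have : ϑ x = 0 := by simp only [hϑ, cutoff_eq_one hρ hx.le]; ring
      rw [indicator_of_mem (by rwa [mem_ball, dist_eq_norm])]
      simp [this]
    · rw [indicator_of_notMem hx]; positivity
  have hm1' : m1 ≤ ∫ x in ball c (2 * ρ), g x := by
    rw [← integral_indicator measurableSet_ball]
    refine integral_mono K1 (hgi.indicator measurableSet_ball) fun x => ?_
    by_cases hx : x ∈ ball c (2 * ρ)
    · rw [indicator_of_mem hx]
      exact mul_le_of_le_one_left (sq_nonneg _) (Real.cos_sq_le_one _)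
    · rw [indicator_of_notMem hx]
      rw [mem_ball, dist_eq_norm, not_lt] at hx
      have : ϑ x = Real.pi / 2 := by simp only [hϑ, cutoff_eq_zero hρ hx]; ring
      simp [this]
  have hm10 : 0 ≤ m1 := integral_nonneg fun x => by positivity
  have hm20 : 0 ≤ m2 := integral_nonneg fun x => by positivity
  have hmm : 0 ≤ m := (integral_nonneg (indicator_nonneg fun x _ => hg0 x)).trans hmS
  have key : A * (1 - δ) - A * M / 4 * m ≤ max m1 m2 + A * C * m := by
    have k1 := mul_le_mul_of_nonneg_right (le_max_left m1 m2) LD0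
    have k2 := mul_le_mul_of_nonneg_right (le_max_right m1 m2) LD1
    have hx0 : 0 ≤ max m1 m2 := hm20.trans (le_max_right _ _)
    have hxA : max m1 m2 ≤ A := max_le (by linarith) (by linarith)
    have k3 := mul_le_mul_of_nonneg_left hDD hx0
    have k4 := mul_le_mul_of_nonneg_left hQQ (by positivity : 0 ≤ A / 2)
    have k5 := mul_le_mul_of_nonneg_right hxA (by positivity : 0 ≤ C * D * m)
    have k6 : (A * (1 - δ) - A * M / 4 * m) * D ≤ (max m1 m2 + A * C * m) * D := by
      linarith
    exact le_of_mul_le_mul_right k6 hD0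
  rcases le_total m1 m2 with h | h
  · rw [max_eq_right h] at key
    exfalso; linarith
  · rw [max_eq_left h] at key
    linarith

lemma SubSol.mono {g : Plane → ℝ} {l l' : ℝ} (h : SubSol g l) (hl : l' ≤ l) (hg : Continuous g)
    (hg0 : ∀ x, 0 ≤ g x) : SubSol g l' := by
  intro φ hφ hφ0
  have hφc := hφ.1.continuous
  refine le_trans (mul_le_mul_of_nonneg_left ?_ zero_le_two) (h φ hφ hφ0)
  refine integral_mono ?_ ?_ fun x => ?_
  · exact (by fun_prop : Continuous fun x => (l' - g x) * g x * φ x).integrable_of_hasCompactSupport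
      hφ.2.mul_left
  · exact (by fun_prop : Continuous fun x => (l - g x) * g x * φ x).integrable_of_hasCompactSupport
      hφ.2.mul_left
  · have := mul_le_mul_of_nonneg_right hl (mul_nonneg (hg0 x) (hφ0 x))
    simp only
    linarith

/-- The constant in the interior sup bound `SubSol.le_supConst_mul`. -/
def supConst : ℝ := 781250

lemma SubSol.le_supConst_mul {g : Plane → ℝ} (h : SubSol g 0) (hg : Continuous g)
    (hg0 : ∀ x, 0 ≤ g x) (hg2 : Integrable fun x => g x ^ 2) {D : ℝ} (hD : 0 < D)
    (hle : ∫ x, g x ^ 2 ≤ 2 * D) (x : Plane) : g x ≤ supConst * D := by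
  set r := (5000 * Real.sqrt D)⁻¹ with hr
  have hsD := Real.sqrt_pos.2 hD
  have hr0 : 0 < r := by positivity
  have hr2 : r ^ 2 = 1 / (25000000 * D) := by
    rw [hr, inv_pow, mul_pow, Real.sq_sqrt hD.le]; norm_num
  have hmass : ∫ y in ball x r, g y < 1 / 1536 := by
    have hint : IntegrableOn (fun y => 1 / (8000 * D) * g y ^ 2 + 2000 * D) (ball x r) :=
      (hg2.integrableOn.const_mul _).add
        (integrableOn_const (by exact measure_ball_lt_top.ne))
    have h1 : ∫ y in ball x r, g y ≤ ∫ y in ball x r, (1 / (8000 * D) * g y ^ 2 + 2000 * D) := by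
      refine setIntegral_mono (continuous_integrableOn_ball hg x r) hint fun y => ?_
      have e : 1 / (8000 * D) * g y ^ 2 + 2000 * D - g y = (g y - 4000 * D) ^ 2 / (8000 * D) := by
        field_simp; ring
      have : 0 ≤ (g y - 4000 * D) ^ 2 / (8000 * D) := by positivity
      simp only
      linarith
    rw [integral_add (hg2.integrableOn.const_mul _)
      (integrableOn_const (by exact measure_ball_lt_top.ne)), integral_const_mul,
      setIntegral_const, volume_real_ball x hr0.le, hr2, smul_eq_mul] at h1
    have h2 : ∫ y in ball x r, g y ^ 2 ≤ 2 * D :=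
      (setIntegral_le_integral hg2 (Eventually.of_forall fun y => sq_nonneg _)).trans hle
    have h3 := mul_le_mul_of_nonneg_left h2 (by positivity : 0 ≤ 1 / (8000 * D))
    have h4 : 1 / (8000 * D) * (2 * D) = 1 / 4000 := by field_simp; norm_num
    have h5 : Real.pi * (1 / (25000000 * D)) * (2000 * D) = Real.pi / 12500 := by
      field_simp; norm_num
    have := Real.pi_lt_d2
    linarith
  have := h.eps_regularity le_rfl hg hg0 hr0 hmass
  have h6 := mul_le_mul_of_nonneg_left hmass.le (by positivity : 0 ≤ 48 / r ^ 2)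
  have h7 : 48 / r ^ 2 * (1 / 1536) = supConst * D := by
    rw [hr2, supConst]; field_simp; norm_num
  linarith

/-- Uniform concentration of mass at the maximum point of an almost optimizer. -/
lemma exists_mass_concentration {A η : ℝ} (hGN : GN A) (hA : 0 < A) (hη : 0 < η) :
    ∃ δ R : ℝ, 0 < δ ∧ 1 ≤ R ∧ ∀ (u : Plane → ℂ) (c : Plane) (D ε : ℝ), InH1 u →
      ∫ x, gradAbsSq u x = D → 0 < D → 0 < ε → ε ^ 2 * D = 1 → ∫ x, ‖u x‖ ^ 2 ≤ A →
      SubSol (fun x => ‖u x‖ ^ 2) 0 → (∀ y, ‖u y‖ ≤ ‖u c‖) →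
      2 * (1 - δ) * D ≤ ∫ x, ‖u x‖ ^ 4 →
      (∀ x, ‖u x‖ ^ 2 ≤ supConst * D) ∧
      (∫ x, ‖u x‖ ^ 2) - (∫ x in ball c (R * ε), ‖u x‖ ^ 2) ≤ η := by
  have hK := cutConst_pos
  have hsup : 0 < supConst := by norm_num [supConst]
  set C := supConst / 4 + (2 * Real.pi * cutConst) ^ 2 with hC
  have hC0 : 0 < C := by positivity
  set η₀ := min (1 / 1536) (1 / (48 * A)) with hη₀
  have hη₀0 : 0 < η₀ := by positivity
  set η' := min η (η₀ / 2) with hη'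
  have hη'0 : 0 < η' := by positivity
  set δ := min (1 / 2) (η' / (2 * A)) with hδ
  have hδ0 : 0 < δ := by positivity
  set m := η' / (2 * A * C) with hm
  have hm0 : 0 < m := by positivity
  obtain ⟨N, hN⟩ := exists_nat_gt (A / m)
  rw [div_lt_iff₀ hm0] at hN
  refine ⟨δ, 2 ^ N, hδ0, one_le_pow₀ one_le_two, fun u c D ε hu hD hD0 hε hεD ha hsub hmax hG => ?_⟩
  set g : Plane → ℝ := fun x => ‖u x‖ ^ 2 with hg
  have hgi : Integrable g := hu.2.1
  have hg0 : ∀ x, 0 ≤ g x := fun x => sq_nonneg _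
  have hgc : Continuous g := hu.1.continuous.norm.pow 2
  obtain ⟨h4, hgn⟩ := hGN u hu
  rw [hD] at hgn
  have e4 : ∀ x, ‖u x‖ ^ 4 = g x ^ 2 := fun x => by simp only [hg]; ring
  have hG4 : ∫ x, ‖u x‖ ^ 4 ≤ 2 * D := by
    have := mul_le_mul_of_nonneg_right ha hD0.le
    have h : A / 2 * ∫ x, ‖u x‖ ^ 4 ≤ A / 2 * (2 * D) := by linarith
    exact le_of_mul_le_mul_left h (by positivity)
  have hM : ∀ x, g x ≤ supConst * D := by
    simp only [e4] at h4 hG4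
    exact hsub.le_supConst_mul hgc hg0 h4 hD0 hG4
  refine ⟨hM, ?_⟩
  have hδ1 : δ ≤ 1 / 2 := min_le_left _ _
  have hgcD : D / A ≤ g c := by
    have h1 : ∫ x, ‖u x‖ ^ 4 ≤ ∫ x, g c * g x := by
      refine integral_mono h4 (hgi.const_mul _) fun x => ?_
      simp only [e4]
      rw [sq]
      exact mul_le_mul_of_nonneg_right (pow_le_pow_left₀ (norm_nonneg _) (hmax x) 2) (hg0 x)
    rw [integral_const_mul] at h1
    have h2 := mul_le_mul_of_nonneg_left ha (hg0 c)
    rw [div_le_iff₀ hA]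
    have h3 := mul_le_mul_of_nonneg_right hδ1 hD0.le
    linarith
  have hball0 : η₀ ≤ ∫ x in ball c ε, g x := by
    by_contra! hlt
    have h1 := hsub.eps_regularity le_rfl hgc hg0 hε (hlt.trans_le (min_le_left _ _))
    have h2 : 48 / ε ^ 2 = 48 * D := by
      rw [div_eq_iff (by positivity)]; linarith
    rw [h2] at h1
    have h3 := hlt.trans_le (min_le_right _ _)
    have h4 := mul_lt_mul_of_pos_left h3 (by positivity : 0 < 48 * D)
    have h5 : 48 * D * (1 / (48 * A)) = D / A := by field_simp
    linarith
  have hmono : ∀ {s t : ℝ}, s ≤ t → ∫ x in ball c s, g x ≤ ∫ x in ball c t, g x := fun hst =>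
    setIntegral_mono_set hgi.integrableOn (Eventually.of_forall hg0)
      (ball_subset_ball hst).eventuallyLE
  set F : ℕ → ℝ := fun j => ∫ x in ball c (2 ^ j * ε), g x with hF
  obtain ⟨j, hjN, hj⟩ : ∃ j < N, F (j + 1) - F j ≤ m := by
    by_contra! hcon
    have h1 : ∑ j ∈ Finset.range N, m ≤ ∑ j ∈ Finset.range N, (F (j + 1) - F j) :=
      Finset.sum_le_sum fun j hj => (hcon j (Finset.mem_range.1 hj)).le
    rw [Finset.sum_range_sub, Finset.sum_const, Finset.card_range, nsmul_eq_mul] at h1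
    have h2 : F N ≤ A := (setIntegral_le_integral hgi (Eventually.of_forall hg0)).trans ha
    have h3 : 0 ≤ F 0 := integral_nonneg hg0
    linarith
  have hρ1 : ε ≤ 2 ^ j * ε := le_mul_of_one_le_left hε.le (one_le_pow₀ one_le_two)
  have hρ0 : 0 < 2 ^ j * ε := by positivity
  have e2 : 2 * (2 ^ j * ε) = 2 ^ (j + 1) * ε := by ring
  have hbound : A * (δ + C * m) ≤ η' := by
    have h1 : δ ≤ η' / (2 * A) := min_le_right _ _
    have h2 : A * (η' / (2 * A) + C * m) = η' := by rw [hm]; field_simp; ring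
    have h3 := mul_le_mul_of_nonneg_left h1 hA.le
    linarith
  rw [hC] at hbound
  have hη2 : η' ≤ η₀ / 2 := min_le_right _ _
  have hcc := hu.mass_concentration (c := c) (ρ := 2 ^ j * ε) (D := D) (M := supConst) (m := m)
    (δ := δ) (η₀ := η₀) hGN hA hρ0 hD0 hD.le (by
      rw [div_le_iff₀ (by positivity)]
      have := mul_le_mul_of_nonneg_right (pow_le_pow_left₀ hε.le hρ1 2) hD0.le
      linarith) ha hM (by rw [e2]; exact hj) (hball0.trans (hmono hρ1)) hG (by linarith)
  have hcc' := hcc.trans hbound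
  rw [e2] at hcc'
  have hlast := hmono (s := 2 ^ (j + 1) * ε) (t := 2 ^ N * ε)
    (mul_le_mul_of_nonneg_right (pow_le_pow_right₀ one_le_two hjN) hε.le)
  have hη1 : η' ≤ η := min_le_left _ _
  change (∫ x, g x) - (∫ x in ball c (2 ^ (j + 1) * ε), g x) ≤ η' at hcc'
  change (∫ x, g x) - (∫ x in ball c (2 ^ N * ε), g x) ≤ η
  linarith

/-- Uniform exponential decay of the rescaled density around its maximum point. -/
lemma exists_density_decay {A : ℝ} (hGN : GN A) (hA : 0 < A) :
    ∃ δ R C : ℝ, 0 < δ ∧ 0 < R ∧ 0 < C ∧ ∀ (u : Plane → ℂ) (c : Plane) (D ε l : ℝ), InH1 u →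
      ∫ x, gradAbsSq u x = D → 0 < D → 0 < ε → ε ^ 2 * D = 1 → ∫ x, ‖u x‖ ^ 2 ≤ A →
      SubSol (fun x => ‖u x‖ ^ 2) l → 9 / 10 * (D / A) ≤ l → (∀ y, ‖u y‖ ≤ ‖u c‖) →
      2 * (1 - δ) * D ≤ ∫ x, ‖u x‖ ^ 4 → ∀ y : Plane, R ≤ ‖y‖ →
      ε ^ 2 * ‖u (ε • y + c)‖ ^ 2 ≤ C * Real.exp (-(2 / (3 * Real.sqrt A) * ‖y‖)) := by
  set η := min (1 / 2000) (1 / (480 * A)) with hη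
  have hη0 : 0 < η := by positivity
  obtain ⟨δ, R, hδ, hR, H⟩ := exists_mass_concentration hGN hA hη0
  have hsA := Real.sqrt_pos.2 hA
  set k := 2 / (3 * Real.sqrt A) with hk
  have hk0 : 0 < k := by positivity
  have hk2 : k ^ 2 = 4 / (9 * A) := by
    rw [hk, div_pow, mul_pow, Real.sq_sqrt hA.le]; norm_num
  have hsup : 0 < supConst := by norm_num [supConst]
  have hch := Real.cosh_pos k
  set C := 48 * Real.cosh k * (2 * supConst + 1 / A) * 2 * A * A * Real.exp (k * (R + 1)) with hC
  refine ⟨δ, R + 1, C, hδ, by positivity, by positivity,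
    fun u c D ε l hu hD hD0 hε hεD ha hsub hl hmax hG y hy => ?_⟩
  set g : Plane → ℝ := fun x => ‖u x‖ ^ 2 with hg
  have hgi : Integrable g := hu.2.1
  have hg0 : ∀ x, 0 ≤ g x := fun x => sq_nonneg _
  have hgc : Continuous g := hu.1.continuous.norm.pow 2
  have hl0 : 0 ≤ l := le_trans (by positivity) hl
  obtain ⟨hM, htail⟩ := H u c D ε hu hD hD0 hε hεD ha (hsub.mono hl0 hgc hg0) hmax hG
  have htail' : ∀ z, (R + 1) * ε ≤ ‖z - c‖ → ∫ x in ball z ε, g x ≤ η := fun z hz => by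
    refine le_trans ?_ htail
    rw [← setIntegral_compl measurableSet_ball hgi]
    refine setIntegral_mono_set hgi.integrableOn (Eventually.of_forall hg0)
      (LE.le.eventuallyLE fun x hx => ?_)
    rw [mem_compl_iff, mem_ball, dist_eq_norm, not_lt]
    rw [mem_ball, dist_eq_norm] at hx
    have := norm_sub_le_norm_sub_add_norm_sub z x c
    rw [norm_sub_rev z x] at this
    linarith
  have hε2 : ε ^ 2 = 1 / D := by rw [eq_div_iff hD0.ne']; exact hεD
  have hxc : ‖ε • y + c - c‖ = ε * ‖y‖ := by
    rw [add_sub_cancel_right, norm_smul, Real.norm_eq_abs, abs_of_pos hε]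
  have hηA : η * A ≤ 1 / 480 := by
    have := mul_le_mul_of_nonneg_right (min_le_right (1 / 2000) (1 / (480 * A))) hA.le
    refine this.trans (le_of_eq ?_)
    field_simp
  have hDA : 0 < D / A := by positivity
  have hkε : (k / ε) ^ 2 = 4 / 9 * (D / A) := by
    rw [div_pow, hk2, hε2]; field_simp
  have h48 : 48 / ε ^ 2 * η ≤ 1 / 10 * (D / A) := by
    have e : 48 / ε ^ 2 * η = 48 * (η * A) * (D / A) := by rw [hε2]; field_simp
    rw [e]
    exact mul_le_mul_of_nonneg_right (by linarith) hDA.le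
  have hy0 : 0 < ‖y‖ := by linarith
  have key := hsub.exp_decay hl0 hgc hg0 hgi (G := supConst * D) (κ := k / ε) (β := D / A) (r := ε)
    (ρ := (R + 1) * ε) (η := η) (c := c) hM (by positivity) hDA hε
    ((min_le_left _ _).trans_lt (by norm_num)) htail' (by rw [hkε]; linarith)
    (by rw [hkε]; linarith) (x := ε • y + c) (by
      rw [← sub_ne_zero, ← norm_pos_iff, hxc]; positivity) (by
      rw [hxc, mul_comm]; exact mul_le_mul_of_nonneg_left hy hε.le)
  have e1 : k / ε * ε = k := by field_simp
  have e2 : -(k / ε * (ε * ‖y‖ - (R + 1) * ε)) = k * (R + 1) + -(k * ‖y‖) := by field_simp; ring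
  rw [hxc, e1, e2, Real.exp_add] at key
  set X := Real.exp (k * (R + 1)) with hX
  set Y := Real.exp (-(k * ‖y‖)) with hY
  have hXY : 0 < X * Y := by positivity
  have e3 : 48 / ε ^ 2 * (Real.cosh k * ((2 * (supConst * D) + D / A) * (2 * (X * Y) * ∫ x, g x))
      / (D / A)) = D * (48 * Real.cosh k * (2 * supConst + 1 / A) * 2 * A * X * Y * ∫ x, g x) := by
    rw [hε2]; field_simp
  rw [e3] at key
  have hpre : 0 ≤ 48 * Real.cosh k * (2 * supConst + 1 / A) * 2 * A * X * Y := by positivity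
  have h1 := mul_le_mul_of_nonneg_left ha hpre
  calc ε ^ 2 * ‖u (ε • y + c)‖ ^ 2
      ≤ ε ^ 2 * (D * (48 * Real.cosh k * (2 * supConst + 1 / A) * 2 * A * X * Y * ∫ x, g x)) :=
        mul_le_mul_of_nonneg_left key (sq_nonneg _)
    _ = 48 * Real.cosh k * (2 * supConst + 1 / A) * 2 * A * X * Y * ∫ x, g x := by
        rw [← mul_assoc, hεD, one_mul]
    _ ≤ _ := h1
    _ = C * Y := by rw [hC]; ring

/-- The lower bound for the logarithmic potential of a density of mass at most `A` with kinetic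
energy `D`. -/
def potBound (A D : ℝ) : ℝ := A / 2 * Real.log (max 1 D) + logSqConst / 2 + 1

lemma potBound_mono {A : ℝ} (hA : 0 ≤ A) : Monotone (potBound A) := fun s t hst => by
  have := Real.log_le_log (by positivity : 0 < max 1 s) (max_le_max_left 1 hst)
  have := mul_le_mul_of_nonneg_left this (by positivity : 0 ≤ A / 2)
  unfold potBound
  linarith

lemma potBound_nonneg {A : ℝ} (hA : 0 ≤ A) (D : ℝ) : 0 ≤ potBound A D := by
  have := Real.log_nonneg (le_max_left 1 D)
  have := logSqConst_nonneg
  unfold potBound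
  positivity

lemma exists_potBound_le (A : ℝ) {κ : ℝ} (hκ : 0 < κ) :
    ∃ D₀ : ℝ, 1 ≤ D₀ ∧ ∀ D, D₀ ≤ D → potBound A D ≤ κ * D := by
  have h : (fun D : ℝ => A / 2 * Real.log D + (logSqConst / 2 + 1)) =o[atTop] (id : ℝ → ℝ) :=
    (Real.isLittleO_log_id_atTop.const_mul_left _).add (Asymptotics.isLittleO_const_id_atTop _)
  obtain ⟨D₁, hD₁⟩ := eventually_atTop.1 (h.def hκ)
  refine ⟨max 1 D₁, le_max_left _ _, fun D hD => ?_⟩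
  have h1 : 1 ≤ D := (le_max_left _ _).trans hD
  have h2 := (le_abs_self _).trans (hD₁ D ((le_max_right _ _).trans hD))
  rw [id, Real.norm_of_nonneg (by linarith)] at h2
  rw [potBound, max_eq_right h1]
  linarith

lemma InH1.logPot_ge {u : Plane → ℂ} {A : ℝ} (hu : InH1 u) (hGN : GN A) (hA : 0 < A)
    (ha : ∫ x, ‖u x‖ ^ 2 ≤ A) (x : Plane) :
    -potBound A (∫ x, gradAbsSq u x) ≤ ∫ y, Real.log ‖x - y‖ * ‖u y‖ ^ 2 := by
  obtain ⟨h4, hgn⟩ := hGN u hu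
  set D := ∫ x, gradAbsSq u x with hD
  have hD0 : 0 ≤ D := integral_nonneg (gradAbsSq_nonneg u)
  set T := max 1 D with hT
  have hT0 : 0 < T := by positivity
  have hsT := Real.sqrt_pos.2 hT0
  have e4 : ∀ x, (‖u x‖ ^ 2) ^ 2 = ‖u x‖ ^ 4 := fun x => by ring
  refine logPot_lower (g := fun y => ‖u y‖ ^ 2) (s := (Real.sqrt T)⁻¹) hu.2.1
    (by simpa only [e4] using h4) (fun x => sq_nonneg _) (inv_pos.2 hsT)
    (potBound_nonneg hA.le D) ?_ x
  simp only [e4]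
  have hG : ∫ x, ‖u x‖ ^ 4 ≤ 2 * T := by
    have h1 := mul_le_mul_of_nonneg_right ha hD0
    have h2 := mul_le_mul_of_nonneg_left (le_max_right 1 D) hA.le
    have h : A / 2 * ∫ x, ‖u x‖ ^ 4 ≤ A / 2 * (2 * T) := by linarith
    exact le_of_mul_le_mul_left h (by positivity)
  have h1 : ((Real.sqrt T)⁻¹) ^ 2 * ∫ x, ‖u x‖ ^ 4 ≤ 2 := by
    rw [inv_pow, Real.sq_sqrt hT0.le, inv_mul_le_iff₀ hT0]
    linarith
  have h2 := mul_le_mul_of_nonneg_left ha (Real.log_nonneg (le_max_left 1 D))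
  rw [Real.log_inv, Real.log_sqrt hT0.le, potBound]
  linarith

lemma IsMinimizer.energy_bounds {V : Plane → ℝ} {Ω a A : ℝ} {u : Plane → ℂ} (hV : V110 V)
    (hV0 : ∀ x, 0 ≤ V x - Ω ^ 2 / 4 * ‖x‖ ^ 2) (hGN : GN A) (hw : IsMinimizer V Ω a u)
    (ha : 0 < a) (haA : a ≤ A) {D : ℝ} (hD : ∫ x, gradAbsSq u x = D) :
    -(A / 2 * potBound A D) ≤ Ea V Ω u ∧ (Ea V Ω u ≤ 0 →
      2 * D - A * potBound A D ≤ ∫ x, ‖u x‖ ^ 4 ∧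
      SubSol (fun x => ‖u x‖ ^ 2) (D / A - potBound A D)) := by
  obtain ⟨hu, hmass⟩ := hw.1
  have hA : 0 < A := ha.trans_le haA
  have hD0 : 0 ≤ D := hD ▸ integral_nonneg (gradAbsSq_nonneg u)
  have hpot := hu.1.logPot_ge hGN hA (hmass.trans_le haA)
  rw [hD] at hpot
  have hadm := hu.logAdm hV hGN
  have hL := logForm_lower hadm hadm (fun x => sq_nonneg _) hpot
  rw [hmass, ← logConv_eq] at hL
  have hB := mul_le_mul_of_nonneg_left haA (potBound_nonneg hA.le D)
  have hP : D ≤ ∫ x, quadDensity V Ω u x := by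
    rw [← hD]
    exact integral_mono hu.1.integrable_gradAbsSq (hu.integrable_quadDensity hV Ω)
      (gradAbsSq_le_quadDensity hu.1.1 hV0)
  have hE := hu.Ea_eq hV Ω
  have hG : ∫ x, ‖u x‖ ^ 4 ≤ 2 * D := by
    have h1 := (hGN u hu.1).2
    rw [hmass, hD] at h1
    have h2 := mul_le_mul_of_nonneg_right haA hD0
    have h : A / 2 * ∫ x, ‖u x‖ ^ 4 ≤ A / 2 * (2 * D) := by linarith
    exact le_of_mul_le_mul_left h (by positivity)
  refine ⟨by linarith, fun hE0 => ⟨by linarith, ?_⟩⟩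
  refine (hw.subSol hV hV0 hGN ha hpot).mono ?_ (hu.1.1.continuous.norm.pow 2)
    fun x => sq_nonneg _
  refine sub_le_sub_right ?_ _
  refine (div_le_div_of_nonneg_left hD0 ha haA).trans ?_
  exact div_le_div_of_nonneg_right (by linarith) ha.le

lemma norm_wfam_sq (Ω : ℝ) (u : ℝ → Plane → ℂ) (xa : ℝ → Plane) (a t : ℝ) (y : Plane) :
    ‖wfam Ω u xa a t y‖ ^ 2 = epsOf u a ^ 2 * ‖u a (epsOf u a • y + xa a)‖ ^ 2 := by
  rw [wfam, norm_mul, norm_mul, Complex.norm_exp, mul_pow, mul_pow, Complex.norm_real,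
    Real.norm_eq_abs, sq_abs]
  simp

theorem uniform_exponential_decay
    (V : Plane → ℝ) (Ω α : ℝ) (Q : Plane → ℝ)
    (hV : V110 V) (hΩ : 0 < Ω) (hsub : SubCritical V Ω) (hCV : CondV V Ω α)
    (hQ : IsGroundState Q)
    (astar : ℝ) (hastar : astar = ∫ x : Plane, (Q x) ^ 2)
    (u : ℝ → Plane → ℂ)
    (hmin : ∀ a ∈ Ioo (0 : ℝ) astar, IsMinimizer V Ω a (u a))
    (xa : ℝ → Plane) (θ : ℝ → ℝ)
    (hxa : ∀ a ∈ Ioo (0 : ℝ) astar, ∀ y : Plane, ‖u a y‖ ≤ ‖u a (xa a)‖)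
    (hθ : ∀ a, θ a ∈ Ico (0 : ℝ) (2 * Real.pi))
 :
    ∃ R C : ℝ, 0 < R ∧ 0 < C ∧ ∀ᶠ a in 𝓝[<] astar, ∀ y : Plane, R ≤ ‖y‖ →
      ‖wfam Ω u xa a (θ a) y‖ ≤ C * Real.exp (-‖y‖ / (3 * Real.sqrt astar)) := by
  have hA : 0 < astar := hastar ▸ hQ.integral_sq_pos
  have hGN := gn_of_minimizers hV hA hmin
  obtain ⟨δ, R, C, hδ, hR, hC, H⟩ := exists_density_decay hGN hA
  obtain ⟨D₀, hD₀, hpot⟩ := exists_potBound_le astar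
    (by positivity : 0 < min (2 * δ / astar) (1 / (10 * astar)))
  refine ⟨R, Real.sqrt C, hR, Real.sqrt_pos.2 hC, ?_⟩
  filter_upwards [hQ.eventually_Ea_le hV hCV.2.2.2.2 hastar hGN hmin
    (-(astar / 2 * potBound astar D₀ + 1)), Ioo_mem_nhdsLT hA] with a hE ha y hy
  set D := ∫ x, gradAbsSq (u a) x with hD
  obtain ⟨hE1, hE2⟩ := (hmin a ha).energy_bounds hV hCV.2.1 hGN ha.1 ha.2.le hD.symm
  obtain ⟨hG, hS⟩ := hE2 (hE.trans (by
    have := mul_nonneg (half_pos hA).le (potBound_nonneg hA.le D₀)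
    linarith))
  have hDD : D₀ ≤ D := by
    by_contra! hlt
    have := mul_le_mul_of_nonneg_left (potBound_mono hA.le hlt.le) (half_pos hA).le
    linarith
  have hD0 : 0 < D := by linarith
  have hp := hpot D hDD
  have hp1 := hp.trans (mul_le_mul_of_nonneg_right (min_le_left _ _) hD0.le)
  have hp2 := hp.trans (mul_le_mul_of_nonneg_right (min_le_right _ _) hD0.le)
  have hε : 0 < epsOf u a := Real.rpow_pos_of_pos hD0 _
  have hεD : epsOf u a ^ 2 * D = 1 := by
    rw [epsOf, ← hD, ← Real.rpow_natCast, ← Real.rpow_mul hD0.le]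
    norm_num [Real.rpow_neg_one, hD0.ne']
  obtain ⟨hInH, hmass⟩ := (hmin a ha).1
  have key := H (u a) (xa a) D (epsOf u a) _ hInH.1 rfl hD0 hε hεD (hmass.trans_le ha.2.le) hS
    (by
      have : 1 / (10 * astar) * D = 1 / 10 * (D / astar) := by field_simp
      linarith) (hxa a ha)
    (by
      have h1 := mul_le_mul_of_nonneg_left hp1 hA.le
      have : astar * (2 * δ / astar * D) = 2 * δ * D := by field_simp
      linarith) y hy
  rw [← norm_wfam_sq Ω u xa a (θ a)] at key
  refine le_of_pow_le_pow_left₀ two_ne_zero (by positivity) ?_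
  have e : 2 * (-‖y‖ / (3 * Real.sqrt astar)) = -(2 / (3 * Real.sqrt astar) * ‖y‖) := by ring
  rwa [mul_pow, Real.sq_sqrt hC.le, ← Real.exp_nat_mul, Nat.cast_ofNat, e]

end
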